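/- Let Ω and Ω̃ be Jordan domains in ℂ, let S be a relative Schottky set in Ω whose 2-dimensional Lebesgue measure is zero, let S̃ be a relative Schottky set in Ω̃, and let f : S → S̃ be a locally quasisymmetric homeomorphism. Then f is locally bi-Lipschitz, and at least one of the two maps g = f or g = (z ↦ conj(f(z))) has the following property: for every p ∈ S the limit g'(p) = lim_{q→p, q∈S} (g(q) − g(p))/(q − p) exists and is nonzero, and the function p ↦ g'(p) is continuous on S. (If f is orientation preserving this holds for g = f, i.e., f is conformal on S with continuous nonvanishing derivative.) -/

import Mathlib

open Set Metric MeasureTheory Filter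
open scoped NNReal ENNReal Topology

noncomputable section

/-- A (nonempty, open, connected) domain in the complex plane. -/
def IsPlaneDomain (Ω : Set ℂ) : Prop := IsOpen Ω ∧ IsConnected Ω

/-- A family of open round discs (given by centers `c` and radii `r`) whose closures
are contained in `Ω` and are pairwise disjoint. -/
def IsSchottkyFamily {I : Type*} (Ω : Set ℂ) (c : I → ℂ) (r : I → ℝ) : Prop :=
  (∀ i, 0 < r i) ∧ (∀ i, closedBall (c i) (r i) ⊆ Ω) ∧
    Pairwise fun i j => Disjoint (closedBall (c i) (r i)) (closedBall (c j) (r j))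

/-- `S` is a relative Schottky set in the domain `Ω`. -/
def IsRelativeSchottkySet (Ω S : Set ℂ) : Prop :=
  IsPlaneDomain Ω ∧
    ∃ (I : Type) (c : I → ℂ) (r : I → ℝ),
      IsSchottkyFamily Ω c r ∧ S = Ω \ ⋃ i, ball (c i) (r i)

/-- A Jordan domain: a bounded domain whose boundary is an embedded circle, and which is
a connected component of the complement of its boundary. -/
def IsJordanDomain (Ω : Set ℂ) : Prop :=
  IsPlaneDomain Ω ∧ Bornology.IsBounded Ω ∧
    (∃ γ : ℂ → ℂ, ContinuousOn γ (sphere (0 : ℂ) 1) ∧ InjOn γ (sphere (0 : ℂ) 1) ∧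
      γ '' sphere (0 : ℂ) 1 = frontier Ω) ∧
    ∀ p ∈ Ω, connectedComponentIn (frontier Ω)ᶜ p = Ω

/-- `f : ℂ → ℂ` restricts to a homeomorphism from `S` onto `T`. -/
def IsHomeoOn (f : ℂ → ℂ) (S T : Set ℂ) : Prop :=
  ∃ e : S ≃ₜ T, ∀ z : S, (e z : ℂ) = f (z : ℂ)

/-- `f` is `η`-quasisymmetric on `X`. -/
def QuasisymmetricWith (η : ℝ≥0 ≃ₜ ℝ≥0) (f : ℂ → ℂ) (X : Set ℂ) : Prop :=
  ∀ p ∈ X, ∀ q ∈ X, ∀ s ∈ X, ∀ t : ℝ≥0,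
    dist p q ≤ (t : ℝ) * dist p s → dist (f p) (f q) ≤ (η t : ℝ) * dist (f p) (f s)

/-- `f` is locally quasisymmetric on `X`: its restriction to every compact subset of `X`
is quasisymmetric. -/
def LocallyQuasisymmetricOn (f : ℂ → ℂ) (X : Set ℂ) : Prop :=
  ∀ K ⊆ X, IsCompact K → ∃ η : ℝ≥0 ≃ₜ ℝ≥0, QuasisymmetricWith η f K

/-- `f` is locally bi-Lipschitz on `S`. -/
def LocallyBiLipschitzOn (f : ℂ → ℂ) (S : Set ℂ) : Prop :=
  ∀ p ∈ S, ∃ U ∈ 𝓝[S] p, ∃ L : ℝ, 1 ≤ L ∧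
    ∀ x ∈ U, ∀ y ∈ U,
      dist x y / L ≤ dist (f x) (f y) ∧ dist (f x) (f y) ≤ L * dist x y

open Complex in
/-- A nonvanishing continuous function on a simply connected space has a continuous logarithm. -/
theorem exists_continuous_log {X : Type*} [TopologicalSpace X] [LocallyPathConnectedSpace X]
    [SimplyConnectedSpace X] {g : X → ℂ} (hg : Continuous g) (h0 : ∀ x, g x ≠ 0) :
    ∃ u : X → ℂ, Continuous u ∧ ∀ x, g x = exp (u x) := by
  obtain ⟨x₀⟩ := (inferInstance : Nonempty X)
  rcases isCoveringMapOn_exp.existsUnique_continuousMap_lifts ⟨g, hg⟩ (exp_log (h0 x₀))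
    (fun x ↦ h0 x) with ⟨f, ⟨-, hf⟩, -⟩
  exact ⟨f, f.continuous, fun x ↦ (congrFun hf x).symm⟩

open Complex in
theorem exists_int_of_exp_eq_one {X : Type*} [TopologicalSpace X] [PreconnectedSpace X]
    {a : X → ℂ} (ha : Continuous a) (h : ∀ x, exp (a x) = 1) :
    ∃ n : ℤ, ∀ x, a x = n * (2 * Real.pi * I) := by
  have h1 : ∀ x, ∃ n : ℤ, a x = n * (2 * Real.pi * I) := fun x ↦ exp_eq_one_iff.1 (h x)
  choose n hn using h1
  have hpi : (2 * Real.pi : ℝ) ≠ 0 := by positivity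
  have hre : ∀ x, ((n x : ℤ) : ℝ) = (a x).im / (2 * Real.pi) := by
    intro x
    rw [hn x]
    simp
  have hnc : Continuous fun x ↦ ((n x : ℤ) : ℝ) := by
    simp_rw [hre]; fun_prop
  have hnc' : Continuous n := by
    rw [Int.isClosedEmbedding_coe_real.isEmbedding.continuous_iff]
    exact hnc
  rcases isEmpty_or_nonempty X with hX | ⟨⟨x₀⟩⟩
  · exact ⟨0, fun x ↦ (hX.false x).elim⟩
  · refine ⟨n x₀, fun x ↦ ?_⟩
    rw [hn x, (PreconnectedSpace.constant inferInstance hnc' : n x = n x₀)]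

/-- The nonvanishing `2π`-periodic function `g` has winding number `n`. -/
def LoopWind (g : ℝ → ℂ) (n : ℤ) : Prop :=
  ∃ u : ℝ → ℂ, Continuous u ∧ (∀ t, g t = Complex.exp (u t)) ∧
    ∀ t, u (t + 2 * Real.pi) = u t + n * (2 * Real.pi * Complex.I)

theorem LoopWind.unique {g : ℝ → ℂ} {n m : ℤ} (hn : LoopWind g n) (hm : LoopWind g m) :
    n = m := by
  obtain ⟨u, hu, hgu, hup⟩ := hn
  obtain ⟨v, hv, hgv, hvp⟩ := hm
  obtain ⟨k, hk⟩ := exists_int_of_exp_eq_one (a := fun t ↦ u t - v t)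
    (by fun_prop) (by
      intro t
      rw [Complex.exp_sub, ← hgu, ← hgv, div_self]
      rw [hgu]; exact Complex.exp_ne_zero _)
  have h1 := hk 0
  have h2 := hk (0 + 2 * Real.pi)
  simp only [hup, hvp] at h2
  have h3 : ((n : ℂ) - m) * (2 * Real.pi * Complex.I) = 0 := by linear_combination h2 - h1
  have h4 : (2 * Real.pi * Complex.I : ℂ) ≠ 0 := Complex.two_pi_I_ne_zero
  have h5 := (mul_eq_zero.1 h3).resolve_right h4
  exact_mod_cast sub_eq_zero.1 h5

theorem LoopWind.homotopy {H : ℝ → ℝ → ℂ} {n : ℤ} (hcont : Continuous fun p : ℝ × ℝ ↦ H p.1 p.2)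
    (h0 : ∀ s t, H s t ≠ 0) (hper : ∀ s t, H s (t + 2 * Real.pi) = H s t)
    (hn : LoopWind (H 0) n) : LoopWind (H 1) n := by
  obtain ⟨U, hU, hHU⟩ := exists_continuous_log hcont (fun p ↦ h0 _ _)
  obtain ⟨k, hk⟩ := exists_int_of_exp_eq_one
    (a := fun p : ℝ × ℝ ↦ U (p.1, p.2 + 2 * Real.pi) - U p) (by fun_prop) (by
      intro p
      rw [Complex.exp_sub, ← hHU, ← hHU, hper, div_self]
      exact h0 _ _)
  have hw : ∀ s, LoopWind (H s) k := fun s ↦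
    ⟨fun t ↦ U (s, t), by fun_prop, fun t ↦ hHU (s, t), fun t ↦ by rw [← hk (s, t)]; ring⟩
  rw [hn.unique (hw 0)]
  exact hw 1

/-- The nonvanishing function `g` has winding number `n` along the circle of center `c` and
radius `r`. -/
def Wind (g : ℂ → ℂ) (c : ℂ) (r : ℝ) (n : ℤ) : Prop :=
  LoopWind (fun t ↦ g (circleMap c r t)) n

namespace Wind

variable {g h : ℂ → ℂ} {c : ℂ} {r : ℝ} {n m : ℤ}

theorem comp_circleMap_continuous (hr : 0 ≤ r) (hg : ContinuousOn g (sphere c r)) :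
    Continuous fun t ↦ g (circleMap c r t) :=
  hg.comp_continuous (continuous_circleMap c r) (circleMap_mem_sphere c hr)

theorem exists_eq (hr : 0 ≤ r) (hg : ContinuousOn g (sphere c r))
    (h0 : ∀ z ∈ sphere c r, g z ≠ 0) : ∃ n, Wind g c r n := by
  obtain ⟨u, hu, hgu⟩ := exists_continuous_log (comp_circleMap_continuous hr hg)
    (fun t ↦ h0 _ (circleMap_mem_sphere c hr t))
  obtain ⟨n, hn⟩ := exists_int_of_exp_eq_one (a := fun t ↦ u (t + 2 * Real.pi) - u t)
    (by fun_prop) (by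
      intro t
      rw [Complex.exp_sub, ← hgu, ← hgu, periodic_circleMap, div_self]
      exact h0 _ (circleMap_mem_sphere c hr t))
  exact ⟨n, u, hu, hgu, fun t ↦ by rw [← hn t]; ring⟩

theorem unique (hn : Wind g c r n) (hm : Wind g c r m) : n = m :=
  LoopWind.unique hn hm

theorem congr (hn : Wind g c r n) (hr : 0 ≤ r) (hgh : ∀ z ∈ sphere c r, g z = h z) :
    Wind h c r n := by
  obtain ⟨u, hu, hgu, hup⟩ := hn
  exact ⟨u, hu, fun t ↦ (hgh _ (circleMap_mem_sphere c hr t)).symm.trans (hgu t), hup⟩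

theorem mul (hn : Wind g c r n) (hm : Wind h c r m) :
    Wind (fun z ↦ g z * h z) c r (n + m) := by
  obtain ⟨u, hu, hgu, hup⟩ := hn
  obtain ⟨v, hv, hgv, hvp⟩ := hm
  refine ⟨fun t ↦ u t + v t, by fun_prop,
    fun t ↦ by simp only [hgu, hgv, Complex.exp_add], fun t ↦ ?_⟩
  simp only [hup, hvp]
  push_cast
  ring

theorem inv (hn : Wind g c r n) : Wind (fun z ↦ (g z)⁻¹) c r (-n) := by
  obtain ⟨u, hu, hgu, hup⟩ := hn
  refine ⟨fun t ↦ -u t, by fun_prop, fun t ↦ by simp only [hgu, Complex.exp_neg], fun t ↦ ?_⟩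
  simp only [hup]
  push_cast
  ring

theorem div (hn : Wind g c r n) (hm : Wind h c r m) :
    Wind (fun z ↦ g z / h z) c r (n - m) := by
  simpa only [div_eq_mul_inv, sub_eq_add_neg] using hn.mul hm.inv

theorem const {a : ℂ} (ha : a ≠ 0) : Wind (fun _ ↦ a) c r 0 :=
  ⟨fun _ ↦ Complex.log a, by fun_prop, fun _ ↦ (Complex.exp_log ha).symm, by simp⟩

theorem conj (hn : Wind g c r n) : Wind (fun z ↦ (starRingEnd ℂ) (g z)) c r (-n) := by
  obtain ⟨u, hu, hgu, hup⟩ := hn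
  refine ⟨fun t ↦ (starRingEnd ℂ) (u t), by fun_prop, fun t ↦ by simp only [hgu, Complex.exp_conj],
    fun t ↦ ?_⟩
  simp [hup, Complex.conj_ofNat]

theorem pow (hn : Wind g c r n) (k : ℕ) : Wind (fun z ↦ g z ^ k) c r (k * n) := by
  induction k with
  | zero => simpa using const (c := c) (r := r) one_ne_zero
  | succ k ih =>
    have := ih.mul hn
    simp only [← pow_succ] at this
    convert this using 1
    push_cast; ring

theorem zpow (hn : Wind g c r n) (k : ℤ) : Wind (fun z ↦ g z ^ k) c r (k * n) := by
  cases k with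
  | ofNat k => simpa using hn.pow k
  | negSucc k =>
    have := (hn.pow (k + 1)).inv
    simp only [zpow_negSucc]
    convert this using 1
    rw [Int.negSucc_eq]; push_cast; ring

theorem homotopy {H : ℝ → ℂ → ℂ} (hr : 0 ≤ r)
    (hH : ContinuousOn (fun p : ℝ × ℂ ↦ H p.1 p.2) (Icc 0 1 ×ˢ sphere c r))
    (h0 : ∀ s ∈ Icc (0 : ℝ) 1, ∀ z ∈ sphere c r, H s z ≠ 0)
    (hn : Wind (H 0) c r n) : Wind (H 1) c r n := by
  let π' : ℝ → ℝ := fun s ↦ (projIcc 0 1 zero_le_one s : ℝ)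
  have hπ : Continuous π' := continuous_subtype_val.comp continuous_projIcc
  have hπm : ∀ s, π' s ∈ Icc (0 : ℝ) 1 := fun s ↦ (projIcc 0 1 zero_le_one s).2
  have hcont : Continuous fun p : ℝ × ℝ ↦ H (π' p.1) (circleMap c r p.2) := by
    have h1 : Continuous fun p : ℝ × ℝ ↦ (π' p.1, circleMap c r p.2) :=
      (hπ.comp continuous_fst).prodMk ((continuous_circleMap c r).comp continuous_snd)
    exact hH.comp_continuous h1 fun p ↦ ⟨hπm _, circleMap_mem_sphere c hr _⟩
  have h0' : π' 0 = 0 := by simp [π']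
  have h1' : π' 1 = 1 := by simp [π']
  have key := LoopWind.homotopy (H := fun s t ↦ H (π' s) (circleMap c r t)) (n := n) hcont
    (fun s t ↦ h0 _ (hπm _) _ (circleMap_mem_sphere c hr _))
    (fun s t ↦ by rw [periodic_circleMap]) (by rw [h0']; exact hn)
  rw [h1'] at key
  exact key

theorem of_norm_sub_lt (hr : 0 ≤ r) (hg : ContinuousOn g (sphere c r))
    (hh : ContinuousOn h (sphere c r)) (hlt : ∀ z ∈ sphere c r, ‖g z - h z‖ < ‖h z‖)
    (hn : Wind h c r n) : Wind g c r n := by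
  have key := homotopy (H := fun s z ↦ h z + s * (g z - h z)) (c := c) (r := r) (n := n) hr ?_ ?_
    (by simpa using hn)
  · simpa using key
  · have hg' : ContinuousOn (fun p : ℝ × ℂ ↦ g p.2) (Icc 0 1 ×ˢ sphere c r) :=
      hg.comp continuousOn_snd fun p hp ↦ hp.2
    have hh' : ContinuousOn (fun p : ℝ × ℂ ↦ h p.2) (Icc 0 1 ×ˢ sphere c r) :=
      hh.comp continuousOn_snd fun p hp ↦ hp.2
    have hs : ContinuousOn (fun p : ℝ × ℂ ↦ (p.1 : ℂ)) (Icc 0 1 ×ˢ sphere c r) := by fun_prop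
    exact hh'.add (hs.mul (hg'.sub hh'))
  · intro s hs z hz h0
    have h1 := hlt z hz
    have h2 : ‖h z‖ = s * ‖g z - h z‖ := by
      have : h z = -(s * (g z - h z)) := by linear_combination h0
      rw [this, norm_neg, norm_mul, Complex.norm_real, Real.norm_of_nonneg hs.1]
      congr 2
      rw [← this]
    have h3 := hs.2
    have h4 := norm_nonneg (g z - h z)
    nlinarith

theorem id_sub_center (hr : 0 < r) : Wind (fun z ↦ z - c) c r 1 := by
  refine ⟨fun t ↦ Complex.log r + t * Complex.I, by fun_prop, fun t ↦ ?_, fun t ↦ ?_⟩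
  · rw [Complex.exp_add, Complex.exp_log (by exact_mod_cast hr.ne')]; simp [circleMap]
  · push_cast; ring

theorem id_sub_of_mem {a : ℂ} (ha : a ∈ ball c r) : Wind (fun z ↦ z - a) c r 1 := by
  have hr : 0 < r := (dist_nonneg.trans_lt ha)
  refine of_norm_sub_lt hr.le (by fun_prop) (by fun_prop) ?_ (id_sub_center hr)
  intro z hz
  rw [mem_ball, dist_eq_norm] at ha
  rw [mem_sphere, dist_eq_norm] at hz
  rw [hz, show z - a - (z - c) = -(a - c) by ring, norm_neg]
  exact ha

theorem id_sub_of_notMem {a : ℂ} (hr : 0 ≤ r) (ha : a ∉ closedBall c r) :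
    Wind (fun z ↦ z - a) c r 0 := by
  rw [mem_closedBall, dist_eq_norm, not_le] at ha
  have hca : c - a ≠ 0 := by
    intro h
    rw [← norm_neg, neg_sub, h, norm_zero] at ha
    linarith
  refine of_norm_sub_lt hr (by fun_prop) (by fun_prop) ?_ (const hca)
  intro z hz
  rw [mem_sphere, dist_eq_norm] at hz
  rw [show z - a - (c - a) = z - c by ring, hz, ← norm_neg, neg_sub]
  exact ha

/-- Winding number zero means that there is a continuous logarithm along the circle. -/
theorem exists_log (hr : 0 < r) (hn : Wind g c r 0) :
    ∃ u : ℂ → ℂ, ContinuousOn u (sphere c r) ∧ ∀ z ∈ sphere c r, g z = Complex.exp (u z) := by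
  obtain ⟨u, hu, hgu, hup⟩ := hn
  have hper : Function.Periodic u (2 * Real.pi) := fun t ↦ by simpa using hup t
  have hrc : (r : ℂ) ≠ 0 := by exact_mod_cast hr.ne'
  have hcirc : ∀ t₀ : ℝ, ∀ z ∈ sphere c r,
      circleMap c r (t₀ + Complex.arg ((z - c) / (circleMap c r t₀ - c))) = z := by
    intro t₀ z hz
    have hz' : ‖z - c‖ = r := by rwa [mem_sphere, dist_eq_norm] at hz
    have hd : circleMap c r t₀ - c = r * Complex.exp (t₀ * Complex.I) := by simp [circleMap]
    have hnorm : ‖(z - c) / (circleMap c r t₀ - c)‖ = 1 := by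
      rw [norm_div, hz', hd, norm_mul, Complex.norm_exp_ofReal_mul_I, Complex.norm_real,
        Real.norm_of_nonneg hr.le, mul_one, div_self hr.ne']
    have h1 := Complex.norm_mul_exp_arg_mul_I ((z - c) / (circleMap c r t₀ - c))
    rw [hnorm, Complex.ofReal_one, one_mul] at h1
    rw [circleMap]
    push_cast
    rw [add_mul, Complex.exp_add, h1, hd]
    have := Complex.exp_ne_zero (t₀ * Complex.I)
    field_simp
    ring
  have hval : ∀ s t : ℝ, circleMap c r s = circleMap c r t → u s = u t := by
    intro s t hst
    rw [circleMap_eq_circleMap_iff c hr.ne'] at hst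
    obtain ⟨n, hn⟩ := hst
    have : s = t + n * (2 * Real.pi) := by
      have h2 : (s : ℂ) * Complex.I = (t + n * (2 * Real.pi) : ℝ) * Complex.I := by
        rw [hn]; push_cast; ring
      exact_mod_cast mul_right_cancel₀ Complex.I_ne_zero h2
    rw [this]
    exact hper.int_mul n t
  refine ⟨fun z ↦ u (0 + Complex.arg ((z - c) / (circleMap c r 0 - c))), ?_, fun z hz ↦ ?_⟩
  · intro z₀ hz₀
    set t₀ := 0 + Complex.arg ((z₀ - c) / (circleMap c r 0 - c)) with ht₀
    have hzt : circleMap c r t₀ = z₀ := hcirc 0 z₀ hz₀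
    have hne : z₀ - c ≠ 0 := by
      intro h
      rw [mem_sphere, dist_eq_norm, h, norm_zero] at hz₀
      exact hr.ne hz₀
    have h1 : ContinuousWithinAt
        (fun z ↦ u (t₀ + Complex.arg ((z - c) / (circleMap c r t₀ - c)))) (sphere c r) z₀ := by
      apply ContinuousAt.continuousWithinAt
      apply hu.continuousAt.comp
      apply ContinuousAt.add continuousAt_const
      apply ContinuousAt.comp (g := Complex.arg)
      · apply Complex.continuousAt_arg
        rw [hzt, div_self hne]
        simp
      · fun_prop
    refine h1.congr_of_mem (fun z hz ↦ ?_) hz₀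
    exact hval _ _ ((hcirc 0 z hz).trans (hcirc t₀ z hz).symm)
  · rw [← hgu]
    congr 1
    exact (hcirc 0 z hz).symm

end Wind

/-- A nonvanishing continuous function on a disc has winding number zero. -/
theorem wind_zero_of_closedBall {g : ℂ → ℂ} {c : ℂ} {r : ℝ} (hr : 0 < r)
    (hg : ContinuousOn g (closedBall c r)) (h0 : ∀ z ∈ closedBall c r, g z ≠ 0) :
    Wind g c r 0 := by
  have hmem : ∀ s ∈ Icc (0 : ℝ) 1, ∀ z ∈ sphere c r, c + s * (z - c) ∈ closedBall c r := by
    intro s hs z hz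
    rw [mem_closedBall, dist_eq_norm, add_sub_cancel_left, norm_mul, Complex.norm_real,
      Real.norm_of_nonneg hs.1]
    rw [mem_sphere, dist_eq_norm] at hz
    rw [hz]
    nlinarith [hs.2]
  have key := Wind.homotopy (H := fun s z ↦ g (c + s * (z - c))) (c := c) (r := r) (n := 0) hr.le
    (hg.comp (by fun_prop) fun p hp ↦ hmem p.1 hp.1 p.2 hp.2)
    (fun s hs z hz ↦ h0 _ (hmem s hs z hz))
    (by simpa using Wind.const (h0 c (mem_closedBall_self hr.le)))
  simpa using key

/-- `ψ` is a lift to the universal cover of an injective self-map of the circle of degree `n`. -/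
structure IsCircleLift (ψ : ℝ → ℝ) (n : ℤ) : Prop where
  cont : Continuous ψ
  add_period : ∀ t, ψ (t + 2 * Real.pi) = ψ t + n * (2 * Real.pi)
  inj : ∀ s t (k : ℤ), ψ s = ψ t + k * (2 * Real.pi) → ∃ l : ℤ, s = t + l * (2 * Real.pi)

namespace IsCircleLift

variable {ψ : ℝ → ℝ} {n : ℤ}

theorem add_int_mul (h : IsCircleLift ψ n) (t : ℝ) (l : ℤ) :
    ψ (t + l * (2 * Real.pi)) = ψ t + l * (n * (2 * Real.pi)) := by
  induction l with
  | zero => simp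
  | succ i ih =>
    have := h.add_period (t + i * (2 * Real.pi))
    push_cast at ih ⊢
    rw [show t + (i + 1) * (2 * Real.pi) = t + i * (2 * Real.pi) + 2 * Real.pi by ring, this, ih]
    ring
  | pred i ih =>
    have := h.add_period (t + (-i - 1) * (2 * Real.pi))
    push_cast at ih ⊢
    rw [show t + (-i - 1) * (2 * Real.pi) + 2 * Real.pi = t + -i * (2 * Real.pi) by ring, ih]
      at this
    linarith

theorem injective (h : IsCircleLift ψ n) (hn : n ≠ 0) : Function.Injective ψ := by
  intro s t hst
  obtain ⟨l, hl⟩ := h.inj s t 0 (by simpa using hst)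
  rw [hl, h.add_int_mul] at hst
  have h1 : (l : ℝ) * (n * (2 * Real.pi)) = 0 := by linarith
  have hn' : (n : ℝ) ≠ 0 := by exact_mod_cast hn
  have hl0 : (l : ℝ) = 0 := by
    rcases mul_eq_zero.1 h1 with h2 | h2
    · exact h2
    · exact absurd h2 (mul_ne_zero hn' Real.two_pi_pos.ne')
  rw [hl, hl0]; simp

theorem ne_zero (h : IsCircleLift ψ n) : n ≠ 0 := by
  rintro rfl
  have hpi := Real.pi_pos
  have h2 : ψ (2 * Real.pi) = ψ 0 := by simpa using h.add_period 0
  have hne : ψ Real.pi ≠ ψ 0 := by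
    intro he
    obtain ⟨l, hl⟩ := h.inj Real.pi 0 0 (by simpa using he)
    have h3 : (1 : ℝ) = 2 * l := by
      have : Real.pi * (1 - 2 * l) = 0 := by linarith
      have := (mul_eq_zero.1 this).resolve_left hpi.ne'
      linarith
    have h4 : (1 : ℤ) = 2 * l := by exact_mod_cast h3
    omega
  set y := (ψ Real.pi + ψ 0) / 2 with hy
  have key : ∃ s ∈ Ioo 0 Real.pi, ∃ t ∈ Ioo Real.pi (2 * Real.pi), ψ s = ψ t := by
    rcases lt_or_gt_of_ne hne with hlt | hlt
    · obtain ⟨s, hs, hsy⟩ := intermediate_value_Ioo' hpi.le h.cont.continuousOn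
        (show y ∈ Ioo (ψ Real.pi) (ψ 0) from ⟨by linarith, by linarith⟩)
      obtain ⟨t, ht, hty⟩ := intermediate_value_Ioo (by linarith : Real.pi ≤ 2 * Real.pi)
        h.cont.continuousOn
        (show y ∈ Ioo (ψ Real.pi) (ψ (2 * Real.pi)) by rw [h2]; exact ⟨by linarith, by linarith⟩)
      exact ⟨s, hs, t, ht, hsy.trans hty.symm⟩
    · obtain ⟨s, hs, hsy⟩ := intermediate_value_Ioo hpi.le h.cont.continuousOn
        (show y ∈ Ioo (ψ 0) (ψ Real.pi) from ⟨by linarith, by linarith⟩)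
      obtain ⟨t, ht, hty⟩ := intermediate_value_Ioo' (by linarith : Real.pi ≤ 2 * Real.pi)
        h.cont.continuousOn
        (show y ∈ Ioo (ψ (2 * Real.pi)) (ψ Real.pi) by rw [h2]; exact ⟨by linarith, by linarith⟩)
      exact ⟨s, hs, t, ht, hsy.trans hty.symm⟩
  obtain ⟨s, hs, t, ht, hst⟩ := key
  obtain ⟨l, hl⟩ := h.inj s t 0 (by simpa using hst)
  have h5 : -(1 : ℝ) < l := by
    have : -(2 * Real.pi) < l * (2 * Real.pi) := by linarith [hs.1, ht.2]
    nlinarith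
  have h6 : (l : ℝ) < 0 := by
    have : l * (2 * Real.pi) < 0 := by linarith [hs.2, ht.1]
    nlinarith
  have h5' : -(1 : ℤ) < l := by exact_mod_cast h5
  have h6' : (l : ℤ) < 0 := by exact_mod_cast h6
  omega

theorem eq_one_or_eq_neg_one (h : IsCircleLift ψ n) : n = 1 ∨ n = -1 := by
  have hpi := Real.pi_pos
  have h2 : ψ (2 * Real.pi) = ψ 0 + n * (2 * Real.pi) := by simpa using h.add_period 0
  by_contra! hcon
  have hn0 := h.ne_zero
  have key : ∃ t ∈ Ioo 0 (2 * Real.pi), ∃ k : ℤ, ψ t = ψ 0 + k * (2 * Real.pi) := by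
    rcases lt_or_gt_of_ne hn0 with hlt | hlt
    · have hn : n < -1 := by omega
      have hn' : (n : ℝ) < -1 := by exact_mod_cast hn
      obtain ⟨t, ht, hty⟩ := intermediate_value_Ioo' (by linarith : 0 ≤ 2 * Real.pi)
        h.cont.continuousOn
        (show ψ 0 + (-1 : ℤ) * (2 * Real.pi) ∈ Ioo (ψ (2 * Real.pi)) (ψ 0) by
          rw [h2]; push_cast; exact ⟨by nlinarith, by linarith⟩)
      exact ⟨t, ht, -1, hty⟩
    · have hn : 1 < n := by omega
      have hn' : 1 < (n : ℝ) := by exact_mod_cast hn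
      obtain ⟨t, ht, hty⟩ := intermediate_value_Ioo (by linarith : 0 ≤ 2 * Real.pi)
        h.cont.continuousOn
        (show ψ 0 + (1 : ℤ) * (2 * Real.pi) ∈ Ioo (ψ 0) (ψ (2 * Real.pi)) by
          rw [h2]; push_cast; exact ⟨by linarith, by nlinarith⟩)
      exact ⟨t, ht, 1, hty⟩
  obtain ⟨t, ht, k, hk⟩ := key
  obtain ⟨l, hl⟩ := h.inj t 0 k hk
  have h5 : (0 : ℝ) < l := by
    have : 0 < l * (2 * Real.pi) := by linarith [ht.1]
    nlinarith
  have h6 : (l : ℝ) < 1 := by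
    have : l * (2 * Real.pi) < 2 * Real.pi := by linarith [ht.2]
    nlinarith
  have h5' : (0 : ℤ) < l := by exact_mod_cast h5
  have h6' : (l : ℤ) < 1 := by exact_mod_cast h6
  omega

theorem strictMono (h : IsCircleLift ψ 1) : StrictMono ψ := by
  rcases h.cont.strictMono_of_inj (h.injective one_ne_zero) with h1 | h1
  · exact h1
  · have h2 := h.add_period 0
    have h3 := h1 (show (0 : ℝ) < 0 + 2 * Real.pi by linarith [Real.pi_pos])
    push_cast at h2
    linarith [Real.pi_pos]

end IsCircleLift

theorem circleMap_inj_period {c : ℂ} {r : ℝ} (hr : r ≠ 0) {s t : ℝ}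
    (h : circleMap c r s = circleMap c r t) : ∃ l : ℤ, s = t + l * (2 * Real.pi) := by
  rw [circleMap_eq_circleMap_iff c hr] at h
  obtain ⟨n, hn⟩ := h
  refine ⟨n, ?_⟩
  have h2 : (s : ℂ) * Complex.I = (t + n * (2 * Real.pi) : ℝ) * Complex.I := by
    rw [hn]; push_cast; ring
  exact_mod_cast mul_right_cancel₀ Complex.I_ne_zero h2

theorem circleMap_add_int_mul {c : ℂ} {r : ℝ} (t : ℝ) (l : ℤ) :
    circleMap c r (t + l * (2 * Real.pi)) = circleMap c r t :=
  (periodic_circleMap c r).int_mul l t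

/-- An injective continuous map between circles has a lift to the universal covers. -/
theorem exists_isCircleLift {f : ℂ → ℂ} {c c' : ℂ} {r r' : ℝ} {n : ℤ} (hr : 0 < r)
    (hinj : InjOn f (sphere c r)) (hmaps : MapsTo f (sphere c r) (sphere c' r'))
    (hw : Wind (fun z ↦ f z - c') c r n) :
    ∃ ψ : ℝ → ℝ, IsCircleLift ψ n ∧ ∀ t, f (circleMap c r t) = circleMap c' r' (ψ t) := by
  obtain ⟨u, hu, hfu, hup⟩ := hw
  have hmem := circleMap_mem_sphere c hr.le
  have hf : ∀ t, f (circleMap c r t) = circleMap c' r' ((u t).im) := by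
    intro t
    have h1 : ‖f (circleMap c r t) - c'‖ = r' := by
      have := hmaps (hmem t)
      rwa [mem_sphere, dist_eq_norm] at this
    have h2 := hfu t
    simp only at h2
    have h3 : Real.exp ((u t).re) = r' := by rw [← h1, h2, Complex.norm_exp]
    have h4 : circleMap c' r' ((u t).im) = c' + Complex.exp (u t) := by
      rw [circleMap, ← h3, Complex.ofReal_exp, ← Complex.exp_add, Complex.re_add_im]
    rw [h4, ← h2]
    ring
  refine ⟨fun t ↦ (u t).im, ⟨by fun_prop, fun t ↦ ?_, fun s t k hk ↦ ?_⟩, hf⟩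
  · rw [hup]; simp
  · have h1 : f (circleMap c r s) = f (circleMap c r t) := by
      rw [hf, hf]
      rw [hk, circleMap_add_int_mul]
    exact circleMap_inj_period hr.ne' (hinj (hmem s) (hmem t) h1)

namespace LoopWind

variable {g h : ℝ → ℂ} {n m : ℤ}

theorem mul (hn : LoopWind g n) (hm : LoopWind h m) : LoopWind (fun t ↦ g t * h t) (n + m) := by
  obtain ⟨u, hu, hgu, hup⟩ := hn
  obtain ⟨v, hv, hgv, hvp⟩ := hm
  refine ⟨fun t ↦ u t + v t, by fun_prop, fun t ↦ by simp only [hgu, hgv, Complex.exp_add],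
    fun t ↦ ?_⟩
  simp only [hup, hvp]
  push_cast
  ring

theorem inv (hn : LoopWind g n) : LoopWind (fun t ↦ (g t)⁻¹) (-n) := by
  obtain ⟨u, hu, hgu, hup⟩ := hn
  refine ⟨fun t ↦ -u t, by fun_prop, fun t ↦ by simp only [hgu, Complex.exp_neg], fun t ↦ ?_⟩
  simp only [hup]
  push_cast
  ring

theorem ne_zero (hn : LoopWind g n) (t : ℝ) : g t ≠ 0 := by
  obtain ⟨u, hu, hgu, hup⟩ := hn
  rw [hgu]
  exact Complex.exp_ne_zero _

end LoopWind

/-- A polynomial of degree at most one without zeros on the unit circle winds nonnegatively. -/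
theorem loopWind_linear {A B : ℂ} (h : ∀ t, A * circleMap 0 1 t + B ≠ 0) :
    ∃ n : ℤ, 0 ≤ n ∧ LoopWind (fun t ↦ A * circleMap 0 1 t + B) n := by
  by_cases hA : A = 0
  · subst hA
    refine ⟨0, le_rfl, ?_⟩
    have hB : B ≠ 0 := by simpa using h 0
    simp only [zero_mul, zero_add]
    exact Wind.const (c := 0) (r := 1) hB
  · set a := -B / A with ha
    have hfac : ∀ z : ℂ, A * z + B = A * (z - a) := by intro z; rw [ha]; field_simp; ring
    have hna : a ∉ sphere (0 : ℂ) 1 := by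
      intro hmem
      have : a ∈ range (circleMap 0 1) := by rw [range_circleMap]; simpa using hmem
      obtain ⟨t, ht⟩ := this
      apply h t
      rw [hfac, ht]; simp
    simp_rw [hfac]
    by_cases hb : a ∈ ball (0 : ℂ) 1
    · exact ⟨0 + 1, by norm_num,
        (Wind.const (c := 0) (r := 1) hA).mul (Wind.id_sub_of_mem hb)⟩
    · refine ⟨0 + 0, by norm_num, (Wind.const (c := 0) (r := 1) hA).mul
        (Wind.id_sub_of_notMem zero_le_one ?_)⟩
      rw [← ball_union_sphere]
      exact fun hor ↦ hor.elim hb hna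

theorem exists_quadratic_factor (a b c : ℂ) :
    ∃ A B C D : ℂ, ∀ z, a * z ^ 2 + b * z + c = (A * z + B) * (C * z + D) := by
  by_cases ha : a = 0
  · exact ⟨0, 1, b, c, fun z ↦ by rw [ha]; ring⟩
  · obtain ⟨s, hs⟩ := IsAlgClosed.exists_eq_mul_self (discrim a b c)
    refine ⟨a, (b - s) / 2, 1, (b + s) / (2 * a), fun z ↦ ?_⟩
    rw [discrim] at hs
    field_simp
    linear_combination -hs

theorem loopWind_quadratic {a b c : ℂ}
    (h : ∀ t, a * circleMap 0 1 t ^ 2 + b * circleMap 0 1 t + c ≠ 0) :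
    ∃ n : ℤ, 0 ≤ n ∧ LoopWind (fun t ↦ a * circleMap 0 1 t ^ 2 + b * circleMap 0 1 t + c) n := by
  obtain ⟨A, B, C, D, hfac⟩ := exists_quadratic_factor a b c
  simp only [hfac] at h ⊢
  obtain ⟨n, hn, h1⟩ := loopWind_linear fun t ↦ left_ne_zero_of_mul (h t)
  obtain ⟨m, hm, h2⟩ := loopWind_linear fun t ↦ right_ne_zero_of_mul (h t)
  exact ⟨n + m, by omega, h1.mul h2⟩

theorem norm_circleMap_zero_one (t : ℝ) : ‖circleMap 0 1 t‖ = 1 := by simp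

theorem IsCircleLift.loopWind {ψ : ℝ → ℝ} {n : ℤ} (h : IsCircleLift ψ n) :
    LoopWind (fun t ↦ circleMap 0 1 (ψ t)) n := by
  have := h.cont
  refine ⟨fun t ↦ ψ t * Complex.I, by fun_prop, fun t ↦ by simp [circleMap], fun t ↦ ?_⟩
  simp only [h.add_period]
  push_cast
  ring

/-- A loop dominated by another one can be neglected when computing winding numbers. -/
theorem LoopWind.add_of_norm_le {g h : ℝ → ℂ} {n : ℤ} (hn : LoopWind g n) (hg : Continuous g)
    (hh : Continuous h) (hgp : ∀ t, g (t + 2 * Real.pi) = g t)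
    (hhp : ∀ t, h (t + 2 * Real.pi) = h t) (hle : ∀ t, ‖h t‖ ≤ ‖g t‖)
    (h0 : ∀ t, g t + h t ≠ 0) : LoopWind (fun t ↦ g t + h t) n := by
  let σ : ℝ → ℝ := fun s ↦ max 0 (min 1 s)
  have hσ : Continuous σ := by fun_prop
  have key := LoopWind.homotopy (H := fun s t ↦ g t + σ s * h t) (n := n) (by fun_prop) ?_
    (fun s t ↦ by rw [hgp, hhp]) (by simpa [σ] using hn)
  · simpa [σ] using key
  · intro s t hz
    have h1 : ‖g t‖ = σ s * ‖h t‖ := by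
      rw [eq_neg_of_add_eq_zero_left hz, norm_neg, norm_mul, Complex.norm_real,
        Real.norm_of_nonneg (le_max_left _ _)]
    have hσ1 : σ s ≤ 1 := max_le zero_le_one (min_le_left _ _)
    have hg0 := norm_pos_iff.2 (hn.ne_zero t)
    have h2 := hle t
    have h3 : σ s = 1 := by
      by_contra hne
      have : σ s < 1 := lt_of_le_of_ne hσ1 hne
      have := mul_le_mul_of_nonneg_left h2 (le_max_left 0 (min 1 s))
      nlinarith
    apply h0 t
    rw [h3] at hz
    simpa using hz

open ComplexConjugate in
/-- The disc automorphism `z ↦ (p z + q) / (conj q z + conj p)`, `‖q‖ < ‖p‖`, restricted to the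
unit circle. -/
theorem exists_moebius_lift {p q : ℂ} (hpq : ‖q‖ < ‖p‖) :
    (∀ t, conj q * circleMap 0 1 t + conj p ≠ 0) ∧
    ∃ μ : ℝ → ℝ, IsCircleLift μ 1 ∧ ∀ t, circleMap 0 1 (μ t) * (conj q * circleMap 0 1 t + conj p)
      = p * circleMap 0 1 t + q := by
  have hden : ∀ z : ℂ, ‖z‖ = 1 → conj q * z + conj p ≠ 0 := by
    intro z hz h
    have h1 : ‖conj p‖ = ‖conj q * z‖ := by
      rw [eq_neg_of_add_eq_zero_right h, norm_neg]
    rw [norm_mul, hz, RCLike.norm_conj, RCLike.norm_conj] at h1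
    linarith
  have hden' : ∀ t, conj q * circleMap 0 1 t + conj p ≠ 0 := fun t ↦ hden _ (by simp)
  refine ⟨hden', ?_⟩
  have hp : p ≠ 0 := by
    rintro rfl
    rw [norm_zero] at hpq
    linarith [norm_nonneg q]
  let m : ℂ → ℂ := fun z ↦ (p * z + q) / (conj q * z + conj p)
  have hnum : ∀ z : ℂ, ‖z‖ = 1 → ‖p * z + q‖ = ‖conj q * z + conj p‖ := by
    intro z hz
    have hz' : z * conj z = 1 := by rw [Complex.mul_conj, Complex.normSq_eq_norm_sq, hz]; norm_num
    have : p * z + q = z * conj (conj q * z + conj p) := by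
      simp only [map_add, map_mul, Complex.conj_conj]
      linear_combination -q * hz'
    rw [this, norm_mul, hz, one_mul, RCLike.norm_conj]
  have hsph : ∀ z : ℂ, z ∈ sphere (0 : ℂ) 1 → ‖z‖ = 1 := fun z hz ↦ by simpa using hz
  have hmaps : MapsTo m (sphere 0 1) (sphere 0 1) := by
    intro z hz
    have h1 := hden z (hsph z hz)
    simp only [m, mem_sphere_iff_norm, sub_zero, norm_div, hnum z (hsph z hz)]
    exact div_self (norm_ne_zero_iff.2 h1)
  have hinj : InjOn m (sphere 0 1) := by
    intro z hz w hw hzw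
    simp only [m] at hzw
    rw [div_eq_div_iff (hden z (hsph z hz)) (hden w (hsph w hw))] at hzw
    have h1 : (p * conj p - q * conj q) * (z - w) = 0 := by linear_combination hzw
    rcases mul_eq_zero.1 h1 with h2 | h2
    · rw [Complex.mul_conj, Complex.mul_conj, Complex.normSq_eq_norm_sq,
        Complex.normSq_eq_norm_sq] at h2
      have h3 : ‖p‖ ^ 2 - ‖q‖ ^ 2 = 0 := by exact_mod_cast h2
      nlinarith [norm_nonneg q]
    · exact sub_eq_zero.1 h2
  have hroot : -q / p ∈ ball (0 : ℂ) 1 := by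
    rw [mem_ball_zero_iff, norm_div, norm_neg, div_lt_one (norm_pos_iff.2 hp)]
    exact hpq
  have hw1 : Wind (fun z ↦ p * z + q) 0 1 1 := by
    have := (Wind.const (c := 0) (r := 1) hp).mul (Wind.id_sub_of_mem hroot)
    refine (by simpa using this : Wind _ 0 1 1).congr zero_le_one fun z _ ↦ ?_
    field_simp
    ring
  have hw2 : Wind (fun z ↦ conj q * z + conj p) 0 1 0 := by
    refine Wind.of_norm_sub_lt zero_le_one (by fun_prop) (by fun_prop) (h := fun _ ↦ conj p) ?_
      (Wind.const (by simpa using hp))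
    intro z hz
    simp [hsph z hz, hpq]
  have hw : Wind (fun z ↦ m z - 0) 0 1 1 := by
    simpa [m] using hw1.div hw2
  obtain ⟨μ, hμ, hmμ⟩ := exists_isCircleLift one_pos hinj hmaps hw
  refine ⟨μ, hμ, fun t ↦ ?_⟩
  rw [← hmμ]
  exact div_mul_cancel₀ _ (hden' t)

open ComplexConjugate in
/-- A disc automorphism with prescribed values at two points of the circle. -/
theorem exists_moebius_interpolation {t₁ t₂ a₁ a₂ : ℝ} (ht : t₁ < t₂) (ht' : t₂ < t₁ + 2 * Real.pi)
    (ha : a₁ < a₂) (ha' : a₂ < a₁ + 2 * Real.pi) :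
    ∃ p q : ℂ, ‖q‖ < ‖p‖ ∧
      p * circleMap 0 1 t₁ + q = circleMap 0 1 a₁ * (conj q * circleMap 0 1 t₁ + conj p) ∧
      p * circleMap 0 1 t₂ + q = circleMap 0 1 a₂ * (conj q * circleMap 0 1 t₂ + conj p) := by
  let e : ℝ → ℂ := fun x ↦ Complex.exp ((x / 2 : ℝ) * Complex.I)
  have hsq : ∀ x, circleMap 0 1 x = e x ^ 2 := by
    intro x
    simp only [e, circleMap, ← Complex.exp_nat_mul]
    push_cast
    rw [zero_add, one_mul]
    ring_nf
  have hne : ∀ x, e x ≠ 0 := fun x ↦ Complex.exp_ne_zero _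
  have hconj : ∀ x, conj (e x) = (e x)⁻¹ := by
    intro x
    simp only [e]
    rw [← Complex.exp_conj, ← Complex.exp_neg, map_mul, Complex.conj_ofReal, Complex.conj_I]
    congr 1
    ring
  have he_add : ∀ x y, e x * e y = e (x + y) := by
    intro x y; simp only [e]; rw [← Complex.exp_add]; congr 1; push_cast; ring
  have he_inv : ∀ x, (e x)⁻¹ = e (-x) := by
    intro x; simp only [e]; rw [← Complex.exp_neg]; congr 1; push_cast; ring
  have h1 := hne t₁
  have h2 := hne t₂
  have h3 := hne a₁
  have h4 := hne a₂
  refine ⟨Complex.I * (e a₁ / e t₂ - e a₂ / e t₁), Complex.I * (e a₂ * e t₁ - e a₁ * e t₂),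
    ?_, ?_, ?_⟩
  · have hnorm : ∀ x y, ‖e x - e y‖ ^ 2 = 2 - 2 * Real.cos ((x - y) / 2) := by
      intro x y
      rw [← Complex.normSq_eq_norm_sq, Complex.normSq_apply]
      simp only [e, Complex.sub_re, Complex.sub_im, Complex.exp_ofReal_mul_I_re,
        Complex.exp_ofReal_mul_I_im]
      rw [show (x - y) / 2 = x / 2 - y / 2 by ring, Real.cos_sub]
      nlinarith [Real.sin_sq_add_cos_sq (x / 2), Real.sin_sq_add_cos_sq (y / 2)]
    rw [← sq_lt_sq₀ (norm_nonneg _) (norm_nonneg _), norm_mul, norm_mul, Complex.norm_I, one_mul,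
      one_mul, div_eq_mul_inv, div_eq_mul_inv, he_inv, he_inv, he_add, he_add, he_add, he_add,
      hnorm, hnorm]
    set x := (a₂ - a₁) / 2 with hx
    set y := (t₂ - t₁) / 2 with hy
    rw [show (a₁ + -t₂ - (a₂ + -t₁)) / 2 = -(x + y) by rw [hx, hy]; ring,
      show (a₂ + t₁ - (a₁ + t₂)) / 2 = x - y by rw [hx, hy]; ring, Real.cos_neg, Real.cos_add,
      Real.cos_sub]
    have hsx : 0 < Real.sin x := Real.sin_pos_of_pos_of_lt_pi (by linarith) (by linarith)
    have hsy : 0 < Real.sin y := Real.sin_pos_of_pos_of_lt_pi (by linarith) (by linarith)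
    nlinarith [mul_pos hsx hsy]
  all_goals
    simp only [hsq, map_mul, map_sub, map_div₀, hconj, Complex.conj_I]
    field_simp
    ring

/-- The zero set of a real trigonometric polynomial of degree one which changes sign. -/
theorem exists_zeros_trig {τ : ℝ} {κ : ℂ} {s₁ s₂ : ℝ}
    (h1 : 0 < τ + 2 * (κ * circleMap 0 1 s₁).re) (h2 : τ + 2 * (κ * circleMap 0 1 s₂).re < 0) :
    ∃ t₁ t₂ : ℝ, t₁ < t₂ ∧ t₂ < t₁ + 2 * Real.pi ∧
      ∀ t, τ + 2 * (κ * circleMap 0 1 t).re = 0 →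
        ∃ l : ℤ, t = t₁ + l * (2 * Real.pi) ∨ t = t₂ + l * (2 * Real.pi) := by
  set θ := κ.arg with hθ
  have hre : ∀ t, (κ * circleMap 0 1 t).re = ‖κ‖ * Real.cos (θ + t) := by
    intro t
    have : κ * circleMap 0 1 t = ‖κ‖ * Complex.exp ((θ + t : ℝ) * Complex.I) := by
      conv_lhs => rw [← Complex.norm_mul_exp_arg_mul_I κ]
      simp only [circleMap, Complex.ofReal_one, one_mul, zero_add]
      rw [mul_assoc, ← Complex.exp_add]
      push_cast
      congr 2
      rw [hθ]
      ring
    rw [this, Complex.re_ofReal_mul, Complex.exp_ofReal_mul_I_re]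
  simp only [hre] at h1 h2 ⊢
  have hκ : 0 < ‖κ‖ := by
    rcases (norm_nonneg κ).eq_or_lt with h | h
    · rw [← h] at h1 h2; linarith
    · exact h
  set β := -τ / (2 * ‖κ‖) with hβ
  have hτ : τ = -(2 * ‖κ‖) * β := by rw [hβ]; field_simp
  have hb1 : β < 1 := by
    have := Real.cos_le_one (θ + s₁)
    rw [hτ] at h1
    have : 0 < 2 * ‖κ‖ * (Real.cos (θ + s₁) - β) := by linarith
    have := (mul_pos_iff_of_pos_left (by positivity)).1 this
    linarith
  have hb2 : -1 < β := by
    have := Real.neg_one_le_cos (θ + s₂)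
    rw [hτ] at h2
    have : 0 < 2 * ‖κ‖ * (β - Real.cos (θ + s₂)) := by linarith
    have := (mul_pos_iff_of_pos_left (by positivity)).1 this
    linarith
  set α := Real.arccos β with hα
  have hcos : Real.cos α = β := Real.cos_arccos hb2.le hb1.le
  have hα0 : 0 < α := Real.arccos_pos.2 hb1
  have hαpi : α < Real.pi := by
    refine lt_of_le_of_ne (Real.arccos_le_pi β) fun h ↦ ?_
    rw [h, Real.cos_pi] at hcos
    linarith
  refine ⟨-α - θ, α - θ, by linarith, by linarith, fun t ht ↦ ?_⟩
  have hc : Real.cos α = Real.cos (θ + t) := by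
    rw [hτ] at ht
    have : 2 * ‖κ‖ * (Real.cos (θ + t) - β) = 0 := by linarith
    have := (mul_eq_zero.1 this).resolve_left (by positivity)
    linarith
  rw [Real.cos_eq_cos_iff] at hc
  obtain ⟨k, hk | hk⟩ := hc
  · exact ⟨k, Or.inr (by linarith)⟩
  · exact ⟨k, Or.inl (by linarith)⟩

theorem IsCircleLift.index_nonneg {ψ : ℝ → ℝ} (h : IsCircleLift ψ 1) {A B C D : ℂ}
    (h0 : ∀ t, circleMap 0 1 (ψ t) * (A * circleMap 0 1 t + B) + (C * circleMap 0 1 t + D) ≠ 0) :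
    ∃ n : ℤ, 0 ≤ n ∧ LoopWind (fun t ↦ circleMap 0 1 (ψ t) * (A * circleMap 0 1 t + B) +
      (C * circleMap 0 1 t + D)) n := by
  have hψ := h.cont
  have hper : ∀ t, circleMap 0 1 (t + 2 * Real.pi) = circleMap 0 1 t := periodic_circleMap 0 1
  have hψper : ∀ t, circleMap 0 1 (ψ (t + 2 * Real.pi)) = circleMap 0 1 (ψ t) := by
    intro t
    rw [h.add_period, circleMap_add_int_mul]
  have hcirc : Continuous (circleMap 0 1) := continuous_circleMap 0 1
  have hnorm : ∀ t (z : ℂ), ‖circleMap 0 1 t * z‖ = ‖z‖ := fun t z ↦ by simp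
  by_cases hP : ∀ t, ‖C * circleMap 0 1 t + D‖ ≤ ‖A * circleMap 0 1 t + B‖
  · have hP0 : ∀ t, A * circleMap 0 1 t + B ≠ 0 := by
      intro t ht
      have := hP t
      rw [ht, norm_zero, norm_le_zero_iff] at this
      apply h0 t
      rw [ht, this]; simp
    obtain ⟨n, hn, hw⟩ := loopWind_linear hP0
    exact ⟨1 + n, by omega, (h.loopWind.mul hw).add_of_norm_le (by fun_prop) (by fun_prop)
      (fun t ↦ by rw [hper, hψper]) (fun t ↦ by rw [hper]) (fun t ↦ by rw [hnorm]; exact hP t) h0⟩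
  by_cases hQ : ∀ t, ‖A * circleMap 0 1 t + B‖ ≤ ‖C * circleMap 0 1 t + D‖
  · have hQ0 : ∀ t, C * circleMap 0 1 t + D ≠ 0 := by
      intro t ht
      have := hQ t
      rw [ht, norm_zero, norm_le_zero_iff] at this
      apply h0 t
      rw [ht, this]; simp
    obtain ⟨n, hn, hw⟩ := loopWind_linear hQ0
    refine ⟨n, hn, ?_⟩
    simp only [add_comm (circleMap 0 1 (ψ _) * _)] at h0 ⊢
    exact hw.add_of_norm_le (by fun_prop) (by fun_prop)
      (fun t ↦ by rw [hper]) (fun t ↦ by rw [hper, hψper]) (fun t ↦ by rw [hnorm]; exact hQ t) h0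
  push Not at hP hQ
  obtain ⟨s₂, hs₂⟩ := hP
  obtain ⟨s₁, hs₁⟩ := hQ
  have htrig : ∀ t, ‖A * circleMap 0 1 t + B‖ ^ 2 - ‖C * circleMap 0 1 t + D‖ ^ 2 =
      (‖A‖ ^ 2 + ‖B‖ ^ 2 - ‖C‖ ^ 2 - ‖D‖ ^ 2) +
        2 * ((A * (starRingEnd ℂ) B - C * (starRingEnd ℂ) D) * circleMap 0 1 t).re := by
    intro t
    have hz : (circleMap 0 1 t).re ^ 2 + (circleMap 0 1 t).im ^ 2 = 1 := by
      have := norm_circleMap_zero_one t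
      rw [← sq_eq_sq₀ (norm_nonneg _) zero_le_one, ← Complex.normSq_eq_norm_sq,
        Complex.normSq_apply] at this
      linarith
    generalize circleMap 0 1 t = z at hz
    simp only [← Complex.normSq_eq_norm_sq, Complex.normSq_apply, Complex.add_re, Complex.add_im,
      Complex.mul_re, Complex.mul_im, Complex.sub_re, Complex.sub_im, Complex.conj_re,
      Complex.conj_im]
    linear_combination (A.re ^ 2 + A.im ^ 2 - C.re ^ 2 - C.im ^ 2) * hz
  obtain ⟨t₁, t₂, ht, ht', hE⟩ := exists_zeros_trig (s₁ := s₂) (s₂ := s₁)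
    (τ := -(‖A‖ ^ 2 + ‖B‖ ^ 2 - ‖C‖ ^ 2 - ‖D‖ ^ 2))
    (κ := -(A * (starRingEnd ℂ) B - C * (starRingEnd ℂ) D))
    (by have := htrig s₂
        rw [neg_mul, Complex.neg_re]
        nlinarith [norm_nonneg (A * circleMap 0 1 s₂ + B)])
    (by have := htrig s₁
        rw [neg_mul, Complex.neg_re]
        nlinarith [norm_nonneg (C * circleMap 0 1 s₁ + D)])
  have hE' : ∀ t, ‖A * circleMap 0 1 t + B‖ = ‖C * circleMap 0 1 t + D‖ →
      ∃ l : ℤ, t = t₁ + l * (2 * Real.pi) ∨ t = t₂ + l * (2 * Real.pi) := by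
    intro t hteq
    apply hE
    have := htrig t
    rw [hteq] at this
    rw [neg_mul, Complex.neg_re]
    linarith
  have ha : ψ t₁ < ψ t₂ := h.strictMono ht
  have ha' : ψ t₂ < ψ t₁ + 2 * Real.pi := by
    have := h.strictMono ht'
    rw [h.add_period] at this
    simpa using this
  obtain ⟨p, q, hpq, hm₁, hm₂⟩ := exists_moebius_interpolation ht ht' ha ha'
  obtain ⟨hden, μ₀, hμ₀, hmμ⟩ := exists_moebius_lift hpq
  obtain ⟨k, hk⟩ : ∃ k : ℤ, μ₀ t₁ = ψ t₁ + k * (2 * Real.pi) := by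
    apply circleMap_inj_period one_ne_zero (c := 0)
    exact mul_right_cancel₀ (hden t₁) ((hmμ t₁).trans hm₁)
  obtain ⟨k', hk'⟩ : ∃ k : ℤ, μ₀ t₂ = ψ t₂ + k * (2 * Real.pi) := by
    apply circleMap_inj_period one_ne_zero (c := 0)
    exact mul_right_cancel₀ (hden t₂) ((hmμ t₂).trans hm₂)
  have hkk : k' = k := by
    have e1 := hμ₀.strictMono ht
    have e2 := hμ₀.strictMono ht'
    rw [hμ₀.add_period] at e2
    push_cast at e2
    have hpi := Real.pi_pos
    have e3 : (k' : ℝ) - k < 1 := by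
      by_contra! hc
      nlinarith
    have e4 : -1 < (k' : ℝ) - k := by
      by_contra! hc
      nlinarith
    have e3' : k' - k < 1 := by exact_mod_cast e3
    have e4' : -1 < k' - k := by exact_mod_cast e4
    omega
  subst hkk
  set μ : ℝ → ℝ := fun t ↦ μ₀ t - k' * (2 * Real.pi) with hμ
  have hμc : Continuous μ := by have := hμ₀.cont; fun_prop
  have hμe : ∀ t, circleMap 0 1 (μ t) = circleMap 0 1 (μ₀ t) := by
    intro t
    rw [← circleMap_add_int_mul (μ t) k']
    simp [hμ]
  have hμper : ∀ t, μ (t + 2 * Real.pi) = μ t + 2 * Real.pi := by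
    intro t
    simp only [hμ, hμ₀.add_period]
    push_cast; ring
  have hψper' : ∀ t, ψ (t + 2 * Real.pi) = ψ t + 2 * Real.pi := by
    intro t
    simp [h.add_period]
  have hdper : Function.Periodic (fun t ↦ ψ t - μ t) (2 * Real.pi) := by
    intro t
    simp only [hμper, hψper']
    ring
  have hv : ∀ t, ‖A * circleMap 0 1 t + B‖ = ‖C * circleMap 0 1 t + D‖ → ψ t = μ t := by
    intro t hteq
    obtain ⟨l, rfl | rfl⟩ := hE' t hteq
    · have := hdper.int_mul l t₁
      simp only [hμ] at this ⊢
      linarith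
    · have := hdper.int_mul l t₂
      simp only [hμ] at this ⊢
      linarith
  have hquad : ∀ t, circleMap 0 1 (μ t) * (A * circleMap 0 1 t + B) + (C * circleMap 0 1 t + D) =
      ((p * A + (starRingEnd ℂ) q * C) * circleMap 0 1 t ^ 2 + (p * B + q * A +
        (starRingEnd ℂ) q * D + (starRingEnd ℂ) p * C) * circleMap 0 1 t +
        (q * B + (starRingEnd ℂ) p * D)) *
        ((starRingEnd ℂ) q * circleMap 0 1 t + (starRingEnd ℂ) p)⁻¹ := by
    intro t
    rw [eq_mul_inv_iff_mul_eq₀ (hden t), hμe]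
    linear_combination (A * circleMap 0 1 t + B) * hmμ t
  have hne : ∀ x t, (x = ψ t ∨ ‖A * circleMap 0 1 t + B‖ ≠ ‖C * circleMap 0 1 t + D‖) →
      circleMap 0 1 x * (A * circleMap 0 1 t + B) + (C * circleMap 0 1 t + D) ≠ 0 := by
    rintro x t (rfl | hx) hz
    · exact h0 t hz
    · apply hx
      rw [← hnorm x, eq_neg_of_add_eq_zero_left hz, norm_neg]
  have hne' : ∀ s t, circleMap 0 1 (μ t + s * (ψ t - μ t)) * (A * circleMap 0 1 t + B) +
      (C * circleMap 0 1 t + D) ≠ 0 := by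
    intro s t
    apply hne
    by_cases hteq : ‖A * circleMap 0 1 t + B‖ = ‖C * circleMap 0 1 t + D‖
    · left; rw [hv t hteq]; ring
    · right; exact hteq
  have hw0 : ∃ n : ℤ, 0 ≤ n ∧ LoopWind (fun t ↦ circleMap 0 1 (μ t) * (A * circleMap 0 1 t + B) +
      (C * circleMap 0 1 t + D)) n := by
    have hz : ∀ t, _ := fun t ↦ hne' 0 t
    simp only [zero_mul, add_zero, hquad] at hz ⊢
    obtain ⟨n, hn, hw⟩ := loopWind_quadratic fun t ↦ left_ne_zero_of_mul (hz t)
    have hw2 : LoopWind (fun t ↦ (starRingEnd ℂ) q * circleMap 0 1 t + (starRingEnd ℂ) p) 0 := by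
      refine Wind.of_norm_sub_lt (g := fun z ↦ (starRingEnd ℂ) q * z + (starRingEnd ℂ) p)
        (c := 0) (r := 1) zero_le_one (by fun_prop) (by fun_prop)
        (h := fun _ ↦ (starRingEnd ℂ) p) ?_ (Wind.const ?_)
      · intro z hz
        have hz1 : ‖z‖ = 1 := by simpa using hz
        simp [hz1, hpq]
      · intro hp
        simp only [map_eq_zero] at hp
        rw [hp, norm_zero] at hpq
        linarith [norm_nonneg q]
    exact ⟨n + -0, by omega, hw.mul hw2.inv⟩
  obtain ⟨n, hn, hw⟩ := hw0
  refine ⟨n, hn, ?_⟩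
  have key := LoopWind.homotopy (H := fun s t ↦ circleMap 0 1 (μ t + s * (ψ t - μ t)) *
    (A * circleMap 0 1 t + B) + (C * circleMap 0 1 t + D)) (n := n) (by fun_prop) hne' ?_
    (by simpa using hw)
  · simpa using key
  · intro s t
    have := hdper t
    simp only at this
    rw [hper, this, hμper, show μ t + 2 * Real.pi + s * (ψ t - μ t) =
      (μ t + s * (ψ t - μ t)) + 2 * Real.pi by ring, hper]

/-- **Index lemma.** If `f` maps a circle injectively into a circle with winding number one,
bilinear expressions in `z` and `f z` have nonnegative winding numbers. -/
theorem index_nonneg {f : ℂ → ℂ} {c c' : ℂ} {r r' : ℝ} (hr : 0 < r)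
    (hinj : InjOn f (sphere c r)) (hmaps : MapsTo f (sphere c r) (sphere c' r'))
    (hw : Wind (fun z ↦ f z - c') c r 1) {A B C D : ℂ}
    (h0 : ∀ z ∈ sphere c r, A * z * f z + B * f z + C * z + D ≠ 0) :
    ∃ n : ℤ, 0 ≤ n ∧ Wind (fun z ↦ A * z * f z + B * f z + C * z + D) c r n := by
  obtain ⟨ψ, hψ, hf⟩ := exists_isCircleLift hr hinj hmaps hw
  have hfac : ∀ t, A * circleMap c r t * f (circleMap c r t) + B * f (circleMap c r t) +
      C * circleMap c r t + D = circleMap 0 1 (ψ t) * ((r' * A * r) * circleMap 0 1 t +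
        r' * (A * c + B)) + ((c' * A * r + C * r) * circleMap 0 1 t +
        (c' * (A * c + B) + C * c + D)) := by
    intro t
    rw [hf]
    simp only [circleMap]
    push_cast
    ring
  have h1 := IsCircleLift.index_nonneg hψ fun t ↦ by
    rw [← hfac t]; exact h0 _ (circleMap_mem_sphere c hr.le t)
  simp only [Wind, hfac]
  exact h1

open Classical in
/-- The winding number along a circle is the sum of the winding numbers along the circles
bounding the holes. -/
theorem wind_sum {ι : Type*} (J : Finset ι) (c : ι → ℂ) (r : ι → ℝ) (n : ι → ℤ) {c₀ : ℂ} {R : ℝ}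
    (hR : 0 < R) (hr : ∀ k ∈ J, 0 < r k) (hsub : ∀ k ∈ J, closedBall (c k) (r k) ⊆ ball c₀ R)
    (hdisj : ∀ k ∈ J, ∀ l ∈ J, k ≠ l → Disjoint (closedBall (c k) (r k)) (closedBall (c l) (r l)))
    {g : ℂ → ℂ} (hg : ContinuousOn g (closedBall c₀ R \ ⋃ k ∈ J, ball (c k) (r k)))
    (h0 : ∀ z ∈ closedBall c₀ R \ ⋃ k ∈ J, ball (c k) (r k), g z ≠ 0)
    (hw : ∀ k ∈ J, Wind g (c k) (r k) (n k)) : Wind g c₀ R (∑ k ∈ J, n k) := by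
  induction J using Finset.induction_on generalizing g n with
  | empty =>
    simp only [Finset.notMem_empty, iUnion_of_empty, iUnion_empty, sdiff_empty] at hg h0
    simpa using wind_zero_of_closedBall hR hg h0
  | insert k J hkJ ih =>
    have hkr := hr k (Finset.mem_insert_self k J)
    have hks := hsub k (Finset.mem_insert_self k J)
    have hne : ∀ z, z ∉ ball (c k) (r k) → z - c k ≠ 0 := by
      intro z hz h
      apply hz
      rw [sub_eq_zero.1 h]
      exact mem_ball_self hkr
    have hdk : ∀ l ∈ J, Disjoint (closedBall (c k) (r k)) (closedBall (c l) (r l)) := fun l hl ↦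
      hdisj k (Finset.mem_insert_self k J) l (Finset.mem_insert_of_mem hl)
        (fun h ↦ hkJ (h ▸ hl))
    have hw1 : Wind (fun z ↦ g z / (z - c k) ^ n k) (c k) (r k) 0 := by
      have := (hw k (Finset.mem_insert_self k J)).div ((Wind.id_sub_center hkr).zpow (n k))
      simpa using this
    obtain ⟨u, hu, hgu⟩ := hw1.exists_log hkr
    obtain ⟨v, hv⟩ := ContinuousMap.exists_restrict_eq (Y := ℂ)
      (isClosed_sphere (x := c k) (ε := r k))
      ⟨fun z ↦ u z, continuousOn_iff_continuous_domRestrict.1 hu⟩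
    have hvu : ∀ z ∈ sphere (c k) (r k), v z = u z := fun z hz ↦
      DFunLike.congr_fun hv (⟨z, hz⟩ : sphere (c k) (r k))
    set h : ℂ → ℂ := fun z ↦ if z ∈ ball (c k) (r k) then Complex.exp (v z) else
      g z / (z - c k) ^ n k with hh
    have hin : ∀ z ∈ closedBall (c k) (r k), h z = Complex.exp (v z) := by
      intro z hz
      simp only [hh]
      split_ifs with hzb
      · rfl
      · have hzs : z ∈ sphere (c k) (r k) := by
          rw [← closedBall_sdiff_ball]; exact ⟨hz, hzb⟩
        rw [hvu z hzs, ← hgu z hzs]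
    have hout : ∀ z, z ∉ ball (c k) (r k) → h z = g z / (z - c k) ^ n k := by
      intro z hz
      simp only [hh, if_neg hz]
    have hgout : ∀ z ∈ closedBall c₀ R \ ⋃ l ∈ J, ball (c l) (r l), z ∉ ball (c k) (r k) →
        z ∈ closedBall c₀ R \ ⋃ l ∈ insert k J, ball (c l) (r l) := by
      intro z hz hzk
      refine ⟨hz.1, ?_⟩
      rw [Finset.set_biUnion_insert]
      exact fun hor ↦ hor.elim hzk hz.2
    have hdisjb : ∀ l ∈ J, ∀ z ∈ sphere (c l) (r l), z ∉ ball (c k) (r k) := fun l hl z hz hzk ↦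
      disjoint_left.1 (hdk l hl) (ball_subset_closedBall hzk) (sphere_subset_closedBall hz)
    have key := ih (g := h) n (fun l hl ↦ hr l (Finset.mem_insert_of_mem hl))
      (fun l hl ↦ hsub l (Finset.mem_insert_of_mem hl))
      (fun a ha b hb ↦ hdisj a (Finset.mem_insert_of_mem ha) b (Finset.mem_insert_of_mem hb))
      ?_ ?_ ?_
    · have h1 := key.mul ((Wind.id_sub_of_mem (hks (mem_closedBall_self hkr.le))).zpow (n k))
      rw [Finset.sum_insert hkJ]
      have h2 : ∑ x ∈ J, n x + n k * 1 = n k + ∑ x ∈ J, n x := by ring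
      rw [h2] at h1
      refine h1.congr hR.le fun z hz ↦ ?_
      have hzb : z ∉ ball (c k) (r k) := fun hzb ↦
        (mem_ball.1 (hks (ball_subset_closedBall hzb))).ne (mem_sphere.1 hz)
      rw [hout z hzb]
      exact div_mul_cancel₀ _ (zpow_ne_zero _ (hne z hzb))
    · have h1 : ContinuousOn h ((closedBall c₀ R \ ⋃ l ∈ J, ball (c l) (r l)) ∩
          closedBall (c k) (r k)) :=
        ((Complex.continuous_exp.comp v.continuous).continuousOn).congr fun z hz ↦ hin z hz.2
      have h2 : ContinuousOn h ((closedBall c₀ R \ ⋃ l ∈ J, ball (c l) (r l)) ∩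
          (ball (c k) (r k))ᶜ) := by
        have h3 : ContinuousOn (fun z ↦ g z / (z - c k) ^ n k)
            ((closedBall c₀ R \ ⋃ l ∈ J, ball (c l) (r l)) ∩ (ball (c k) (r k))ᶜ) := by
          refine (hg.mono fun z hz ↦ hgout z hz.1 hz.2).div ?_ fun z hz ↦
            zpow_ne_zero _ (hne z hz.2)
          exact ContinuousOn.zpow₀ (by fun_prop) _ fun z hz ↦ Or.inl (hne z hz.2)
        exact h3.congr fun z hz ↦ hout z hz.2
      have hcl : IsClosed (closedBall c₀ R \ ⋃ l ∈ J, ball (c l) (r l)) :=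
        isClosed_closedBall.sdiff (isOpen_biUnion fun l _ ↦ isOpen_ball)
      refine (h1.union_of_isClosed h2 (hcl.inter isClosed_closedBall)
        (hcl.inter isOpen_ball.isClosed_compl)).mono fun z hz ↦ ?_
      by_cases hzk : z ∈ ball (c k) (r k)
      · exact Or.inl ⟨hz, ball_subset_closedBall hzk⟩
      · exact Or.inr ⟨hz, hzk⟩
    · intro z hz
      by_cases hzk : z ∈ ball (c k) (r k)
      · rw [hin z (ball_subset_closedBall hzk)]; exact Complex.exp_ne_zero _
      · rw [hout z hzk]
        exact div_ne_zero (h0 z (hgout z hz hzk)) (zpow_ne_zero _ (hne z hzk))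
    · intro l hl
      have hlr := hr l (Finset.mem_insert_of_mem hl)
      have hck : c k ∉ closedBall (c l) (r l) :=
        disjoint_left.1 (hdk l hl) (mem_closedBall_self hkr.le)
      have h1 := (hw l (Finset.mem_insert_of_mem hl)).div
        ((Wind.id_sub_of_notMem hlr.le hck).zpow (n k))
      rw [mul_zero, sub_zero] at h1
      exact h1.congr hlr.le fun z hz ↦ (hout z (hdisjb l hl z hz)).symm

/-- A relative Schottky set in a bounded open set. -/
structure SchottkyData {I : Type} (Ω S : Set ℂ) (c : I → ℂ) (r : I → ℝ) : Prop where
  isOpen : IsOpen Ω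
  isBounded : Bornology.IsBounded Ω
  pos : ∀ i, 0 < r i
  sub : ∀ i, closedBall (c i) (r i) ⊆ Ω
  disj : Pairwise fun i j ↦ Disjoint (closedBall (c i) (r i)) (closedBall (c j) (r j))
  eq : S = Ω \ ⋃ i, ball (c i) (r i)

namespace SchottkyData

variable {I : Type} {Ω S : Set ℂ} {c : I → ℂ} {r : I → ℝ}

theorem mem_iff (h : SchottkyData Ω S c r) {z : ℂ} : z ∈ S ↔ z ∈ Ω ∧ ∀ i, z ∉ ball (c i) (r i) := by
  rw [h.eq]; simp

theorem subset (h : SchottkyData Ω S c r) : S ⊆ Ω := fun _ hz ↦ (h.mem_iff.1 hz).1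

theorem eq_of_mem (h : SchottkyData Ω S c r) {i j : I} {z : ℂ} (hi : z ∈ closedBall (c i) (r i))
    (hj : z ∈ closedBall (c j) (r j)) : i = j := by
  by_contra hij
  exact disjoint_left.1 (h.disj hij) hi hj

theorem sphere_subset (h : SchottkyData Ω S c r) (i : I) : sphere (c i) (r i) ⊆ S := by
  intro z hz
  refine h.mem_iff.2 ⟨h.sub i (sphere_subset_closedBall hz), fun j hj ↦ ?_⟩
  have := h.eq_of_mem (sphere_subset_closedBall hz) (ball_subset_closedBall hj)
  subst this
  exact (mem_ball.1 hj).ne (mem_sphere.1 hz)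

theorem exists_mem_ball (h : SchottkyData Ω S c r) {z : ℂ} (hz : z ∈ Ω) (hzS : z ∉ S) :
    ∃ i, z ∈ ball (c i) (r i) := by
  by_contra! hcon
  exact hzS (h.mem_iff.2 ⟨hz, hcon⟩)

theorem finite_large (h : SchottkyData Ω S c r) {ρ : ℝ} (hρ : 0 < ρ) : {i | ρ ≤ r i}.Finite := by
  have hfin : volume (⋃ i, ball (c i) (r i)) ≠ ∞ := by
    refine ne_top_of_le_ne_top h.isBounded.measure_lt_top.ne (measure_mono ?_)
    exact iUnion_subset fun i ↦ ball_subset_closedBall.trans (h.sub i)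
  have hpos : 0 < volume (ball (0 : ℂ) ρ) := measure_ball_pos _ _ hρ
  refine (Measure.finite_const_le_meas_of_disjoint_iUnion volume hpos
    (fun i ↦ measurableSet_ball) (fun i j hij ↦ (h.disj hij).mono ball_subset_closedBall
    ball_subset_closedBall) hfin).subset fun i hi ↦ ?_
  simp only [mem_ofPred_eq] at hi ⊢
  rw [Complex.volume_ball, Complex.volume_ball]
  gcongr

/-- Around every point there is a ball avoiding the large discs that do not contain the point. -/
theorem exists_ball_avoiding (h : SchottkyData Ω S c r) (p : ℂ) {ρ : ℝ} (hρ : 0 < ρ) :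
    ∃ δ > 0, ∀ i, ρ ≤ r i → p ∉ closedBall (c i) (r i) →
      Disjoint (closedBall (c i) (r i)) (closedBall p δ) := by
  have hfin : {i | ρ ≤ r i ∧ p ∉ closedBall (c i) (r i)}.Finite :=
    (h.finite_large hρ).subset fun i hi ↦ hi.1
  have hcl : IsClosed (⋃ i ∈ {i | ρ ≤ r i ∧ p ∉ closedBall (c i) (r i)}, closedBall (c i) (r i)) :=
    hfin.isClosed_biUnion fun i _ ↦ isClosed_closedBall
  have hp : p ∈ (⋃ i ∈ {i | ρ ≤ r i ∧ p ∉ closedBall (c i) (r i)}, closedBall (c i) (r i))ᶜ := by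
    intro hp
    simp only [mem_iUnion] at hp
    obtain ⟨i, hi, hpi⟩ := hp
    exact hi.2 hpi
  obtain ⟨δ, hδ, hsub⟩ := Metric.nhds_basis_closedBall.mem_iff.1 (hcl.isOpen_compl.mem_nhds hp)
  refine ⟨δ, hδ, fun i hi hpi ↦ disjoint_right.2 fun z hz hzi ↦ hsub hz ?_⟩
  simp only [mem_iUnion]
  exact ⟨i, ⟨hi, hpi⟩, hzi⟩

theorem closedBall_subset_of_small {i : I} {p z : ℂ} {ε δ : ℝ} (hz : z ∈ closedBall (c i) (r i))
    (hzp : z ∈ closedBall p δ) (hlt : δ + 2 * r i < ε) : closedBall (c i) (r i) ⊆ ball p ε := by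
  intro w hw
  rw [mem_closedBall] at hz hzp hw
  rw [mem_ball]
  calc dist w p ≤ dist w (c i) + dist (c i) z + dist z p := dist_triangle4 _ _ _ _
    _ < ε := by rw [dist_comm (c i) z]; linarith

/-- If the Schottky set is a null set, discs accumulate at each of its points. -/
theorem exists_closedBall_subset (h : SchottkyData Ω S c r) (h0 : volume S = 0) {p : ℂ}
    (hp : p ∈ S) {ε : ℝ} (hε : 0 < ε) :
    ∃ i, closedBall (c i) (r i) ⊆ ball p ε := by
  obtain ⟨δ, hδ, hav⟩ := h.exists_ball_avoiding p (show 0 < ε / 8 by positivity)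
  obtain ⟨ε', hε', hΩ⟩ := Metric.isOpen_iff.1 h.isOpen p (h.subset hp)
  set δ' := min (min δ ε') (ε / 2) with hδ'
  have hδ'0 : 0 < δ' := by positivity
  have hU : ∃ U : Set ℂ, IsOpen U ∧ U.Nonempty ∧ U ⊆ ball p δ' ∧
      ∀ i, p ∈ closedBall (c i) (r i) → Disjoint (closedBall (c i) (r i)) U := by
    by_cases hpi : ∃ i, p ∈ closedBall (c i) (r i)
    · obtain ⟨i, hi⟩ := hpi
      refine ⟨ball p δ' ∩ (closedBall (c i) (r i))ᶜ, isOpen_ball.inter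
        isClosed_closedBall.isOpen_compl, ?_, inter_subset_left, fun j hj ↦ ?_⟩
      · have hps : p ∈ frontier (closedBall (c i) (r i)) := by
          rw [frontier_closedBall _ (h.pos i).ne', ← closedBall_sdiff_ball]
          exact ⟨hi, (h.mem_iff.1 hp).2 i⟩
        rw [frontier_eq_closure_inter_closure] at hps
        exact mem_closure_iff.1 hps.2 _ isOpen_ball (mem_ball_self hδ'0)
      · rw [← h.eq_of_mem hi hj]
        exact disjoint_compl_right.mono_right inter_subset_right
    · push Not at hpi
      exact ⟨ball p δ', isOpen_ball, ⟨p, mem_ball_self hδ'0⟩, Subset.rfl,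
        fun i hi ↦ (hpi i hi).elim⟩
  obtain ⟨U, hUo, hUn, hUb, hUd⟩ := hU
  have hnS : ¬ U ⊆ S := fun hUS ↦
    (hUo.measure_pos volume hUn).ne' (measure_mono_null hUS h0)
  obtain ⟨z, hzU, hzS⟩ := not_subset.1 hnS
  have hzp := mem_ball.1 (hUb hzU)
  obtain ⟨i, hi⟩ := h.exists_mem_ball (hΩ (ball_subset_ball
    ((min_le_left _ _).trans (min_le_right _ _)) (hUb hzU))) hzS
  refine ⟨i, closedBall_subset_of_small (ball_subset_closedBall hi) (δ := δ') hzp.le ?_⟩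
  have hri : r i < ε / 8 := by
    by_contra! hbig
    have hpi : p ∉ closedBall (c i) (r i) := fun hpi ↦
      disjoint_left.1 (hUd i hpi) (ball_subset_closedBall hi) hzU
    exact disjoint_left.1 (hav i hbig hpi) (ball_subset_closedBall hi)
      (closedBall_subset_closedBall ((min_le_left _ _).trans (min_le_left _ _)) hzp.le)
  have : δ' ≤ ε / 2 := min_le_right _ _
  linarith

/-- The local setting: a disc in `Ω`, and a smaller disc avoiding all discs of the family which
are not contained in the larger one. -/
structure LocalDisc (Ω : Set ℂ) (c : I → ℂ) (r : I → ℝ) (p c₀ : ℂ) (R δ : ℝ) : Prop where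
  R_pos : 0 < R
  δ_pos : 0 < δ
  sub : closedBall c₀ R ⊆ Ω
  closedBall_sub : closedBall p δ ⊆ ball c₀ R
  inside : ∀ i, ¬ Disjoint (closedBall (c i) (r i)) (closedBall p δ) →
    closedBall (c i) (r i) ⊆ ball c₀ R

theorem exists_localDisc (h : SchottkyData Ω S c r) {p : ℂ} (hp : p ∈ S) :
    ∃ c₀ R δ, LocalDisc Ω c r p c₀ R δ := by
  obtain ⟨c₀, ρ, hρ, hsub, hpc, hin⟩ : ∃ (c₀ : ℂ) (ρ : ℝ), 0 ≤ ρ ∧ closedBall c₀ ρ ⊆ Ω ∧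
      p ∈ closedBall c₀ ρ ∧ ∀ i, p ∈ closedBall (c i) (r i) →
        closedBall (c i) (r i) ⊆ closedBall c₀ ρ := by
    by_cases hpi : ∃ i, p ∈ closedBall (c i) (r i)
    · obtain ⟨i, hi⟩ := hpi
      exact ⟨c i, r i, (h.pos i).le, h.sub i, hi, fun j hj ↦ by rw [h.eq_of_mem hi hj]⟩
    · push Not at hpi
      exact ⟨p, 0, le_rfl, by simpa using h.subset hp, by simp, fun i hi ↦ (hpi i hi).elim⟩
  obtain ⟨ε, hε, hεsub⟩ := (isCompact_closedBall c₀ ρ).exists_cthickening_subset_open h.isOpen hsub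
  rw [cthickening_closedBall hε.le hρ] at hεsub
  obtain ⟨δ₀, hδ₀, hav⟩ := h.exists_ball_avoiding p (show 0 < ε / 8 by positivity)
  have hball : ball p ε ⊆ ball c₀ (ε + ρ) := ball_subset_ball' (by
    have := mem_closedBall.1 hpc; linarith)
  refine ⟨c₀, ε + ρ, min δ₀ (ε / 4), by positivity, by positivity, hεsub, ?_, fun i hi ↦ ?_⟩
  · refine (closedBall_subset_ball ?_).trans hball
    have : min δ₀ (ε / 4) ≤ ε / 4 := min_le_right _ _
    linarith
  · by_cases hpi : p ∈ closedBall (c i) (r i)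
    · exact (hin i hpi).trans (closedBall_subset_ball (by linarith))
    · obtain ⟨z, hz, hzp⟩ := not_disjoint_iff.1 hi
      have hri : r i < ε / 8 := by
        by_contra! hbig
        exact disjoint_left.1 (hav i hbig hpi) hz
          (closedBall_subset_closedBall (min_le_left _ _) hzp)
      refine (closedBall_subset_of_small hz hzp ?_).trans hball
      have : min δ₀ (ε / 4) ≤ ε / 4 := min_le_right _ _
      linarith

end SchottkyData

/-- A positively oriented extension of a homeomorphism between relative Schottky sets; only the
properties which are used in the analytic part of the argument are recorded. -/
structure SchottkyMap {I : Type} (Ω S : Set ℂ) (c : I → ℂ) (r : I → ℝ) (F : ℂ → ℂ)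
    (c' : I → ℂ) (r' : I → ℝ) : Prop extends SchottkyData Ω S c r where
  cont : ContinuousOn F Ω
  pos' : ∀ i, 0 < r' i
  disj' : Pairwise fun i j ↦ Disjoint (closedBall (c' i) (r' i)) (closedBall (c' j) (r' j))
  maps_ball : ∀ i, MapsTo F (ball (c i) (r i)) (ball (c' i) (r' i))
  maps_sphere : ∀ i, MapsTo F (sphere (c i) (r i)) (sphere (c' i) (r' i))
  notMem_ball : ∀ z ∈ S, ∀ i, F z ∉ ball (c' i) (r' i)
  injOn : InjOn F S
  null : volume S = 0
  null_image : ∀ A B C : ℂ, volume ((fun z ↦ A * z * F z + B * F z + C * z) '' S) = 0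
  conn : IsPreconnected S
  noncompact : ∀ K, IsCompact K → K ⊆ Ω → ¬ S ⊆ K
  wind : ∀ i, Wind (fun z ↦ F z - c' i) (c i) (r i) 1

namespace SchottkyMap

variable {I : Type} {Ω S : Set ℂ} {c : I → ℂ} {r : I → ℝ} {F : ℂ → ℂ} {c' : I → ℂ} {r' : I → ℝ}

theorem continuousOn_bilin {X : Set ℂ} (hF : ContinuousOn F X) (A B C D : ℂ) :
    ContinuousOn (fun z ↦ A * z * F z + B * F z + C * z + D) X := by
  fun_prop

theorem wind_nonneg (M : SchottkyMap Ω S c r F c' r') {A B C D : ℂ} {i : I}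
    (h0 : ∀ z ∈ sphere (c i) (r i), A * z * F z + B * F z + C * z + D ≠ 0) :
    ∃ n : ℤ, 0 ≤ n ∧ Wind (fun z ↦ A * z * F z + B * F z + C * z + D) (c i) (r i) n :=
  index_nonneg (M.pos i) (M.injOn.mono (M.toSchottkyData.sphere_subset i)) (M.maps_sphere i)
    (M.wind i) h0

/-- The number of peripheral circles with winding number one is at most the total winding
number. -/
theorem card_le (M : SchottkyMap Ω S c r F c' r') {p c₀ : ℂ} {R δ : ℝ}
    (L : SchottkyData.LocalDisc Ω c r p c₀ R δ) {A B C D : ℂ}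
    (hreg : ∀ z ∈ closedBall c₀ R \ ball p δ, A * z * F z + B * F z + C * z + D ≠ 0) {N : ℤ}
    (hN : Wind (fun z ↦ A * z * F z + B * F z + C * z + D) c₀ R N) (J : Finset I)
    (hJ : ∀ j ∈ J, closedBall (c j) (r j) ⊆ ball c₀ R ∧
      (∀ z ∈ sphere (c j) (r j), A * z * F z + B * F z + C * z + D ≠ 0) ∧
      Wind (fun z ↦ A * z * F z + B * F z + C * z + D) (c j) (r j) 1) :
    (J.card : ℤ) ≤ N := by
  classical
  have M' := M.toSchottkyData
  set G : ℂ → ℂ := fun z ↦ A * z * F z + B * F z + C * z + D with hG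
  have hGc : ContinuousOn G Ω := continuousOn_bilin M.cont A B C D
  set K : Set ℂ := (closedBall c₀ R \ ball p δ) ∪ ⋃ j ∈ J, sphere (c j) (r j) with hK
  have hKc : IsCompact K := ((isCompact_closedBall c₀ R).diff isOpen_ball).union
    (J.isCompact_biUnion fun j _ ↦ isCompact_sphere _ _)
  have hKΩ : K ⊆ Ω := by
    refine union_subset (sdiff_subset.trans L.sub) (iUnion₂_subset fun j _ ↦ ?_)
    exact sphere_subset_closedBall.trans (M.sub j)
  have hsphR : sphere c₀ R ⊆ K := fun z hz ↦ Or.inl ⟨sphere_subset_closedBall hz, fun hzp ↦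
    (mem_ball.1 (L.closedBall_sub (ball_subset_closedBall hzp))).ne (mem_sphere.1 hz)⟩
  have hsphJ : ∀ j ∈ J, sphere (c j) (r j) ⊆ K := fun j hj z hz ↦
    Or.inr (mem_iUnion₂.2 ⟨j, hj, hz⟩)
  have hG0 : ∀ z ∈ K, G z ≠ 0 := by
    rintro z (hz | hz)
    · exact hreg z hz
    · obtain ⟨j, hj, hz⟩ := mem_iUnion₂.1 hz
      exact (hJ j hj).2.1 z hz
  obtain ⟨η, hη, hηG⟩ : ∃ η > 0, ∀ z ∈ K, η ≤ ‖G z‖ := by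
    have hne : K.Nonempty := ((NormedSpace.sphere_nonempty).2 L.R_pos.le).mono hsphR
    obtain ⟨z₀, hz₀, hmin⟩ := hKc.exists_isMinOn hne (hGc.mono hKΩ).norm
    exact ⟨‖G z₀‖, norm_pos_iff.2 (hG0 z₀ hz₀), fun z hz ↦ hmin hz⟩
  obtain ⟨w, hwη, hw⟩ : ∃ w ∈ ball (-D) η,
      w ∉ (fun z ↦ A * z * F z + B * F z + C * z) '' S := by
    by_contra! hcon
    exact (measure_ball_pos volume (-D) hη).ne'
      (measure_mono_null hcon (M.null_image A B C))
  set G₁ : ℂ → ℂ := fun z ↦ A * z * F z + B * F z + C * z + (-w) with hG₁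
  have hG₁c : ContinuousOn G₁ Ω := continuousOn_bilin M.cont A B C _
  have hG₁S : ∀ z ∈ S, G₁ z ≠ 0 := fun z hz h0 ↦
    hw ⟨z, hz, by simp only [hG₁] at h0; linear_combination h0⟩
  have hclose : ∀ z ∈ K, ‖G₁ z - G z‖ < ‖G z‖ := fun z hz ↦ by
    refine lt_of_lt_of_le ?_ (hηG z hz)
    have : G₁ z - G z = -(w - (-D)) := by simp only [hG₁, hG]; ring
    rw [this, norm_neg, ← dist_eq_norm]
    exact mem_ball.1 hwη
  have hG₁K : ∀ z ∈ K, G₁ z ≠ 0 := fun z hz h0 ↦ by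
    have := hclose z hz
    rw [h0, zero_sub, norm_neg] at this
    exact lt_irrefl _ this
  have hwind : ∀ {a : ℂ} {ρ : ℝ} {m : ℤ}, 0 ≤ ρ → sphere a ρ ⊆ K → Wind G a ρ m →
      Wind G₁ a ρ m := fun hρ hsub hm ↦
    Wind.of_norm_sub_lt hρ (hG₁c.mono (hsub.trans hKΩ)) (hGc.mono (hsub.trans hKΩ))
      (fun z hz ↦ hclose z (hsub hz)) hm
  have hN₁ := hwind L.R_pos.le hsphR hN
  choose n hn0 hn using fun i ↦ M.wind_nonneg (i := i) (A := A) (B := B) (C := C) (D := -w)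
    fun z hz ↦ hG₁S z (M'.sphere_subset i hz)
  set Z : Set ℂ := {z ∈ closedBall c₀ R | G₁ z = 0} with hZ
  have hZc : IsCompact Z := by
    have : Z = closedBall c₀ R ∩ (fun z ↦ G₁ z) ⁻¹' {0} := rfl
    rw [this]
    exact (isCompact_closedBall c₀ R).of_isClosed_subset
      ((hG₁c.mono L.sub).preimage_isClosed_of_isClosed isClosed_closedBall isClosed_singleton)
      inter_subset_left
  obtain ⟨T, hT⟩ := hZc.elim_finite_subcover (fun i ↦ ball (c i) (r i)) (fun i ↦ isOpen_ball)
    fun z hz ↦ mem_iUnion.2 (M'.exists_mem_ball (L.sub hz.1) fun hzS ↦ hG₁S z hzS hz.2)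
  set T' := T.filter fun i ↦ (ball (c i) (r i) ∩ Z).Nonempty with hT'
  have hTsub : ∀ k ∈ T' ∪ J, closedBall (c k) (r k) ⊆ ball c₀ R := by
    intro k hk
    rcases Finset.mem_union.1 hk with hk | hk
    · obtain ⟨z, hzk, hz⟩ := (Finset.mem_filter.1 hk).2
      refine L.inside k (not_disjoint_iff.2 ⟨z, ball_subset_closedBall hzk, ?_⟩)
      by_contra hzp
      exact hG₁K z (Or.inl ⟨hz.1, fun h ↦ hzp (ball_subset_closedBall h)⟩) hz.2
    · exact (hJ k hk).1
  have hsum : Wind G₁ c₀ R (∑ k ∈ T' ∪ J, n k) := by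
    refine wind_sum (T' ∪ J) c r n L.R_pos (fun k _ ↦ M.pos k) hTsub
      (fun k _ l _ hkl ↦ M.disj hkl) (hG₁c.mono (sdiff_subset.trans L.sub)) ?_ fun k _ ↦ hn k
    rintro z ⟨hz, hzT⟩ h0
    have hzZ : z ∈ Z := ⟨hz, h0⟩
    obtain ⟨i, hi, hzi⟩ := mem_iUnion₂.1 (hT hzZ)
    exact hzT (mem_iUnion₂.2 ⟨i, Finset.mem_union_left _
      (Finset.mem_filter.2 ⟨hi, z, hzi, hzZ⟩), hzi⟩)
  rw [hN₁.unique hsum]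
  have hnJ : ∀ j ∈ J, n j = 1 := fun j hj ↦
    (hn j).unique (hwind (M.pos j).le (hsphJ j hj) (hJ j hj).2.2)
  calc (J.card : ℤ) = ∑ j ∈ J, n j := by rw [Finset.sum_congr rfl hnJ]; simp
    _ ≤ ∑ k ∈ T' ∪ J, n k := Finset.sum_le_sum_of_subset_of_nonneg Finset.subset_union_right
      fun i _ _ ↦ hn0 i

end SchottkyMap

/-- Small perturbations of the coefficients of a bilinear form are dominated by the form on a
compact set on which it does not vanish. -/
theorem eventually_bilin_sub_lt {K : Set ℂ} (hK : IsCompact K) {F : ℂ → ℂ} (hF : ContinuousOn F K)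
    {A B C D : ℂ} (h0 : ∀ z ∈ K, A * z * F z + B * F z + C * z + D ≠ 0) {ι : Type*} {l : Filter ι}
    {a b c d : ι → ℂ} (ha : Tendsto a l (𝓝 A)) (hb : Tendsto b l (𝓝 B)) (hc : Tendsto c l (𝓝 C))
    (hd : Tendsto d l (𝓝 D)) : ∀ᶠ i in l, ∀ z ∈ K,
      ‖(a i * z * F z + b i * F z + c i * z + d i) - (A * z * F z + B * F z + C * z + D)‖ <
        ‖A * z * F z + B * F z + C * z + D‖ := by
  have hKK : IsCompact ((fun z ↦ (z, F z)) '' K) := hK.image_of_continuousOn (by fun_prop)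
  have key : ∀ᶠ x : ℂ × ℂ × ℂ × ℂ in 𝓝 (A, B, C, D), ∀ q ∈ (fun z ↦ (z, F z)) '' K,
      ‖(x.1 * q.1 * q.2 + x.2.1 * q.2 + x.2.2.1 * q.1 + x.2.2.2) -
        (A * q.1 * q.2 + B * q.2 + C * q.1 + D)‖ < ‖A * q.1 * q.2 + B * q.2 + C * q.1 + D‖ := by
    refine hKK.eventually_forall_of_forall_eventually ?_
    rintro _ ⟨z, hz, rfl⟩
    refine IsOpen.mem_nhds (isOpen_lt (Continuous.norm (by fun_prop))
      (Continuous.norm (by fun_prop))) ?_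
    simp only [mem_ofPred_eq, sub_self, norm_zero]
    exact norm_pos_iff.2 (h0 z hz)
  have ht : Tendsto (fun i ↦ (a i, b i, c i, d i)) l (𝓝 (A, B, C, D)) :=
    ha.prodMk_nhds (hb.prodMk_nhds (hc.prodMk_nhds hd))
  filter_upwards [ht.eventually key] with i hi z hz
  exact hi (z, F z) ⟨z, hz, rfl⟩

namespace SchottkyMap

variable {I : Type} {Ω S : Set ℂ} {c : I → ℂ} {r : I → ℝ} {F : ℂ → ℂ} {c' : I → ℂ} {r' : I → ℝ}

theorem eq_of_map_eq (M : SchottkyMap Ω S c r F c' r') {p z : ℂ} (hp : p ∈ S) (hz : z ∈ Ω)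
    (h : F z = F p) : z = p := by
  by_cases hzS : z ∈ S
  · exact M.injOn hzS hp h
  · obtain ⟨i, hi⟩ := M.toSchottkyData.exists_mem_ball hz hzS
    exact (M.notMem_ball p hp i (h ▸ M.maps_ball i hi)).elim

/-- A circle winds zero times around a point far from its image. -/
theorem wind_sub_far (M : SchottkyMap Ω S c r F c' r') {i : I} {y : ℂ} (hy : r' i < ‖c' i - y‖) :
    Wind (fun z ↦ F z - y) (c i) (r i) 0 := by
  have hc : ContinuousOn F (sphere (c i) (r i)) :=
    M.cont.mono (sphere_subset_closedBall.trans (M.sub i))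
  refine Wind.of_norm_sub_lt (M.pos i).le (hc.sub continuousOn_const)
    (continuousOn_const (c := c' i - y)) (fun z hz ↦ ?_) (Wind.const ?_)
  · rw [sub_sub_sub_cancel_right, ← dist_eq_norm, mem_sphere.1 (M.maps_sphere i hz)]
    exact hy
  · exact norm_pos_iff.1 ((M.pos' i).trans hy)

/-- The filter of discs shrinking to a point. -/
def near (c : I → ℂ) (r : I → ℝ) (F : ℂ → ℂ) (c' : I → ℂ) (r' : I → ℝ) (p : ℂ) : Filter I :=
  comap (fun i ↦ (c i, r i, c' i, r' i)) (𝓝 (p, 0, F p, 0))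

theorem tendsto_near (p : ℂ) : Tendsto (fun i ↦ (c i, r i, c' i, r' i)) (near c r F c' r' p)
    (𝓝 (p, 0, F p, 0)) := tendsto_comap

theorem tendsto_c (p : ℂ) : Tendsto c (near c r F c' r' p) (𝓝 p) :=
  (continuous_fst.tendsto _).comp (tendsto_near p)

theorem tendsto_r (p : ℂ) : Tendsto r (near c r F c' r' p) (𝓝 0) :=
  ((continuous_fst.comp continuous_snd).tendsto _).comp (tendsto_near p)

theorem tendsto_c' (p : ℂ) : Tendsto c' (near c r F c' r' p) (𝓝 (F p)) :=
  ((continuous_fst.comp (continuous_snd.comp continuous_snd)).tendsto _).comp (tendsto_near p)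

theorem tendsto_r' (p : ℂ) : Tendsto r' (near c r F c' r' p) (𝓝 0) :=
  ((continuous_snd.comp (continuous_snd.comp continuous_snd)).tendsto _).comp (tendsto_near p)

theorem eventually_closedBall_subset (p : ℂ) {ε : ℝ} (hε : 0 < ε) :
    ∀ᶠ i in near c r F c' r' p, closedBall (c i) (r i) ⊆ ball p ε := by
  have h1 : Tendsto (fun i ↦ r i + dist (c i) p) (near c r F c' r' p) (𝓝 (0 + dist p p)) :=
    (tendsto_r p).add ((tendsto_c p).dist tendsto_const_nhds)
  rw [dist_self, add_zero] at h1
  filter_upwards [h1.eventually_lt_const hε] with i hi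
  exact closedBall_subset_ball' hi

theorem neBot_near (M : SchottkyMap Ω S c r F c' r') {p : ℂ} (hp : p ∈ S) :
    (near c r F c' r' p).NeBot := by
  have M' := M.toSchottkyData
  refine comap_neBot fun t ht ↦ ?_
  obtain ⟨ε, hε, hsub⟩ := Metric.mem_nhds_iff.1 ht
  have hFp : ContinuousAt F p := M.cont.continuousAt (M.isOpen.mem_nhds (M'.subset hp))
  obtain ⟨ρ, hρ, hFρ⟩ := Metric.continuousAt_iff.1 hFp (ε / 2) (by positivity)
  obtain ⟨i, hi⟩ := M'.exists_closedBall_subset M.null hp (show 0 < min ρ (ε / 2) by positivity)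
  refine ⟨i, hsub ?_⟩
  have hc1 := mem_ball.1 (hi (mem_closedBall_self (M.pos i).le))
  have hsph : ∀ z ∈ sphere (c i) (r i), dist (F z) (F p) < ε / 2 := fun z hz ↦
    hFρ ((mem_ball.1 (hi (sphere_subset_closedBall hz))).trans_le (min_le_left _ _))
  obtain ⟨z, hz⟩ := (NormedSpace.sphere_nonempty (x := c i)).2 (M.pos i).le
  have hc2 : dist (c' i) (F p) < ε / 2 := by
    by_contra! hcon
    have hw : Wind (fun z ↦ F z - c' i) (c i) (r i) 0 := by
      refine Wind.of_norm_sub_lt (M.pos i).le ((M.cont.mono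
        (sphere_subset_closedBall.trans (M.sub i))).sub continuousOn_const)
        (continuousOn_const (c := F p - c' i)) (fun z hz ↦ ?_) (Wind.const ?_)
      · rw [sub_sub_sub_cancel_right, ← dist_eq_norm, ← dist_eq_norm, dist_comm (F p)]
        exact (hsph z hz).trans_le hcon
      · intro h0
        rw [sub_eq_zero.1 h0, dist_self] at hcon
        linarith
    exact one_ne_zero ((M.wind i).unique hw)
  have hr'1 : r' i < ε := by
    rw [← mem_sphere.1 (M.maps_sphere i hz)]
    calc dist (F z) (c' i) ≤ dist (F z) (F p) + dist (c' i) (F p) := dist_triangle_right _ _ _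
      _ < ε := by linarith [hsph z hz]
  have hr1 : r i < ε := by
    rw [← mem_sphere.1 hz]
    calc dist z (c i) ≤ dist z p + dist (c i) p := dist_triangle_right _ _ _
      _ < ε := by
        have h1 := mem_ball.1 (hi (sphere_subset_closedBall hz))
        have h2 : min ρ (ε / 2) ≤ ε / 2 := min_le_right _ _
        linarith
  have hc1' : dist (c i) p < ε := by
    have h2 : min ρ (ε / 2) ≤ ε / 2 := min_le_right _ _
    linarith
  simp only [mem_ball, Prod.dist_eq, max_lt_iff, Real.dist_eq, sub_zero, abs_of_pos (M.pos i),
    abs_of_pos (M.pos' i)]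
  exact ⟨hc1', hr1, by linarith, hr'1⟩

theorem neBot_nhdsWithin (M : SchottkyMap Ω S c r F c' r') {p : ℂ} (hp : p ∈ S) :
    (𝓝[S \ {p}] p).NeBot := by
  rw [← mem_closure_iff_nhdsWithin_neBot, Metric.mem_closure_iff]
  intro ε hε
  have := M.neBot_near hp
  obtain ⟨i, hi⟩ := (eventually_closedBall_subset (c := c) (r := r) (F := F) (c' := c') (r' := r')
    p hε).exists
  have hnt : (sphere (c i) (r i)).Nontrivial := by
    refine ⟨c i + r i, by simp [abs_of_pos (M.pos i)], c i - r i, by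
      simp [abs_of_pos (M.pos i)], fun h ↦ ?_⟩
    have h2 : (r i : ℂ) = 0 := by linear_combination h / 2
    exact (M.pos i).ne' (by exact_mod_cast h2)
  obtain ⟨z, hz, hzp⟩ := hnt.exists_ne p
  exact ⟨z, ⟨M.toSchottkyData.sphere_subset i hz, hzp⟩, by
    rw [dist_comm]; exact mem_ball.1 (hi (sphere_subset_closedBall hz))⟩

/-- Schottky sets are locally not contained in a generalized circle. -/
theorem not_subset_circle (M : SchottkyMap Ω S c r F c' r') {q : ℂ} (hq : q ∈ S) {U : Set ℂ}
    (hU : U ∈ 𝓝 q) (a : ℂ) {e d : ℝ} {b : ℂ}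
    (h : ∀ x ∈ S ∩ U, e * ‖x - a‖ ^ 2 + (b * (x - a)).re + d = 0) : e = 0 ∧ b = 0 ∧ d = 0 := by
  have M' := M.toSchottkyData
  have := M.neBot_near hq
  have key : ∀ i, closedBall (c i) (r i) ⊆ U →
      2 * e * (c i - a).re + b.re = 0 ∧ 2 * e * (c i - a).im - b.im = 0 := by
    intro i hi
    have hr := M.pos i
    have hmem : ∀ u : ℂ, ‖u‖ = r i → c i + u ∈ S ∩ U := fun u hu ↦ by
      have hs : c i + u ∈ sphere (c i) (r i) := by simp [hu]
      exact ⟨M'.sphere_subset i hs, hi (sphere_subset_closedBall hs)⟩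
    have hre : ∀ u : ℂ, ‖u‖ = r i → e * (((c i - a).re + u.re) ^ 2 + ((c i - a).im + u.im) ^ 2) +
        (b.re * ((c i - a).re + u.re) - b.im * ((c i - a).im + u.im)) + d = 0 := fun u hu ↦ by
      have h1 := h _ (hmem u hu)
      have h2 : c i + u - a = (c i - a) + u := by ring
      rw [h2, ← Complex.normSq_eq_norm_sq, Complex.normSq_apply, Complex.mul_re, Complex.add_re,
        Complex.add_im] at h1
      linear_combination h1
    have h1 := hre (r i) (by simp [abs_of_pos hr])
    have h2 := hre (-r i) (by simp [abs_of_pos hr])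
    have h3 := hre (r i * Complex.I) (by simp [abs_of_pos hr])
    have h4 := hre (-r i * Complex.I) (by simp [abs_of_pos hr])
    simp at h1 h2 h3 h4
    constructor
    · have : r i * (2 * e * (c i - a).re + b.re) = 0 := by
        simp only [Complex.sub_re]
        linear_combination (h1 - h2) / 2
      exact (mul_eq_zero.1 this).resolve_left hr.ne'
    · have : r i * (2 * e * (c i - a).im - b.im) = 0 := by
        simp only [Complex.sub_im]
        linear_combination (h3 - h4) / 2
      exact (mul_eq_zero.1 this).resolve_left hr.ne'
  obtain ⟨ε, hε, hεU⟩ := Metric.mem_nhds_iff.1 hU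
  obtain ⟨i, hi⟩ := (eventually_closedBall_subset (c := c) (r := r) (F := F) (c' := c') (r' := r')
    q hε).exists
  have hqi : ∃ j, closedBall (c j) (r j) ⊆ ball q ε ∧ j ≠ i := by
    by_cases hqi : q = c i
    · exact ((M'.mem_iff.1 hq).2 i (hqi ▸ mem_ball_self (M.pos i))).elim
    · have h1 : 0 < min ε (dist q (c i)) := lt_min hε (dist_pos.2 hqi)
      obtain ⟨j, hj⟩ := (eventually_closedBall_subset (c := c) (r := r) (F := F) (c' := c')
        (r' := r') q h1).exists
      refine ⟨j, hj.trans (ball_subset_ball (min_le_left _ _)), fun hji ↦ ?_⟩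
      have h2 := mem_ball.1 (hj (mem_closedBall_self (M.pos j).le))
      rw [hji, dist_comm] at h2
      exact (h2.trans_le (min_le_right _ _)).false
  obtain ⟨j, hj, hji⟩ := hqi
  have ki := key i (hi.trans hεU)
  have kj := key j (hj.trans hεU)
  have hcc : c i ≠ c j := fun hc ↦ hji (M'.eq_of_mem (mem_closedBall_self (M.pos j).le)
    (hc ▸ mem_closedBall_self (M.pos i).le))
  have he : e = 0 := by
    by_contra he
    refine hcc (Complex.ext ?_ ?_)
    · have : e * ((c i).re - (c j).re) = 0 := by
        have h1 := ki.1; have h2 := kj.1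
        simp only [Complex.sub_re] at h1 h2
        linear_combination (h1 - h2) / 2
      exact sub_eq_zero.1 ((mul_eq_zero.1 this).resolve_left he)
    · have : e * ((c i).im - (c j).im) = 0 := by
        have h1 := ki.2; have h2 := kj.2
        simp only [Complex.sub_im] at h1 h2
        linear_combination (h1 - h2) / 2
      exact sub_eq_zero.1 ((mul_eq_zero.1 this).resolve_left he)
  have hb : b = 0 := by
    refine Complex.ext ?_ ?_
    · have := ki.1; rw [he] at this; simpa using this
    · have := ki.2; rw [he] at this; simpa using this
  refine ⟨he, hb, ?_⟩
  have := h q ⟨hq, mem_of_mem_nhds hU⟩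
  simpa [he, hb] using this

end SchottkyMap

/-- If one of two terms with the same winding number dominates, their difference has this winding
number. -/
theorem Wind.sub_of_norm_ne {a b : ℂ → ℂ} {c : ℂ} {r : ℝ} {n : ℤ} (hr : 0 ≤ r)
    (hac : ContinuousOn a (sphere c r)) (hbc : ContinuousOn b (sphere c r)) (K₁ K₂ : ℂ)
    (ha : Wind a c r n) (hb : Wind b c r n)
    (hne : ∀ z ∈ sphere c r, ‖K₁ * a z‖ ≠ ‖K₂ * b z‖) :
    (∀ z ∈ sphere c r, K₁ * a z - K₂ * b z ≠ 0) ∧ Wind (fun z ↦ K₁ * a z - K₂ * b z) c r n := by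
  refine ⟨fun z hz h0 ↦ hne z hz (by rw [sub_eq_zero.1 h0]), ?_⟩
  obtain ⟨z₀, hz₀⟩ := (NormedSpace.sphere_nonempty (x := c)).2 hr
  have hpre : IsPreconnected (sphere c r) :=
    isPreconnected_sphere (by rw [Complex.rank_real_complex]; norm_num) c r
  have hac' : ContinuousOn (fun z ↦ K₁ * a z) (sphere c r) := continuousOn_const.mul hac
  have hbc' : ContinuousOn (fun z ↦ K₂ * b z) (sphere c r) := continuousOn_const.mul hbc
  rcases lt_or_gt_of_ne (hne z₀ hz₀) with hlt | hlt
  · have hall : ∀ z ∈ sphere c r, ‖K₁ * a z‖ < ‖K₂ * b z‖ := by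
      intro z hz
      by_contra! hcon
      obtain ⟨w, hw, hw'⟩ := hpre.intermediate_value₂ hz₀ hz hac'.norm hbc'.norm hlt.le hcon
      exact hne w hw hw'
    have hK : -K₂ ≠ 0 := by
      rintro h
      rw [neg_eq_zero.1 h] at hlt
      simp only [zero_mul, norm_zero] at hlt
      exact (norm_nonneg _).not_gt hlt
    have hw := (Wind.const (c := c) (r := r) hK).mul hb
    rw [zero_add] at hw
    refine Wind.of_norm_sub_lt (h := fun z ↦ -K₂ * b z) hr (hac'.sub hbc')
      (continuousOn_const.mul hbc) (fun z hz ↦ ?_) hw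
    have h1 : K₁ * a z - K₂ * b z - -K₂ * b z = K₁ * a z := by ring
    rw [h1, neg_mul, norm_neg]
    exact hall z hz
  · have hall : ∀ z ∈ sphere c r, ‖K₂ * b z‖ < ‖K₁ * a z‖ := by
      intro z hz
      by_contra! hcon
      obtain ⟨w, hw, hw'⟩ := hpre.intermediate_value₂ hz₀ hz hbc'.norm hac'.norm hlt.le hcon
      exact hne w hw hw'.symm
    have hK : K₁ ≠ 0 := by
      rintro rfl
      simp only [zero_mul, norm_zero] at hlt
      exact (norm_nonneg _).not_gt hlt
    have hw := (Wind.const (c := c) (r := r) hK).mul ha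
    rw [zero_add] at hw
    refine Wind.of_norm_sub_lt hr (hac'.sub hbc') hac' (fun z hz ↦ ?_) hw
    rw [sub_sub_cancel_left, norm_neg]
    exact hall z hz

namespace SchottkyMap

variable {I : Type} {Ω S : Set ℂ} {c : I → ℂ} {r : I → ℝ} {F : ℂ → ℂ} {c' : I → ℂ} {r' : I → ℝ}

theorem wind_sub_of_ne (M : SchottkyMap Ω S c r F c' r') {i k : I} (hik : i ≠ k) :
    Wind (fun z ↦ F z - c' k) (c i) (r i) 0 := by
  refine M.wind_sub_far ?_
  rw [← dist_eq_norm, dist_comm]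
  exact not_le.1 fun h ↦ disjoint_left.1 (M.disj' hik) (mem_closedBall.2 h)
    (mem_closedBall_self (M.pos' k).le)

theorem wind_id_sub_of_ne (M : SchottkyMap Ω S c r F c' r') {i k : I} (hik : i ≠ k) :
    Wind (fun z ↦ z - c k) (c i) (r i) 0 :=
  Wind.id_sub_of_notMem (M.pos i).le fun h ↦ disjoint_left.1 (M.disj hik) h
    (mem_closedBall_self (M.pos k).le)

theorem continuousOn_sphere (M : SchottkyMap Ω S c r F c' r') (i : I) :
    ContinuousOn F (sphere (c i) (r i)) :=
  M.cont.mono (sphere_subset_closedBall.trans (M.sub i))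

/-- The form with zeros at the centres of two discs has winding number one around the first
disc as soon as one of its terms dominates. -/
theorem wind_first (M : SchottkyMap Ω S c r F c' r') {i k : I} (hik : i ≠ k) (K₁ K₂ : ℂ)
    (hne : ∀ z ∈ sphere (c i) (r i), ‖K₁‖ * (r' i * ‖z - c k‖) ≠ ‖K₂‖ * (‖F z - c' k‖ * r i)) :
    (∀ z ∈ sphere (c i) (r i),
      K₁ * ((F z - c' i) * (z - c k)) - K₂ * ((F z - c' k) * (z - c i)) ≠ 0) ∧
    Wind (fun z ↦ K₁ * ((F z - c' i) * (z - c k)) - K₂ * ((F z - c' k) * (z - c i)))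
      (c i) (r i) 1 := by
  have hc := M.continuousOn_sphere i
  refine Wind.sub_of_norm_ne (M.pos i).le (by fun_prop) (by fun_prop) K₁ K₂
    (by simpa using (M.wind i).mul (M.wind_id_sub_of_ne hik))
    (by simpa using (M.wind_sub_of_ne hik).mul (Wind.id_sub_center (M.pos i))) fun z hz ↦ ?_
  have h1 : ‖z - c i‖ = r i := by rw [← dist_eq_norm]; exact mem_sphere.1 hz
  have h2 : ‖F z - c' i‖ = r' i := by rw [← dist_eq_norm]; exact mem_sphere.1 (M.maps_sphere i hz)
  rw [norm_mul, norm_mul, norm_mul, norm_mul, h1, h2]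
  exact hne z hz

theorem not_two_bad (M : SchottkyMap Ω S c r F c' r') {i k : I} (hik : i ≠ k) {K₁ K₂ : ℂ}
    (hK : K₁ ≠ 0 ∨ K₂ ≠ 0) {t t' : ℝ} (ht : 0 < t) (ht' : 0 < t')
    (hlt : t * ((‖c i - c k‖ + r i) * (‖c' i - c' k‖ + r' i)) <
      t' * ((‖c i - c k‖ - r i) * (‖c' i - c' k‖ - r' i)))
    {z z' : ℂ} (hz : z ∈ sphere (c i) (r i)) (hz' : z' ∈ sphere (c i) (r i))
    (h : t * ‖K₁‖ * (r' i * ‖z - c k‖) = ‖K₂‖ * (‖F z - c' k‖ * r i))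
    (h' : t' * ‖K₁‖ * (r' i * ‖z' - c k‖) = ‖K₂‖ * (‖F z' - c' k‖ * r i)) : False := by
  have hr := M.pos i
  have hr' := M.pos' i
  have hx : ∀ z ∈ sphere (c i) (r i), ‖z - c k‖ ≤ ‖c i - c k‖ + r i ∧
      ‖c i - c k‖ - r i ≤ ‖z - c k‖ := by
    intro z hz
    rw [← mem_sphere.1 hz, dist_eq_norm]
    constructor
    · have := norm_add_le (c i - c k) (z - c i)
      rwa [show c i - c k + (z - c i) = z - c k by ring] at this
    · have := norm_sub_norm_le (c i - c k) (c i - z)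
      rw [show c i - c k - (c i - z) = z - c k by ring, norm_sub_rev (c i) z] at this
      exact this
  have hy : ∀ z ∈ sphere (c i) (r i), ‖F z - c' k‖ ≤ ‖c' i - c' k‖ + r' i ∧
      ‖c' i - c' k‖ - r' i ≤ ‖F z - c' k‖ := by
    intro z hz
    rw [← mem_sphere.1 (M.maps_sphere i hz), dist_eq_norm]
    constructor
    · have := norm_add_le (c' i - c' k) (F z - c' i)
      rwa [show c' i - c' k + (F z - c' i) = F z - c' k by ring] at this
    · have := norm_sub_norm_le (c' i - c' k) (c' i - F z)
      rw [show c' i - c' k - (c' i - F z) = F z - c' k by ring, norm_sub_rev (c' i) (F z)] at this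
      exact this
  have hX : 0 < ‖c i - c k‖ - r i := by
    rw [sub_pos, ← dist_eq_norm, dist_comm]
    exact not_le.1 fun h ↦ disjoint_left.1 (M.disj hik) (mem_closedBall.2 h)
      (mem_closedBall_self (M.pos k).le)
  have hY : 0 < ‖c' i - c' k‖ - r' i := by
    rw [sub_pos, ← dist_eq_norm, dist_comm]
    exact not_le.1 fun h ↦ disjoint_left.1 (M.disj' hik) (mem_closedBall.2 h)
      (mem_closedBall_self (M.pos' k).le)
  have hxz := hx z hz
  have hxz' := hx z' hz'
  have hyz := hy z hz
  have hyz' := hy z' hz'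
  have hxp : 0 < ‖z - c k‖ := hX.trans_le hxz.2
  have hyp : 0 < ‖F z - c' k‖ := hY.trans_le hyz.2
  have hxp' : 0 < ‖z' - c k‖ := hX.trans_le hxz'.2
  have hK₁ : 0 < ‖K₁‖ := by
    rcases hK with hK | hK
    · exact norm_pos_iff.2 hK
    · have : 0 < ‖K₂‖ := norm_pos_iff.2 hK
      have h1 : 0 < t * ‖K₁‖ * (r' i * ‖z - c k‖) := by rw [h]; positivity
      by_contra! hcon
      rw [le_antisymm hcon (norm_nonneg _)] at h1
      simp at h1
  have hK₂ : 0 < ‖K₂‖ := by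
    have h1 : 0 < ‖K₂‖ * (‖F z - c' k‖ * r i) := by rw [← h]; positivity
    by_contra! hcon
    rw [le_antisymm hcon (norm_nonneg _)] at h1
    simp at h1
  have key : t * (‖z - c k‖ * ‖F z' - c' k‖) = t' * (‖z' - c k‖ * ‖F z - c' k‖) := by
    have h3 : (‖K₁‖ * r' i * (‖K₂‖ * r i)) * (t * (‖z - c k‖ * ‖F z' - c' k‖)) =
        (‖K₁‖ * r' i * (‖K₂‖ * r i)) * (t' * (‖z' - c k‖ * ‖F z - c' k‖)) := by
      linear_combination (‖K₂‖ * ‖F z' - c' k‖ * r i) * h - (‖K₂‖ * ‖F z - c' k‖ * r i) * h'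
    exact mul_left_cancel₀ (by positivity) h3
  have h4 : t * (‖z - c k‖ * ‖F z' - c' k‖) ≤
      t * ((‖c i - c k‖ + r i) * (‖c' i - c' k‖ + r' i)) := by
    have := hxz.1; have := hyz'.1
    gcongr
  have h5 : t' * ((‖c i - c k‖ - r i) * (‖c' i - c' k‖ - r' i)) ≤
      t' * (‖z' - c k‖ * ‖F z - c' k‖) := by
    have := hxz'.2; have := hyz.2
    gcongr
  linarith

theorem wind_second (M : SchottkyMap Ω S c r F c' r') {i k : I} (hik : i ≠ k) (K₁ K₂ : ℂ)
    (hne : ∀ z ∈ sphere (c k) (r k), ‖K₂‖ * (r' k * ‖z - c i‖) ≠ ‖K₁‖ * (‖F z - c' i‖ * r k)) :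
    (∀ z ∈ sphere (c k) (r k),
      K₁ * ((F z - c' i) * (z - c k)) - K₂ * ((F z - c' k) * (z - c i)) ≠ 0) ∧
    Wind (fun z ↦ K₁ * ((F z - c' i) * (z - c k)) - K₂ * ((F z - c' k) * (z - c i)))
      (c k) (r k) 1 := by
  obtain ⟨h1, h2⟩ := M.wind_first hik.symm (-K₂) (-K₁) (by simpa only [norm_neg] using hne)
  constructor
  · intro z hz h0
    refine h1 z hz ?_
    linear_combination h0
  · refine h2.congr (M.pos k).le fun z _ ↦ ?_
    ring

theorem eventually_card_le (M : SchottkyMap Ω S c r F c' r') {p c₀ : ℂ} {R δ : ℝ}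
    (L : SchottkyData.LocalDisc Ω c r p c₀ R δ) {A B C D : ℂ}
    (hreg : ∀ z ∈ closedBall c₀ R \ ball p δ, A * z * F z + B * F z + C * z + D ≠ 0) {N : ℤ}
    (hN : Wind (fun z ↦ A * z * F z + B * F z + C * z + D) c₀ R N) (J : Finset I)
    (hJ : ∀ j ∈ J, closedBall (c j) (r j) ⊆ ball c₀ R ∧
      (∀ z ∈ sphere (c j) (r j), A * z * F z + B * F z + C * z + D ≠ 0) ∧
      Wind (fun z ↦ A * z * F z + B * F z + C * z + D) (c j) (r j) 1)
    {ι : Type*} {l : Filter ι} {a b c₁ d : ι → ℂ} (ha : Tendsto a l (𝓝 A)) (hb : Tendsto b l (𝓝 B))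
    (hc : Tendsto c₁ l (𝓝 C)) (hd : Tendsto d l (𝓝 D)) :
    ∀ᶠ x in l, ∀ J' : Finset I, Disjoint J J' → (∀ j ∈ J', closedBall (c j) (r j) ⊆ ball c₀ R ∧
      (∀ z ∈ sphere (c j) (r j), a x * z * F z + b x * F z + c₁ x * z + d x ≠ 0) ∧
      Wind (fun z ↦ a x * z * F z + b x * F z + c₁ x * z + d x) (c j) (r j) 1) →
      ((J.card + J'.card : ℕ) : ℤ) ≤ N := by
  classical
  set G : ℂ → ℂ := fun z ↦ A * z * F z + B * F z + C * z + D with hG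
  have hGc : ContinuousOn G Ω := continuousOn_bilin M.cont A B C D
  set K : Set ℂ := (closedBall c₀ R \ ball p δ) ∪ ⋃ j ∈ J, sphere (c j) (r j) with hK
  have hKc : IsCompact K := ((isCompact_closedBall c₀ R).diff isOpen_ball).union
    (J.isCompact_biUnion fun j _ ↦ isCompact_sphere _ _)
  have hKΩ : K ⊆ Ω := by
    refine union_subset (sdiff_subset.trans L.sub) (iUnion₂_subset fun j _ ↦ ?_)
    exact sphere_subset_closedBall.trans (M.sub j)
  have hsphR : sphere c₀ R ⊆ K := fun z hz ↦ Or.inl ⟨sphere_subset_closedBall hz, fun hzp ↦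
    (mem_ball.1 (L.closedBall_sub (ball_subset_closedBall hzp))).ne (mem_sphere.1 hz)⟩
  have hsphJ : ∀ j ∈ J, sphere (c j) (r j) ⊆ K := fun j hj z hz ↦
    Or.inr (mem_iUnion₂.2 ⟨j, hj, hz⟩)
  have hG0 : ∀ z ∈ K, G z ≠ 0 := by
    rintro z (hz | hz)
    · exact hreg z hz
    · obtain ⟨j, hj, hz⟩ := mem_iUnion₂.1 hz
      exact (hJ j hj).2.1 z hz
  filter_upwards [eventually_bilin_sub_lt hKc (M.cont.mono hKΩ) hG0 ha hb
    hc hd] with x hx J' hJJ' hJ'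
  have hx0 : ∀ z ∈ K, a x * z * F z + b x * F z + c₁ x * z + d x ≠ 0 := fun z hz h0 ↦ by
    have := hx z hz
    rw [h0, zero_sub, norm_neg] at this
    exact lt_irrefl _ this
  have hwind : ∀ {a' : ℂ} {ρ : ℝ} {m : ℤ}, 0 ≤ ρ → sphere a' ρ ⊆ K → Wind G a' ρ m →
      Wind (fun z ↦ a x * z * F z + b x * F z + c₁ x * z + d x) a' ρ m := fun hρ hsub hm ↦
    Wind.of_norm_sub_lt hρ (continuousOn_bilin (M.cont.mono (hsub.trans hKΩ)) _ _ _ _)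
      (hGc.mono (hsub.trans hKΩ)) (fun z hz ↦ hx z (hsub hz)) hm
  rw [← Finset.card_union_of_disjoint hJJ']
  refine M.card_le L (fun z hz ↦ hx0 z (Or.inl hz)) (hwind L.R_pos.le hsphR hN) (J ∪ J') ?_
  intro j hj
  rcases Finset.mem_union.1 hj with hj | hj
  · exact ⟨(hJ j hj).1, fun z hz ↦ hx0 z (hsphJ j hj hz),
      hwind (M.pos j).le (hsphJ j hj) (hJ j hj).2.2⟩
  · exact hJ' j hj

theorem exists_three {P : ℝ → Prop} (h : ∀ᶠ t in 𝓝 (1 : ℝ), P t) :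
    ∃ t₀ t₁ t₂, P t₀ ∧ P t₁ ∧ P t₂ ∧ 0 < t₀ ∧ t₀ < t₁ ∧ t₁ < t₂ := by
  obtain ⟨ε, hε, hP⟩ := Metric.eventually_nhds_iff.1 h
  refine ⟨1, 1 + ε / 4, 1 + ε / 2, hP ?_, hP ?_, hP ?_, one_pos, by linarith, by linarith⟩
  · simpa using hε
  · rw [Real.dist_eq, add_sub_cancel_left, abs_of_pos (by positivity)]; linarith
  · rw [Real.dist_eq, add_sub_cancel_left, abs_of_pos (by positivity)]; linarith

theorem eventually_notMem (M : SchottkyMap Ω S c r F c' r') (q : ℂ) (J : Finset I) :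
    ∀ᶠ i in near c r F c' r' q, i ∉ J := by
  have : ∀ᶠ i in near c r F c' r' q, ∀ j ∈ J, r i < r j :=
    (Filter.eventually_all_finset J).2 fun j _ ↦ (tendsto_r q).eventually_lt_const (M.pos j)
  filter_upwards [this] with i hi hiJ
  exact (hi i hiJ).false

/-- A form with two zeros in the Schottky set. -/
theorem exists_node_form (M : SchottkyMap Ω S c r F c' r') {A B C D q₀ q₂ : ℂ} (h₀ : q₀ ∈ S)
    (h₂ : q₂ ∈ S) (hne : q₀ ≠ q₂) (hz₀ : A * q₀ * F q₀ + B * F q₀ + C * q₀ + D = 0)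
    (hz₂ : A * q₂ * F q₂ + B * F q₂ + C * q₂ + D = 0) : ∃ K₁ K₂ : ℂ, ∀ z w : ℂ,
      A * z * w + B * w + C * z + D =
        K₁ * ((w - F q₀) * (z - q₂)) - K₂ * ((w - F q₂) * (z - q₀)) := by
  have hx : q₀ - q₂ ≠ 0 := sub_ne_zero.2 hne
  have hy : F q₀ - F q₂ ≠ 0 := sub_ne_zero.2 fun h ↦ hne (M.injOn h₀ h₂ h)
  have hD : D = -(A * q₀ * F q₀ + B * F q₀ + C * q₀) := by linear_combination hz₀
  have hB : B * (F q₀ - F q₂) = -(A * (q₀ * F q₀ - q₂ * F q₂) + C * (q₀ - q₂)) := by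
    linear_combination hz₀ - hz₂
  have hB' : B = -(A * (q₀ * F q₀ - q₂ * F q₂) + C * (q₀ - q₂)) / (F q₀ - F q₂) := by
    rw [eq_div_iff hy, hB]
  refine ⟨(A * q₀ * F q₂ + B * F q₂ + C * q₀ + D) / ((F q₂ - F q₀) * (q₀ - q₂)),
    -(A * q₂ * F q₀ + B * F q₀ + C * q₂ + D) / ((F q₀ - F q₂) * (q₂ - q₀)), fun z w ↦ ?_⟩
  have hx' : q₂ - q₀ ≠ 0 := sub_ne_zero.2 hne.symm
  have hy' : F q₂ - F q₀ ≠ 0 := by rw [← neg_sub]; exact neg_ne_zero.2 hy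
  rw [hD, hB']
  generalize F q₀ = y₀ at *
  generalize F q₂ = y₂ at *
  field_simp
  ring

theorem eventually_not_two_bad (M : SchottkyMap Ω S c r F c' r') {q₀ q₂ : ℂ} (h₀ : q₀ ∈ S)
    (h₂ : q₂ ∈ S) (hne : q₀ ≠ q₂) {K₁ K₂ : ℂ} (hK : K₁ ≠ 0 ∨ K₂ ≠ 0) {t t' : ℝ} (ht : 0 < t)
    (htt' : t < t') :
    ∀ᶠ x : I × I in near c r F c' r' q₀ ×ˢ near c r F c' r' q₂, x.1 ≠ x.2 ∧
      ((∀ z ∈ sphere (c x.1) (r x.1), t * ‖K₁‖ * (r' x.1 * ‖z - c x.2‖) ≠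
        ‖K₂‖ * (‖F z - c' x.2‖ * r x.1)) ∨
      (∀ z ∈ sphere (c x.1) (r x.1), t' * ‖K₁‖ * (r' x.1 * ‖z - c x.2‖) ≠
        ‖K₂‖ * (‖F z - c' x.2‖ * r x.1))) := by
  set l := near c r F c' r' q₀ ×ˢ near c r F c' r' q₂
  have hX : 0 < ‖q₀ - q₂‖ := norm_pos_iff.2 (sub_ne_zero.2 hne)
  have hY : 0 < ‖F q₀ - F q₂‖ := norm_pos_iff.2 (sub_ne_zero.2 fun h ↦ hne (M.injOn h₀ h₂ h))
  have t1 : Tendsto (fun x : I × I ↦ ‖c x.1 - c x.2‖) l (𝓝 ‖q₀ - q₂‖) :=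
    (((tendsto_c q₀).comp tendsto_fst).sub ((tendsto_c q₂).comp tendsto_snd)).norm
  have t2 : Tendsto (fun x : I × I ↦ ‖c' x.1 - c' x.2‖) l (𝓝 ‖F q₀ - F q₂‖) :=
    (((tendsto_c' q₀).comp tendsto_fst).sub ((tendsto_c' q₂).comp tendsto_snd)).norm
  have t3 : Tendsto (fun x : I × I ↦ r x.1) l (𝓝 0) := (tendsto_r q₀).comp tendsto_fst
  have t4 : Tendsto (fun x : I × I ↦ r' x.1) l (𝓝 0) := (tendsto_r' q₀).comp tendsto_fst
  have t5 := ((t1.add t3).mul (t2.add t4)).const_mul t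
  have t6 := ((t1.sub t3).mul (t2.sub t4)).const_mul t'
  have hlt : t * ((‖q₀ - q₂‖ + 0) * (‖F q₀ - F q₂‖ + 0)) <
      t' * ((‖q₀ - q₂‖ - 0) * (‖F q₀ - F q₂‖ - 0)) := by
    rw [add_zero, add_zero, sub_zero, sub_zero]
    gcongr
  filter_upwards [t5.eventually_lt t6 hlt, t1.eventually_const_lt hX] with x hx hx1
  have hik : x.1 ≠ x.2 := fun h ↦ by rw [h, sub_self, norm_zero] at hx1; exact lt_irrefl _ hx1
  refine ⟨hik, ?_⟩
  by_contra! hcon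
  obtain ⟨⟨z, hz, h⟩, z', hz', h'⟩ := hcon
  exact M.not_two_bad hik hK ht (ht.trans htt') hx hz hz' h h'

theorem add_two_le (M : SchottkyMap Ω S c r F c' r') {c₀ K₁ K₂ : ℂ} {R : ℝ} {N : ℤ}
    {J : Finset I} {i k : I} (hik : i ≠ k) (hi : closedBall (c i) (r i) ⊆ ball c₀ R)
    (hk : closedBall (c k) (r k) ⊆ ball c₀ R) (hiJ : i ∉ J) (hkJ : k ∉ J) {t : ℝ} (ht : 0 < t)
    (h1 : ∀ z ∈ sphere (c i) (r i), t * ‖K₁‖ * (r' i * ‖z - c k‖) ≠ ‖K₂‖ * (‖F z - c' k‖ * r i))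
    (h2 : ∀ z ∈ sphere (c k) (r k), t⁻¹ * ‖K₂‖ * (r' k * ‖z - c i‖) ≠
      ‖K₁‖ * (‖F z - c' i‖ * r k))
    (h3 : ∀ J' : Finset I, Disjoint J J' → (∀ j ∈ J',
      closedBall (c j) (r j) ⊆ ball c₀ R ∧ (∀ z ∈ sphere (c j) (r j), (t * K₁ - K₂) * z * F z +
      (-(t * K₁) * c k + K₂ * c i) * F z + (-(t * K₁) * c' i + K₂ * c' k) * z +
      ((t * K₁) * c' i * c k - K₂ * c' k * c i) ≠ 0) ∧ Wind (fun z ↦ (t * K₁ - K₂) * z * F z +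
      (-(t * K₁) * c k + K₂ * c i) * F z + (-(t * K₁) * c' i + K₂ * c' k) * z +
      ((t * K₁) * c' i * c k - K₂ * c' k * c i)) (c j) (r j) 1) →
      ((J.card + J'.card : ℕ) : ℤ) ≤ N) : (J.card : ℤ) + 2 ≤ N := by
  classical
  have hnt : ‖(t : ℂ) * K₁‖ = t * ‖K₁‖ := by
    rw [norm_mul, Complex.norm_real, Real.norm_of_nonneg ht.le]
  have w1 := M.wind_first hik (t * K₁) K₂ (by rw [hnt]; exact h1)
  have w2 := M.wind_second hik (t * K₁) K₂ (by
    rw [hnt]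
    intro z hz h
    refine h2 z hz ?_
    rw [mul_assoc, h]
    field_simp)
  have hid : ∀ z, (t * K₁ - K₂) * z * F z +
    (-(t * K₁) * c k + K₂ * c i) * F z + (-(t * K₁) * c' i + K₂ * c' k) * z +
    ((t * K₁) * c' i * c k - K₂ * c' k * c i) =
    t * K₁ * ((F z - c' i) * (z - c k)) - K₂ * ((F z - c' k) * (z - c i)) := fun z ↦ by ring
  have := h3 {i, k} ?_ ?_
  · rw [Finset.card_pair hik] at this
    exact_mod_cast this
  · rw [Finset.disjoint_right]
    intro j hj
    rcases Finset.mem_insert.1 hj with rfl | hj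
    · exact hiJ
    · rw [Finset.mem_singleton.1 hj]; exact hkJ
  · intro j hj
    simp only [hid]
    rcases Finset.mem_insert.1 hj with rfl | hj
    · exact ⟨hi, w1⟩
    · rw [Finset.mem_singleton.1 hj]; exact ⟨hk, w2⟩

theorem pigeonhole_three {a₀ a₁ a₂ b₀ b₁ b₂ : Prop} (h01 : a₀ ∨ a₁) (h02 : a₀ ∨ a₂) (h12 : a₁ ∨ a₂)
    (k01 : b₁ ∨ b₀) (k02 : b₂ ∨ b₀) (k12 : b₂ ∨ b₁) : (a₀ ∧ b₀) ∨ (a₁ ∧ b₁) ∨ (a₂ ∧ b₂) := by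
  tauto

/-- Two zeros in the Schottky set count like two discs. -/
theorem two_add_card_le (M : SchottkyMap Ω S c r F c' r') {p c₀ : ℂ} {R δ : ℝ}
    (L : SchottkyData.LocalDisc Ω c r p c₀ R δ) {A B C D : ℂ}
    (hreg : ∀ z ∈ closedBall c₀ R \ ball p δ, A * z * F z + B * F z + C * z + D ≠ 0) {N : ℤ}
    (hN : Wind (fun z ↦ A * z * F z + B * F z + C * z + D) c₀ R N) {q₀ q₂ : ℂ} (h₀ : q₀ ∈ S)
    (h₂ : q₂ ∈ S) (hp₀ : q₀ ∈ ball p δ) (hp₂ : q₂ ∈ ball p δ) (hne : q₀ ≠ q₂)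
    (hz₀ : A * q₀ * F q₀ + B * F q₀ + C * q₀ + D = 0)
    (hz₂ : A * q₂ * F q₂ + B * F q₂ + C * q₂ + D = 0) (J : Finset I)
    (hJ : ∀ j ∈ J, closedBall (c j) (r j) ⊆ ball c₀ R ∧
      (∀ z ∈ sphere (c j) (r j), A * z * F z + B * F z + C * z + D ≠ 0) ∧
      Wind (fun z ↦ A * z * F z + B * F z + C * z + D) (c j) (r j) 1) :
    (J.card : ℤ) + 2 ≤ N := by
  classical
  obtain ⟨K₁, K₂, hK⟩ := M.exists_node_form h₀ h₂ hne hz₀ hz₂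
  have hA : A = K₁ - K₂ := by
    linear_combination hK 1 1 - hK 1 0 - hK 0 1 + hK 0 0
  have hB : B = -K₁ * q₂ + K₂ * q₀ := by linear_combination hK 0 1 - hK 0 0
  have hC : C = -K₁ * F q₀ + K₂ * F q₂ := by linear_combination hK 1 0 - hK 0 0
  have hD : D = K₁ * F q₀ * q₂ - K₂ * F q₂ * q₀ := by linear_combination hK 0 0
  have hKne : K₁ ≠ 0 ∨ K₂ ≠ 0 := by
    by_contra! hcon
    have hs : c₀ + R ∈ closedBall c₀ R \ ball p δ := by
      refine ⟨by simp [abs_of_pos L.R_pos], fun h ↦ ?_⟩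
      have := L.closedBall_sub (ball_subset_closedBall h)
      simp [abs_of_pos L.R_pos] at this
    refine hreg _ hs ?_
    rw [hK, hcon.1, hcon.2]
    ring
  set l := near c r F c' r' q₀ ×ˢ near c r F c' r' q₂ with hl
  have n₀ := M.neBot_near h₀
  have n₂ := M.neBot_near h₂
  have tt : Tendsto (fun x : ℝ × I × I ↦ ((x.1 : ℝ) : ℂ)) (𝓝 1 ×ˢ l) (𝓝 1) := by
    have h1 : Tendsto (fun t : ℝ ↦ (t : ℂ)) (𝓝 1) (𝓝 1) := by
      simpa using (Complex.continuous_ofReal.tendsto (1 : ℝ))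
    exact h1.comp tendsto_fst
  have tx₀ : Tendsto (fun x : ℝ × I × I ↦ c x.2.1) (𝓝 1 ×ˢ l) (𝓝 q₀) :=
    (tendsto_c q₀).comp (tendsto_fst.comp tendsto_snd)
  have ty₀ : Tendsto (fun x : ℝ × I × I ↦ c' x.2.1) (𝓝 1 ×ˢ l) (𝓝 (F q₀)) :=
    (tendsto_c' q₀).comp (tendsto_fst.comp tendsto_snd)
  have tx₂ : Tendsto (fun x : ℝ × I × I ↦ c x.2.2) (𝓝 1 ×ˢ l) (𝓝 q₂) :=
    (tendsto_c q₂).comp (tendsto_snd.comp tendsto_snd)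
  have ty₂ : Tendsto (fun x : ℝ × I × I ↦ c' x.2.2) (𝓝 1 ×ˢ l) (𝓝 (F q₂)) :=
    (tendsto_c' q₂).comp (tendsto_snd.comp tendsto_snd)
  have tK₁ : Tendsto (fun x : ℝ × I × I ↦ ((x.1 : ℝ) : ℂ) * K₁) (𝓝 1 ×ˢ l) (𝓝 K₁) := by
    simpa using tt.mul_const K₁
  have key := M.eventually_card_le L hreg hN J hJ (l := 𝓝 (1 : ℝ) ×ˢ l)
    (a := fun x ↦ x.1 * K₁ - K₂) (b := fun x ↦ -(x.1 * K₁) * c x.2.2 + K₂ * c x.2.1)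
    (c₁ := fun x ↦ -(x.1 * K₁) * c' x.2.1 + K₂ * c' x.2.2)
    (d := fun x ↦ (x.1 * K₁) * c' x.2.1 * c x.2.2 - K₂ * c' x.2.2 * c x.2.1)
    (by rw [hA]; exact tK₁.sub_const K₂)
    (by rw [hB]; exact (tK₁.neg.mul tx₂).add (tx₀.const_mul K₂))
    (by rw [hC]; exact (tK₁.neg.mul ty₀).add (ty₂.const_mul K₂))
    (by rw [hD]; exact ((tK₁.mul ty₀).mul tx₂).sub ((ty₂.const_mul K₂).mul tx₀))
  obtain ⟨t₀, t₁, t₂, e₀, e₁, e₂, p₀, l₀₁, l₁₂⟩ := exists_three key.curry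
  have hsw : Tendsto Prod.swap l (near c r F c' r' q₂ ×ˢ near c r F c' r' q₀) := by
    rw [hl]; exact tendsto_prod_swap
  -- at the second circle the roles are exchanged and the parameter is inverted
  have hinv : ∀ {s t : ℝ}, 0 < s → s < t → 0 < t⁻¹ ∧ t⁻¹ < s⁻¹ := fun hs hst ↦
    ⟨inv_pos.2 (hs.trans hst), inv_strictAnti₀ hs hst⟩
  have b01 := M.eventually_not_two_bad h₀ h₂ hne hKne p₀ l₀₁
  have b02 := M.eventually_not_two_bad h₀ h₂ hne hKne p₀ (l₀₁.trans l₁₂)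
  have b12 := M.eventually_not_two_bad h₀ h₂ hne hKne (p₀.trans l₀₁) l₁₂
  have d01 := hsw.eventually (M.eventually_not_two_bad h₂ h₀ hne.symm hKne.symm
    (hinv p₀ l₀₁).1 (hinv p₀ l₀₁).2)
  have d02 := hsw.eventually (M.eventually_not_two_bad h₂ h₀ hne.symm hKne.symm
    (hinv p₀ (l₀₁.trans l₁₂)).1 (hinv p₀ (l₀₁.trans l₁₂)).2)
  have d12 := hsw.eventually (M.eventually_not_two_bad h₂ h₀ hne.symm hKne.symm
    (hinv (p₀.trans l₀₁) l₁₂).1 (hinv (p₀.trans l₀₁) l₁₂).2)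
  have hsub : ∀ q ∈ ball p δ, ∀ᶠ i in near c r F c' r' q, closedBall (c i) (r i) ⊆ ball c₀ R := by
    intro q hq
    obtain ⟨ε, hε, hεs⟩ := Metric.isOpen_iff.1 isOpen_ball q
      (L.closedBall_sub (ball_subset_closedBall hq))
    filter_upwards [eventually_closedBall_subset q hε] with i hi
    exact hi.trans hεs
  have s₀ := (tendsto_fst : Tendsto Prod.fst l (near c r F c' r' q₀)).eventually
    ((hsub q₀ hp₀).and (M.eventually_notMem q₀ J))
  have s₂ := (tendsto_snd : Tendsto Prod.snd l (near c r F c' r' q₂)).eventually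
    ((hsub q₂ hp₂).and (M.eventually_notMem q₂ J))
  obtain ⟨⟨i, k⟩, ⟨⟨⟨⟨⟨hb01, hb02, hb12⟩, hd01⟩, hd02, hd12⟩, hs₀⟩, hs₂⟩, he₀, he₁, he₂⟩ :=
    ((((((b01.and (b02.and b12)).and d01).and (d02.and d12)).and s₀).and s₂).and
      (e₀.and (e₁.and e₂))).exists
  simp only at hb01 hb02 hb12 hd01 hd02 hd12 hs₀ hs₂ he₀ he₁ he₂
  have hik := hb01.1
  have f₀ := fun h1 h2 ↦ M.add_two_le hik hs₀.1 hs₂.1 hs₀.2 hs₂.2 p₀ h1 h2 he₀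
  have f₁ := fun h1 h2 ↦ M.add_two_le hik hs₀.1 hs₂.1 hs₀.2 hs₂.2 (p₀.trans l₀₁) h1 h2 he₁
  have f₂ := fun h1 h2 ↦ M.add_two_le hik hs₀.1 hs₂.1 hs₀.2 hs₂.2
    ((p₀.trans l₀₁).trans l₁₂) h1 h2 he₂
  simp only [Prod.fst_swap, Prod.snd_swap] at hd01 hd02 hd12
  rcases pigeonhole_three hb01.2 hb02.2 hb12.2 hd01.2 hd02.2 hd12.2 with h | h | h
  · exact f₀ h.1 h.2
  · exact f₁ h.1 h.2
  · exact f₂ h.1 h.2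

end SchottkyMap

/-- A map between planar sets which multiplies the distances to three points in general position
by a constant is real affine. -/
theorem exists_affine_of_dist (Λ : ℝ) {d₂ d₃ : ℂ} (D₂ D₃ : ℂ)
    (hT : (d₂ * (starRingEnd ℂ) d₃).im ≠ 0) : ∃ α β k : ℂ, ∀ u Y : ℂ, ‖u‖ = Λ * ‖Y‖ →
      ‖u - d₂‖ = Λ * ‖Y - D₂‖ → ‖u - d₃‖ = Λ * ‖Y - D₃‖ →
      u = α * Y + β * (starRingEnd ℂ) Y + k := by
  set T : ℝ := (d₂ * (starRingEnd ℂ) d₃).im with hTdef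
  have hTc : (T : ℂ) * Complex.I ≠ 0 := mul_ne_zero (by exact_mod_cast hT) Complex.I_ne_zero
  set e₂ : ℝ := (‖d₂‖ ^ 2 - Λ ^ 2 * ‖D₂‖ ^ 2) / 2
  set e₃ : ℝ := (‖d₃‖ ^ 2 - Λ ^ 2 * ‖D₃‖ ^ 2) / 2
  refine ⟨Λ ^ 2 * (d₂ * (starRingEnd ℂ) D₃ - d₃ * (starRingEnd ℂ) D₂) / (2 * (T * Complex.I)),
    Λ ^ 2 * (d₂ * D₃ - d₃ * D₂) / (2 * (T * Complex.I)),
    (d₂ * e₃ - d₃ * e₂) / (T * Complex.I), fun u Y h1 h2 h3 ↦ ?_⟩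
  have hexp : ∀ a b : ℂ, ‖a - b‖ ^ 2 = ‖a‖ ^ 2 + ‖b‖ ^ 2 - 2 * (a * (starRingEnd ℂ) b).re := by
    intro a b
    rw [← Complex.normSq_eq_norm_sq, ← Complex.normSq_eq_norm_sq, ← Complex.normSq_eq_norm_sq,
      Complex.normSq_sub]
  have hre : ∀ d D : ℂ, ‖u - d‖ = Λ * ‖Y - D‖ → (u * (starRingEnd ℂ) d).re =
      Λ ^ 2 * (Y * (starRingEnd ℂ) D).re + (‖d‖ ^ 2 - Λ ^ 2 * ‖D‖ ^ 2) / 2 := by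
    intro d D hd
    have h4 : ‖u - d‖ ^ 2 = Λ ^ 2 * ‖Y - D‖ ^ 2 := by rw [hd]; ring
    have h5 : ‖u‖ ^ 2 = Λ ^ 2 * ‖Y‖ ^ 2 := by rw [h1]; ring
    rw [hexp, hexp] at h4
    linear_combination (h5 - h4) / 2
  have r2 := hre _ _ h2
  have r3 := hre _ _ h3
  have cre : ∀ a b : ℂ, ((a * (starRingEnd ℂ) b).re : ℂ) =
      (a * (starRingEnd ℂ) b + (starRingEnd ℂ) a * b) / 2 := by
    intro a b
    rw [Complex.re_eq_add_conj]
    simp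
  have cT : (T : ℂ) * Complex.I = (d₂ * (starRingEnd ℂ) d₃ - (starRingEnd ℂ) d₂ * d₃) / 2 := by
    rw [hTdef, Complex.im_eq_sub_conj]
    simp only [map_mul, Complex.conj_conj]
    field_simp
  have c2 := congrArg (fun x : ℝ ↦ (x : ℂ)) r2
  have c3 := congrArg (fun x : ℝ ↦ (x : ℂ)) r3
  change _ = ((Λ ^ 2 * (Y * (starRingEnd ℂ) D₂).re + e₂ : ℝ) : ℂ) at c2
  change _ = ((Λ ^ 2 * (Y * (starRingEnd ℂ) D₃).re + e₃ : ℝ) : ℂ) at c3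
  simp only [Complex.ofReal_add, Complex.ofReal_mul, Complex.ofReal_pow, cre] at c2 c3
  have h6 : (T : ℂ) * Complex.I * u = (Λ ^ 2 * (d₂ * (starRingEnd ℂ) D₃ -
      d₃ * (starRingEnd ℂ) D₂) * Y + Λ ^ 2 * (d₂ * D₃ - d₃ * D₂) * (starRingEnd ℂ) Y) / 2 +
      (d₂ * e₃ - d₃ * e₂) := by
    rw [cT]
    linear_combination d₂ * c3 - d₃ * c2
  have hT' : (T : ℂ) ≠ 0 := by exact_mod_cast hT
  apply mul_left_cancel₀ hTc
  rw [h6]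
  field_simp

namespace SchottkyMap

variable {I : Type} {Ω S : Set ℂ} {c : I → ℂ} {r : I → ℝ} {F : ℂ → ℂ} {c' : I → ℂ} {r' : I → ℝ}

theorem continuousAt (M : SchottkyMap Ω S c r F c' r') {q : ℂ} (hq : q ∈ S) : ContinuousAt F q :=
  M.cont.continuousAt (M.isOpen.mem_nhds (M.toSchottkyData.subset hq))

/-- The extension cannot be antiholomorphic Möbius (in suitable coordinates) on an open part of
the Schottky set. -/
theorem conj_coeff_eq_zero (M : SchottkyMap Ω S c r F c' r') {q₁ q₂ : ℂ} (h₁ : q₁ ∈ S)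
    (h₂ : q₂ ∈ S) (hne : q₁ ≠ q₂) {U : Set ℂ} (hU : U ∈ 𝓝 q₂) {α β k : ℂ}
    (h : ∀ q ∈ S ∩ U, (q - q₁)⁻¹ =
      α * (F q - F q₁)⁻¹ + β * (starRingEnd ℂ) ((F q - F q₁)⁻¹) + k) : β = 0 := by
  by_contra hβ
  have M' := M.toSchottkyData
  have n₂ := M.neBot_near h₂
  obtain ⟨ε, hε, hεU⟩ := Metric.mem_nhds_iff.1 hU
  have hx : 0 < dist q₁ q₂ := dist_pos.2 hne
  have hy : 0 < dist (F q₂) (F q₁) := dist_pos.2 fun he ↦ hne (M.injOn h₂ h₁ he).symm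
  have tr : Tendsto (fun j ↦ dist (c' j) (F q₁) - r' j) (near c r F c' r' q₂)
      (𝓝 (dist (F q₂) (F q₁) - 0)) :=
    ((tendsto_c' q₂).dist tendsto_const_nhds).sub (tendsto_r' q₂)
  rw [sub_zero] at tr
  obtain ⟨j, hj, hjr⟩ := ((eventually_closedBall_subset (c := c) (r := r) (F := F) (c' := c')
    (r' := r') q₂ (lt_min hε hx)).and (tr.eventually_const_lt hy)).exists
  have hq₁j : q₁ ∉ closedBall (c j) (r j) := fun hq ↦
    ((mem_ball.1 (hj hq)).trans_le (min_le_right _ _)).false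
  have hyj : r' j < ‖c' j - F q₁‖ := by rw [← dist_eq_norm]; linarith
  have hcj : c' j - F q₁ ≠ 0 := norm_pos_iff.1 ((M.pos' j).trans hyj)
  have hS : ∀ z ∈ sphere (c j) (r j), z ∈ S ∩ U := fun z hz ↦ ⟨M'.sphere_subset j hz,
    hεU (ball_subset_ball (min_le_left _ _) (hj (sphere_subset_closedBall hz)))⟩
  have hzx : ∀ z ∈ sphere (c j) (r j), z - q₁ ≠ 0 := fun z hz h0 ↦
    hq₁j (sub_eq_zero.1 h0 ▸ sphere_subset_closedBall hz)
  have hFz : ∀ z ∈ sphere (c j) (r j), F z - F q₁ ≠ 0 := fun z hz h0 ↦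
    hzx z hz (sub_eq_zero.2 (M.injOn (hS z hz).1 h₁ (sub_eq_zero.1 h0)))
  set k' := k + β * (starRingEnd ℂ) ((c' j - F q₁)⁻¹) with hk'
  have hform : ∀ z ∈ sphere (c j) (r j),
      (F z - F q₁) * (z - q₁) * (β * (starRingEnd ℂ)
        ((F z - c' j) * (F z - F q₁)⁻¹ * (-(c' j - F q₁)⁻¹))) =
      (-k') * z * F z + (1 + k' * q₁) * F z + (-α + k' * F q₁) * z +
        (-F q₁ + α * q₁ - k' * F q₁ * q₁) := by
    intro z hz
    have h1 : (F z - c' j) * (F z - F q₁)⁻¹ * (-(c' j - F q₁)⁻¹) =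
        (F z - F q₁)⁻¹ - (c' j - F q₁)⁻¹ := by
      have := hFz z hz
      field_simp
      ring
    have h2 := h z (hS z hz)
    rw [h1, map_sub]
    have h3 : β * ((starRingEnd ℂ) (F z - F q₁)⁻¹ - (starRingEnd ℂ) (c' j - F q₁)⁻¹) =
        (z - q₁)⁻¹ - α * (F z - F q₁)⁻¹ - k' := by
      rw [hk']; linear_combination -h2
    rw [h3]
    have h4 := hzx z hz
    have h5 := hFz z hz
    field_simp
    ring
  have hw0 : Wind (fun z ↦ (F z - c' j) * (F z - F q₁)⁻¹ * (-(c' j - F q₁)⁻¹)) (c j) (r j)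
      (1 + -0 + 0) :=
    ((M.wind j).mul (M.wind_sub_far hyj).inv).mul (Wind.const (neg_ne_zero.2 (inv_ne_zero hcj)))
  have hw1 := ((M.wind_sub_far hyj).mul (Wind.id_sub_of_notMem (M.pos j).le hq₁j)).mul
    ((Wind.const (c := c j) (r := r j) hβ).mul hw0.conj)
  have hw2 := hw1.congr (M.pos j).le hform
  obtain ⟨n, hn, hw3⟩ := M.wind_nonneg (i := j) (A := -k') (B := 1 + k' * q₁)
    (C := -α + k' * F q₁) (D := -F q₁ + α * q₁ - k' * F q₁ * q₁) (fun z hz h0 ↦ by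
      rw [← hform z hz] at h0
      have h5 : F z - c' j ≠ 0 := fun h6 ↦ by
        have := mem_sphere.1 (M.maps_sphere j hz)
        rw [sub_eq_zero.1 h6, dist_self] at this
        exact (M.pos' j).ne this
      have h6 := hzx z hz
      have h7 := hFz z hz
      exact mul_ne_zero (mul_ne_zero h7 h6) (mul_ne_zero hβ ((map_ne_zero _).2 (mul_ne_zero
        (mul_ne_zero h5 (inv_ne_zero h7)) (neg_ne_zero.2 (inv_ne_zero hcj))))) h0)
  have := hw2.unique hw3
  omega

/-- If the distances between two parts of the Schottky set are multiplied by a constant in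
suitable coordinates, the map is Möbius on one of them. -/
theorem exists_moebius (M : SchottkyMap Ω S c r F c' r') {q₀ q₁ q₂ : ℂ} (h₀ : q₀ ∈ S)
    (h₁ : q₁ ∈ S) (h₂ : q₂ ∈ S) (h₀₁ : q₀ ≠ q₁) (h₁₂ : q₁ ≠ q₂) {U₀ U₂ : Set ℂ} (hU₀ : U₀ ∈ 𝓝 q₀)
    (hU₂ : U₂ ∈ 𝓝 q₂) {Λ : ℝ} (h : ∀ q ∈ S ∩ U₀, ∀ q' ∈ S ∩ U₂,
      ‖(q' - q₁)⁻¹ - (q - q₁)⁻¹‖ = Λ * ‖(F q' - F q₁)⁻¹ - (F q - F q₁)⁻¹‖) :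
    ∃ α k : ℂ, (q₀ - q₁)⁻¹ = α * (F q₀ - F q₁)⁻¹ + k ∧
      ∀ q ∈ S ∩ U₂, q ≠ q₁ → (q - q₁)⁻¹ = α * (F q - F q₁)⁻¹ + k := by
  have hq₀ : q₀ ∈ S ∩ U₀ := ⟨h₀, mem_of_mem_nhds hU₀⟩
  have hq₂ : q₂ ∈ S ∩ U₂ := ⟨h₂, mem_of_mem_nhds hU₂⟩
  have hU₀' : U₀ ∩ {q₁}ᶜ ∈ 𝓝 q₀ := inter_mem hU₀ (isOpen_compl_singleton.mem_nhds h₀₁)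
  have hU₂' : U₂ ∩ {q₁}ᶜ ∈ 𝓝 q₂ := inter_mem hU₂ (isOpen_compl_singleton.mem_nhds h₁₂.symm)
  -- generalized circles in the coordinate `1 / (q - q₁)`
  have circ : ∀ {q : ℂ}, q ∈ S → ∀ {U : Set ℂ}, U ∩ {q₁}ᶜ ∈ 𝓝 q → ∀ {e d : ℝ} {b : ℂ},
      (∀ x ∈ S ∩ U, x ≠ q₁ → e * ‖(x - q₁)⁻¹‖ ^ 2 + (b * (x - q₁)⁻¹).re + d = 0) →
      e = 0 ∧ b = 0 ∧ d = 0 := by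
    intro q hq U hU e d b hx
    obtain ⟨r1, r2, r3⟩ := M.not_subset_circle hq hU q₁ (e := d) (b := (starRingEnd ℂ) b) (d := e)
      (fun x hx' ↦ by
        have hne : x - q₁ ≠ 0 := sub_ne_zero.2 hx'.2.2
        have h1 := hx x ⟨hx'.1, hx'.2.1⟩ hx'.2.2
        have h2 : ‖x - q₁‖ ^ 2 ≠ 0 := by positivity
        have h3 : (b * (x - q₁)⁻¹).re * ‖x - q₁‖ ^ 2 = ((starRingEnd ℂ) b * (x - q₁)).re := by
          rw [← Complex.normSq_eq_norm_sq, Complex.inv_def, ← Complex.re_mul_ofReal]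
          have h4 : ((Complex.normSq (x - q₁) : ℝ) : ℂ) ≠ 0 := by
            exact_mod_cast Complex.normSq_eq_zero.not.2 hne
          have h5 : b * ((starRingEnd ℂ) (x - q₁) * ((Complex.normSq (x - q₁))⁻¹ : ℝ)) *
              (Complex.normSq (x - q₁) : ℝ) = (starRingEnd ℂ) ((starRingEnd ℂ) b * (x - q₁)) := by
            rw [map_mul, Complex.conj_conj]
            push_cast
            field_simp
          rw [h5, Complex.conj_re]
        rw [norm_inv, inv_pow] at h1
        have h6 := congrArg (· * ‖x - q₁‖ ^ 2) h1
        simp only [add_mul, zero_mul, h3, mul_assoc, inv_mul_cancel₀ h2] at h6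
        linarith)
    exact ⟨r3, by simpa using r2, r1⟩
  -- three points in general position
  obtain ⟨z₂, ⟨hz₂S, hz₂U, hz₂⟩, hz₂'⟩ : ∃ z ∈ S ∩ (U₀ ∩ {q₁}ᶜ), z ≠ q₀ := by
    have := M.neBot_nhdsWithin h₀
    obtain ⟨z, hz, hzU⟩ := Filter.nonempty_of_mem (inter_mem
      (self_mem_nhdsWithin : S \ {q₀} ∈ 𝓝[S \ {q₀}] q₀) (mem_nhdsWithin_of_mem_nhds hU₀'))
    exact ⟨z, ⟨hz.1, hzU⟩, hz.2⟩
  set d₂ := (z₂ - q₁)⁻¹ - (q₀ - q₁)⁻¹ with hd₂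
  have hd₂0 : d₂ ≠ 0 := fun h0 ↦ hz₂' (by simpa using sub_eq_zero.1 h0)
  obtain ⟨z₃, hz₃, hT⟩ : ∃ z ∈ S ∩ U₀,
      (d₂ * (starRingEnd ℂ) ((z - q₁)⁻¹ - (q₀ - q₁)⁻¹)).im ≠ 0 := by
    by_contra! hcon
    have := circ h₀ hU₀' (e := 0) (b := Complex.I * (starRingEnd ℂ) d₂)
      (d := -(Complex.I * (starRingEnd ℂ) d₂ * (q₀ - q₁)⁻¹).re) (fun x hx _ ↦ by
        have h1 := hcon x hx
        rw [zero_mul, zero_add, ← sub_eq_add_neg, ← Complex.sub_re, ← mul_sub, mul_assoc,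
          Complex.I_mul_re, ← Complex.conj_im, map_mul, Complex.conj_conj]
        exact h1)
    simp [hd₂0] at this
  obtain ⟨α, β, k, haff⟩ := exists_affine_of_dist Λ ((F z₂ - F q₁)⁻¹ - (F q₀ - F q₁)⁻¹)
    ((F z₃ - F q₁)⁻¹ - (F q₀ - F q₁)⁻¹) hT
  have hall : ∀ q ∈ S ∩ U₂, (q - q₁)⁻¹ = α * (F q - F q₁)⁻¹ +
      β * (starRingEnd ℂ) ((F q - F q₁)⁻¹) + (k + (q₀ - q₁)⁻¹ - α * (F q₀ - F q₁)⁻¹ -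
      β * (starRingEnd ℂ) ((F q₀ - F q₁)⁻¹)) := by
    intro q hq
    have := haff ((q - q₁)⁻¹ - (q₀ - q₁)⁻¹) ((F q - F q₁)⁻¹ - (F q₀ - F q₁)⁻¹)
      (h q₀ hq₀ q hq) (by rw [hd₂, sub_sub_sub_cancel_right, sub_sub_sub_cancel_right]
                          exact h z₂ ⟨hz₂S, hz₂U⟩ q hq)
      (by rw [sub_sub_sub_cancel_right, sub_sub_sub_cancel_right]; exact h z₃ hz₃ q hq)
    rw [map_sub] at this
    linear_combination this
  have hβ := M.conj_coeff_eq_zero h₁ h₂ h₁₂ hU₂ hall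
  set k' := k + (q₀ - q₁)⁻¹ - α * (F q₀ - F q₁)⁻¹ - β * (starRingEnd ℂ) ((F q₀ - F q₁)⁻¹)
  have hall' : ∀ q ∈ S ∩ U₂, (q - q₁)⁻¹ = α * (F q - F q₁)⁻¹ + k' := by
    intro q hq
    have := hall q hq
    rw [hβ] at this
    linear_combination this
  refine ⟨α, k', ?_, fun q hq _ ↦ hall' q hq⟩
  have hα : α ≠ 0 := by
    intro hα
    have := M.neBot_nhdsWithin h₂
    obtain ⟨z, hz, hzU⟩ := Filter.nonempty_of_mem (inter_mem
      (self_mem_nhdsWithin : S \ {q₂} ∈ 𝓝[S \ {q₂}] q₂) (mem_nhdsWithin_of_mem_nhds hU₂))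
    have e1 := hall' z ⟨hz.1, hzU⟩
    have e2 := hall' q₂ hq₂
    rw [hα, zero_mul, zero_add] at e1 e2
    rw [← e2, inv_inj] at e1
    exact hz.2 (by simpa using e1)
  -- the point `q₀` lies on the graph of the Möbius transformation
  set ζ₀ := (q₀ - q₁)⁻¹
  set y₀ := (F q₀ - F q₁)⁻¹
  obtain ⟨r1, r2, r3⟩ := circ h₂ hU₂' (e := 1 - Λ ^ 2 / ‖α‖ ^ 2)
    (b := -2 * (starRingEnd ℂ) ζ₀ + 2 * Λ ^ 2 / ‖α‖ ^ 2 * (starRingEnd ℂ) (α * y₀ + k'))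
    (d := ‖ζ₀‖ ^ 2 - Λ ^ 2 / ‖α‖ ^ 2 * ‖α * y₀ + k'‖ ^ 2) (fun x hx _ ↦ by
      have h1 : ‖(x - q₁)⁻¹ - ζ₀‖ = Λ * ‖(F x - F q₁)⁻¹ - y₀‖ := h q₀ hq₀ x hx
      have h2 := hall' x hx
      have hαn : 0 < ‖α‖ := norm_pos_iff.2 hα
      have h3 : ‖(x - q₁)⁻¹ - ζ₀‖ ^ 2 = Λ ^ 2 / ‖α‖ ^ 2 * ‖(x - q₁)⁻¹ - (α * y₀ + k')‖ ^ 2 := by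
        have h4 : (x - q₁)⁻¹ - (α * y₀ + k') = α * ((F x - F q₁)⁻¹ - y₀) := by
          rw [h2]; ring
        rw [h4, norm_mul, h1]
        generalize ‖(F x - F q₁)⁻¹ - y₀‖ = D
        field_simp
      have h5 : ((-2 * (starRingEnd ℂ) ζ₀ + 2 * Λ ^ 2 / ‖α‖ ^ 2 *
          (starRingEnd ℂ) (α * y₀ + k')) * (x - q₁)⁻¹).re = -2 * ((x - q₁)⁻¹ *
          (starRingEnd ℂ) ζ₀).re + 2 * (Λ ^ 2 / ‖α‖ ^ 2) *
          ((x - q₁)⁻¹ * (starRingEnd ℂ) (α * y₀ + k')).re := by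
        have h6 : (-2 * (starRingEnd ℂ) ζ₀ + 2 * Λ ^ 2 / ‖α‖ ^ 2 *
          (starRingEnd ℂ) (α * y₀ + k')) * (x - q₁)⁻¹ = ((-2 : ℝ) : ℂ) * ((x - q₁)⁻¹ *
          (starRingEnd ℂ) ζ₀) + ((2 * (Λ ^ 2 / ‖α‖ ^ 2) : ℝ) : ℂ) *
          ((x - q₁)⁻¹ * (starRingEnd ℂ) (α * y₀ + k')) := by
          push_cast
          ring
        rw [h6, Complex.add_re, Complex.re_ofReal_mul, Complex.re_ofReal_mul]
      have hexp : ∀ a b : ℂ,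
          ‖a - b‖ ^ 2 = ‖a‖ ^ 2 + ‖b‖ ^ 2 - 2 * (a * (starRingEnd ℂ) b).re := by
        intro a b
        rw [← Complex.normSq_eq_norm_sq, ← Complex.normSq_eq_norm_sq,
          ← Complex.normSq_eq_norm_sq, Complex.normSq_sub]
      rw [hexp _ ζ₀, hexp _ (α * y₀ + k')] at h3
      rw [h5]
      linear_combination h3)
  have h8 : Λ ^ 2 / ‖α‖ ^ 2 = 1 := by linarith
  have h9 : (Λ : ℂ) ^ 2 / (‖α‖ : ℂ) ^ 2 = 1 := by exact_mod_cast congrArg (fun x : ℝ ↦ (x : ℂ)) h8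
  have h10 : (starRingEnd ℂ) ζ₀ = (starRingEnd ℂ) (α * y₀ + k') := by
    linear_combination -r2 / 2 + (starRingEnd ℂ) (α * y₀ + k') * h9
  exact (starRingEnd ℂ).injective h10

/-- Small perturbations of a form keep it nonvanishing near the boundary, and its winding
number. -/
theorem eventually_regular (M : SchottkyMap Ω S c r F c' r') {p c₀ : ℂ} {R δ : ℝ}
    (L : SchottkyData.LocalDisc Ω c r p c₀ R δ) {A B C D : ℂ}
    (hreg : ∀ z ∈ closedBall c₀ R \ ball p δ, A * z * F z + B * F z + C * z + D ≠ 0) {N : ℤ}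
    (hN : Wind (fun z ↦ A * z * F z + B * F z + C * z + D) c₀ R N)
    {ι : Type*} {l : Filter ι} {a b c₁ d : ι → ℂ} (ha : Tendsto a l (𝓝 A)) (hb : Tendsto b l (𝓝 B))
    (hc : Tendsto c₁ l (𝓝 C)) (hd : Tendsto d l (𝓝 D)) :
    ∀ᶠ x in l, (∀ z ∈ closedBall c₀ R \ ball p δ,
        a x * z * F z + b x * F z + c₁ x * z + d x ≠ 0) ∧
      Wind (fun z ↦ a x * z * F z + b x * F z + c₁ x * z + d x) c₀ R N := by
  have hK : IsCompact (closedBall c₀ R \ ball p δ) := (isCompact_closedBall c₀ R).diff isOpen_ball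
  have hKΩ : closedBall c₀ R \ ball p δ ⊆ Ω := sdiff_subset.trans L.sub
  have hsphR : sphere c₀ R ⊆ closedBall c₀ R \ ball p δ := fun z hz ↦
    ⟨sphere_subset_closedBall hz, fun hzp ↦
      (mem_ball.1 (L.closedBall_sub (ball_subset_closedBall hzp))).ne (mem_sphere.1 hz)⟩
  filter_upwards [eventually_bilin_sub_lt hK (M.cont.mono hKΩ) hreg ha hb hc hd] with x hx
  refine ⟨fun z hz h0 ↦ ?_, Wind.of_norm_sub_lt L.R_pos.le
    (continuousOn_bilin (M.cont.mono (hsphR.trans hKΩ)) _ _ _ _)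
    (continuousOn_bilin (M.cont.mono (hsphR.trans hKΩ)) _ _ _ _) (fun z hz ↦ hx z (hsphR hz)) hN⟩
  have := hx z hz
  rw [h0, zero_sub, norm_neg] at this
  exact lt_irrefl _ this

theorem eventually_closedBall_subset_ball {p c₀ : ℂ} {R δ : ℝ}
    (L : SchottkyData.LocalDisc Ω c r p c₀ R δ) {q : ℂ} (hq : q ∈ ball p δ) :
    ∀ᶠ i in near c r F c' r' q, closedBall (c i) (r i) ⊆ ball c₀ R := by
  obtain ⟨ε, hε, hεs⟩ := Metric.isOpen_iff.1 isOpen_ball q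
    (L.closedBall_sub (ball_subset_closedBall hq))
  filter_upwards [eventually_closedBall_subset q hε] with i hi
  exact hi.trans hεs

/-- The limit of the ratio of radii at a point determines a distance relation. -/
theorem tendsto_ratio (M : SchottkyMap Ω S c r F c' r') {q₀ q₁ q₂ : ℂ} (h₀ : q₀ ∈ S)
    (h₁ : q₁ ∈ S) (h₂ : q₂ ∈ S) (h₀₁ : q₀ ≠ q₁) (h₁₂ : q₁ ≠ q₂) (h₀₂ : q₀ ≠ q₂)
    (h : ∀ᶠ j in near c r F c' r' q₁, ∃ z ∈ sphere (c j) (r j),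
      ‖(F q₂ - F q₀) * (q₂ - c j)‖ * (r' j * ‖z - q₀‖) =
        ‖(F q₂ - c' j) * (q₂ - q₀)‖ * (‖F z - F q₀‖ * r j)) :
    Tendsto (fun j ↦ r' j / r j) (near c r F c' r' q₁)
      (𝓝 (‖(F q₂ - F q₁) * (q₂ - q₀)‖ * ‖F q₁ - F q₀‖ /
        (‖(F q₂ - F q₀) * (q₂ - q₁)‖ * ‖q₁ - q₀‖))) := by
  have n := M.neBot_near h₁
  have hF₂₀ : F q₂ - F q₀ ≠ 0 := sub_ne_zero.2 fun he ↦ h₀₂ (M.injOn h₂ h₀ he).symm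
  obtain ⟨z, hz⟩ := h.choice
  have tz : Tendsto z (near c r F c' r' q₁) (𝓝 q₁) := by
    refine tendsto_of_tendsto_of_dist (tendsto_c q₁) ?_
    refine (tendsto_r (F := F) (c' := c') (r' := r') q₁).congr' ?_
    filter_upwards [hz] with j hj
    rw [dist_comm]
    exact (mem_sphere.1 hj.1).symm
  have tF : Tendsto (fun j ↦ F (z j)) (near c r F c' r' q₁) (𝓝 (F q₁)) :=
    (M.continuousAt h₁).tendsto.comp tz
  have tl := (((tendsto_const_nhds (x := F q₂)).sub (tendsto_c' (c := c) (r := r) (F := F)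
    (r' := r') q₁)).mul_const (q₂ - q₀)).norm.mul (tF.sub_const (F q₀)).norm
  have tr := (((tendsto_const_nhds (x := q₂)).sub (tendsto_c (c := c) (r := r) (F := F)
    (c' := c') (r' := r') q₁)).const_mul (F q₂ - F q₀)).norm.mul (tz.sub_const q₀).norm
  have hpos : ‖(F q₂ - F q₀) * (q₂ - q₁)‖ * ‖q₁ - q₀‖ ≠ 0 :=
    mul_ne_zero (norm_ne_zero_iff.2 (mul_ne_zero hF₂₀ (sub_ne_zero.2 h₁₂.symm)))
      (norm_ne_zero_iff.2 (sub_ne_zero.2 h₀₁.symm))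
  refine (tl.div tr hpos).congr' ?_
  filter_upwards [hz, tr.eventually_ne hpos] with j hj hj0
  have hrj := (M.pos j).ne'
  rw [Pi.div_apply, div_eq_div_iff hj0 hrj]
  linear_combination -hj.2

/-- Three zeros of a form of winding number at most two force a distance relation. -/
theorem exists_dist_relation (M : SchottkyMap Ω S c r F c' r') {p c₀ : ℂ} {R δ : ℝ}
    (L : SchottkyData.LocalDisc Ω c r p c₀ R δ) {A B C D : ℂ}
    (hreg : ∀ z ∈ closedBall c₀ R \ ball p δ, A * z * F z + B * F z + C * z + D ≠ 0) {N : ℤ}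
    (hN : Wind (fun z ↦ A * z * F z + B * F z + C * z + D) c₀ R N) (hN2 : N ≤ 2) {q₀ q₁ q₂ : ℂ}
    (h₀ : q₀ ∈ S) (h₁ : q₁ ∈ S) (h₂ : q₂ ∈ S) (hp₀ : q₀ ∈ ball p δ) (hp₁ : q₁ ∈ ball p δ)
    (hp₂ : q₂ ∈ ball p δ) (h₀₁ : q₀ ≠ q₁) (h₁₂ : q₁ ≠ q₂) (h₀₂ : q₀ ≠ q₂)
    (hz₀ : A * q₀ * F q₀ + B * F q₀ + C * q₀ + D = 0)
    (hz₁ : A * q₁ * F q₁ + B * F q₁ + C * q₁ + D = 0)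
    (hz₂ : A * q₂ * F q₂ + B * F q₂ + C * q₂ + D = 0) :
    ∃ U₀ ∈ 𝓝 q₀, ∃ U₂ ∈ 𝓝 q₂, ∃ Λ : ℝ, ∀ q ∈ S ∩ U₀, ∀ q' ∈ S ∩ U₂,
      ‖(q' - q₁)⁻¹ - (q - q₁)⁻¹‖ = Λ * ‖(F q' - F q₁)⁻¹ - (F q - F q₁)⁻¹‖ := by
  have n₁ := M.neBot_near h₁
  have hF : ∀ {a b : ℂ}, a ∈ S → b ∈ S → a ≠ b → F a - F b ≠ 0 := fun ha hb hab ↦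
    sub_ne_zero.2 fun he ↦ hab (M.injOn ha hb he)
  obtain ⟨K₁, K₂, hK⟩ := M.exists_node_form h₁ h₀ h₀₁.symm hz₁ hz₀
  have e₂ : F q₂ - F q₀ ≠ 0 := hF h₂ h₀ h₀₂.symm
  have e₁ : q₂ - q₁ ≠ 0 := sub_ne_zero.2 h₁₂.symm
  set κ := K₁ / ((F q₂ - F q₀) * (q₂ - q₁)) with hκ
  have hK₁ : K₁ = κ * ((F q₂ - F q₀) * (q₂ - q₁)) := by rw [hκ]; field_simp
  have hK₂ : K₂ = κ * ((F q₂ - F q₁) * (q₂ - q₀)) := by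
    have h3 := hK q₂ (F q₂)
    rw [hz₂, hK₁] at h3
    apply mul_right_cancel₀ (mul_ne_zero e₂ e₁)
    linear_combination h3
  have hA : A = K₁ - K₂ := by
    linear_combination hK 1 1 - hK 1 0 - hK 0 1 + hK 0 0
  have hB : B = -K₁ * q₀ + K₂ * q₁ := by linear_combination hK 0 1 - hK 0 0
  have hC : C = -K₁ * F q₁ + K₂ * F q₀ := by linear_combination hK 1 0 - hK 0 0
  have hD : D = K₁ * F q₁ * q₀ - K₂ * F q₀ * q₁ := by linear_combination hK 0 0
  have hκ0 : κ ≠ 0 := by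
    intro hκ0
    have hs : c₀ + R ∈ closedBall c₀ R \ ball p δ := by
      refine ⟨by simp [abs_of_pos L.R_pos], fun h ↦ ?_⟩
      have := L.closedBall_sub (ball_subset_closedBall h)
      simp [abs_of_pos L.R_pos] at this
    refine hreg _ hs ?_
    rw [hK, hK₁, hK₂, hκ0]
    ring
  set l := near c r F c' r' q₁ with hl
  set L' := (𝓝 q₀ ×ˢ 𝓝 q₂) ×ˢ l with hL'
  have tx₀ : Tendsto (fun x : (ℂ × ℂ) × I ↦ x.1.1) L' (𝓝 q₀) := tendsto_fst.comp tendsto_fst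
  have tx₂ : Tendsto (fun x : (ℂ × ℂ) × I ↦ x.1.2) L' (𝓝 q₂) := tendsto_snd.comp tendsto_fst
  have ty₀ : Tendsto (fun x : (ℂ × ℂ) × I ↦ F x.1.1) L' (𝓝 (F q₀)) :=
    (M.continuousAt h₀).tendsto.comp tx₀
  have ty₂ : Tendsto (fun x : (ℂ × ℂ) × I ↦ F x.1.2) L' (𝓝 (F q₂)) :=
    (M.continuousAt h₂).tendsto.comp tx₂
  have tx₁ : Tendsto (fun x : (ℂ × ℂ) × I ↦ c x.2) L' (𝓝 q₁) := (tendsto_c q₁).comp tendsto_snd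
  have ty₁ : Tendsto (fun x : (ℂ × ℂ) × I ↦ c' x.2) L' (𝓝 (F q₁)) :=
    (tendsto_c' q₁).comp tendsto_snd
  have tK₁ : Tendsto (fun x : (ℂ × ℂ) × I ↦ κ * ((F x.1.2 - F x.1.1) * (x.1.2 - c x.2))) L'
      (𝓝 K₁) := by
    rw [hK₁]; exact ((ty₂.sub ty₀).mul (tx₂.sub tx₁)).const_mul κ
  have tK₂ : Tendsto (fun x : (ℂ × ℂ) × I ↦ κ * ((F x.1.2 - c' x.2) * (x.1.2 - x.1.1))) L'
      (𝓝 K₂) := by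
    rw [hK₂]; exact ((ty₂.sub ty₁).mul (tx₂.sub tx₀)).const_mul κ
  have key := M.eventually_regular L hreg hN (l := L')
    (a := fun x ↦ κ * ((F x.1.2 - F x.1.1) * (x.1.2 - c x.2)) -
      κ * ((F x.1.2 - c' x.2) * (x.1.2 - x.1.1)))
    (b := fun x ↦ -(κ * ((F x.1.2 - F x.1.1) * (x.1.2 - c x.2))) * x.1.1 +
      κ * ((F x.1.2 - c' x.2) * (x.1.2 - x.1.1)) * c x.2)
    (c₁ := fun x ↦ -(κ * ((F x.1.2 - F x.1.1) * (x.1.2 - c x.2))) * c' x.2 +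
      κ * ((F x.1.2 - c' x.2) * (x.1.2 - x.1.1)) * F x.1.1)
    (d := fun x ↦ κ * ((F x.1.2 - F x.1.1) * (x.1.2 - c x.2)) * c' x.2 * x.1.1 -
      κ * ((F x.1.2 - c' x.2) * (x.1.2 - x.1.1)) * F x.1.1 * c x.2)
    (by rw [hA]; exact tK₁.sub tK₂)
    (by rw [hB]; exact (tK₁.neg.mul tx₀).add (tK₂.mul tx₁))
    (by rw [hC]; exact (tK₁.neg.mul ty₁).add (tK₂.mul ty₀))
    (by rw [hD]; exact ((tK₁.mul ty₁).mul tx₀).sub ((tK₂.mul ty₀).mul tx₁))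
  have hgood : ∀ᶠ x : ℂ × ℂ in 𝓝 q₀ ×ˢ 𝓝 q₂, x.1 ∈ ball p δ ∧ x.2 ∈ ball p δ ∧ x.1 ≠ q₁ ∧
      q₁ ≠ x.2 ∧ x.1 ≠ x.2 := by
    have t₀ : Tendsto (fun x : ℂ × ℂ ↦ x.1) (𝓝 q₀ ×ˢ 𝓝 q₂) (𝓝 q₀) := tendsto_fst
    have t₂ : Tendsto (fun x : ℂ × ℂ ↦ x.2) (𝓝 q₀ ×ˢ 𝓝 q₂) (𝓝 q₂) := tendsto_snd
    filter_upwards [t₀.eventually_mem (isOpen_ball.mem_nhds hp₀),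
      t₂.eventually_mem (isOpen_ball.mem_nhds hp₂), t₀.eventually_ne h₀₁,
      t₂.eventually_ne h₁₂.symm, (t₀.sub t₂).eventually_ne (sub_ne_zero.2 h₀₂)]
        with x a1 a2 a3 a4 a5
    exact ⟨a1, a2, a3, a4.symm, sub_ne_zero.1 a5⟩
  obtain ⟨U₀, hU₀, U₂, hU₂, hU⟩ := Filter.eventually_prod_iff.1 (key.curry.and hgood)
  have main : ∀ q ∈ S, U₀ q → ∀ q' ∈ S, U₂ q' → Tendsto (fun j ↦ r' j / r j) l
      (𝓝 (‖(F q' - F q₁) * (q' - q)‖ * ‖F q₁ - F q‖ /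
        (‖(F q' - F q) * (q' - q₁)‖ * ‖q₁ - q‖))) := by
    intro q hqS hq q' hqS' hq'
    obtain ⟨hev, hqp, hqp', n1, n2, n3⟩ := hU hq hq'
    refine M.tendsto_ratio hqS h₁ hqS' n1 n2 n3 ?_
    have hd : 0 < dist (F q₁) (F q) := dist_pos.2 fun he ↦ n1 (M.injOn h₁ hqS he).symm
    have hd' : 0 < dist q₁ q := dist_pos.2 n1.symm
    have tr : Tendsto (fun j ↦ dist (c' j) (F q) - r' j) l (𝓝 (dist (F q₁) (F q) - 0)) :=
      ((tendsto_c' q₁).dist tendsto_const_nhds).sub (tendsto_r' q₁)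
    rw [sub_zero] at tr
    filter_upwards [hev, eventually_closedBall_subset_ball L hp₁, tr.eventually_const_lt hd,
      eventually_closedBall_subset q₁ hd'] with j hj hjR hjd hjd'
    by_contra! hcon
    have hqj : q ∉ closedBall (c j) (r j) := fun hm ↦ by
      have := mem_ball'.1 (hjd' hm)
      exact this.false
    have w1 := (M.wind j).mul (Wind.id_sub_of_notMem (M.pos j).le hqj)
    have w2 := (M.wind_sub_far (i := j) (y := F q) (by rw [← dist_eq_norm]; linarith)).mul
      (Wind.id_sub_center (c := c j) (M.pos j))
    rw [add_zero] at w1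
    rw [zero_add] at w2
    have hcs := M.continuousOn_sphere j
    obtain ⟨v1, v2⟩ := Wind.sub_of_norm_ne (a := fun z ↦ (F z - c' j) * (z - q))
      (b := fun z ↦ (F z - F q) * (z - c j)) (M.pos j).le
      ((hcs.sub continuousOn_const).mul (continuousOn_id.sub continuousOn_const))
      ((hcs.sub continuousOn_const).mul (continuousOn_id.sub continuousOn_const))
      (κ * ((F q' - F q) * (q' - c j))) (κ * ((F q' - c' j) * (q' - q))) w1 w2 (fun z hz he ↦ by
        refine hcon z hz ?_
        rw [norm_mul _ ((F z - c' j) * (z - q)), norm_mul _ ((F z - F q) * (z - c j)), norm_mul κ,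
          norm_mul κ, norm_mul (F z - c' j), norm_mul (F z - F q), mul_assoc, mul_assoc] at he
        have he' := mul_left_cancel₀ (norm_ne_zero_iff.2 hκ0) he
        rw [← dist_eq_norm (F z) (c' j), ← dist_eq_norm z (c j),
          mem_sphere.1 (M.maps_sphere j hz), mem_sphere.1 hz] at he'
        exact he')
    have := M.two_add_card_le L hj.1 hj.2 hqS hqS' hqp hqp' n3 (by ring) (by ring) {j} (by
      intro i hi
      rw [Finset.mem_singleton] at hi
      subst hi
      refine ⟨hjR, fun z hz ↦ ?_, v2.congr (M.pos i).le fun z _ ↦ by ring⟩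
      convert v1 z hz using 1
      ring)
    simp only [Finset.card_singleton, Nat.cast_one] at this
    omega
  have hq₀ := hU₀.self_of_nhds
  have hq₂ := hU₂.self_of_nhds
  refine ⟨_, hU₀, _, hU₂, ‖(F q₂ - F q₁) * (q₂ - q₀)‖ * ‖F q₁ - F q₀‖ /
        (‖(F q₂ - F q₀) * (q₂ - q₁)‖ * ‖q₁ - q₀‖), ?_⟩
  rintro q ⟨hqS, hq⟩ q' ⟨hqS', hq'⟩
  obtain ⟨-, -, -, n1, n2, n3⟩ := hU hq hq'
  rw [tendsto_nhds_unique (main q₀ h₀ hq₀ q₂ h₂ hq₂) (main q hqS hq q' hqS' hq')]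
  have m1 : q - q₁ ≠ 0 := sub_ne_zero.2 n1
  have m2 : q' - q₁ ≠ 0 := sub_ne_zero.2 n2.symm
  have m3 : q' - q ≠ 0 := sub_ne_zero.2 n3.symm
  have k1 := hF hqS h₁ n1
  have k2 := hF hqS' h₁ n2.symm
  have k3 := hF hqS' hqS n3.symm
  have hi : ∀ {a b e : ℂ}, a - e ≠ 0 → b - e ≠ 0 →
      ‖(a - e)⁻¹ - (b - e)⁻¹‖ = ‖a - b‖ / (‖a - e‖ * ‖b - e‖) := by
    intro a b e ha hb
    rw [← norm_mul, ← norm_div, ← norm_neg]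
    congr 1
    field_simp
    ring
  rw [hi m2 m1, hi k2 k1, norm_mul, norm_mul, norm_sub_rev q₁, norm_sub_rev (F q₁)]
  have := norm_pos_iff.2 m1
  have := norm_pos_iff.2 m2
  have := norm_pos_iff.2 m3
  have := norm_pos_iff.2 k1
  have := norm_pos_iff.2 k2
  have := norm_pos_iff.2 k3
  field_simp

theorem eventually_zero_of_three_zeros (M : SchottkyMap Ω S c r F c' r') {p c₀ : ℂ} {R δ : ℝ}
    (L : SchottkyData.LocalDisc Ω c r p c₀ R δ) {A B C D : ℂ}
    (hreg : ∀ z ∈ closedBall c₀ R \ ball p δ, A * z * F z + B * F z + C * z + D ≠ 0) {N : ℤ}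
    (hN : Wind (fun z ↦ A * z * F z + B * F z + C * z + D) c₀ R N) (hN2 : N ≤ 2) {q₀ q₁ q₂ : ℂ}
    (h₀ : q₀ ∈ S) (h₁ : q₁ ∈ S) (h₂ : q₂ ∈ S) (hp₀ : q₀ ∈ ball p δ) (hp₁ : q₁ ∈ ball p δ)
    (hp₂ : q₂ ∈ ball p δ) (h₀₁ : q₀ ≠ q₁) (h₁₂ : q₁ ≠ q₂) (h₀₂ : q₀ ≠ q₂)
    (hz₀ : A * q₀ * F q₀ + B * F q₀ + C * q₀ + D = 0)
    (hz₁ : A * q₁ * F q₁ + B * F q₁ + C * q₁ + D = 0)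
    (hz₂ : A * q₂ * F q₂ + B * F q₂ + C * q₂ + D = 0) :
    ∃ U ∈ 𝓝 q₂, ∀ q ∈ S ∩ U, A * q * F q + B * F q + C * q + D = 0 := by
  obtain ⟨U₀, hU₀, U₂, hU₂, Λ, hΛ⟩ := M.exists_dist_relation L hreg hN hN2 h₀ h₁ h₂ hp₀ hp₁ hp₂
    h₀₁ h₁₂ h₀₂ hz₀ hz₁ hz₂
  obtain ⟨α, k, e₀, hU⟩ := M.exists_moebius h₀ h₁ h₂ h₀₁ h₁₂ hU₀ hU₂ hΛ
  have e₂ := hU q₂ ⟨h₂, mem_of_mem_nhds hU₂⟩ h₁₂.symm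
  -- the form in the inverted coordinates
  have hform : ∀ z ∈ S, z ≠ q₁ → A * z * F z + B * F z + C * z + D =
      (z - q₁) * (F z - F q₁) * (A + (A * q₁ + B) * (z - q₁)⁻¹ +
        (A * F q₁ + C) * (F z - F q₁)⁻¹) := by
    intro z hz hzq
    have m1 : z - q₁ ≠ 0 := sub_ne_zero.2 hzq
    have m2 : F z - F q₁ ≠ 0 := sub_ne_zero.2 fun he ↦ hzq (M.injOn hz h₁ he)
    field_simp
    linear_combination hz₁
  have hvan : ∀ z ∈ S, z ≠ q₁ → A * z * F z + B * F z + C * z + D = 0 →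
      A + (A * q₁ + B) * (z - q₁)⁻¹ + (A * F q₁ + C) * (F z - F q₁)⁻¹ = 0 := by
    intro z hz hzq h0
    rw [hform z hz hzq] at h0
    exact (mul_eq_zero.1 h0).resolve_left (mul_ne_zero (sub_ne_zero.2 hzq)
      (sub_ne_zero.2 fun he ↦ hzq (M.injOn hz h₁ he)))
  have v₀ := hvan q₀ h₀ h₀₁ hz₀
  have v₂ := hvan q₂ h₂ h₁₂.symm hz₂
  rw [e₀] at v₀
  rw [e₂] at v₂
  have hy : (F q₀ - F q₁)⁻¹ - (F q₂ - F q₁)⁻¹ ≠ 0 := by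
    rw [sub_ne_zero]
    intro he
    exact h₀₂ (M.injOn h₀ h₂ (by simpa using he))
  have w1 : (A * q₁ + B) * α + (A * F q₁ + C) = 0 := by
    refine (mul_eq_zero.1 ?_).resolve_right hy
    linear_combination v₀ - v₂
  have w2 : A + (A * q₁ + B) * k = 0 := by
    linear_combination v₀ - (F q₀ - F q₁)⁻¹ * w1
  refine ⟨U₂, hU₂, fun q hq ↦ ?_⟩
  by_cases hqq : q = q₁
  · rw [hqq]; exact hz₁
  rw [hform q hq.1 hqq, hU q hq hqq]
  linear_combination (q - q₁) * (F q - F q₁) * w2 +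
    (q - q₁) * (F q - F q₁) * (F q - F q₁)⁻¹ * w1

/-- A form of winding number at most two has at most two zeros in the Schottky set. -/
theorem no_three_zeros (M : SchottkyMap Ω S c r F c' r') {p c₀ : ℂ} {R δ : ℝ}
    (L : SchottkyData.LocalDisc Ω c r p c₀ R δ) {A B C D : ℂ}
    (hreg : ∀ z ∈ closedBall c₀ R \ ball p δ, A * z * F z + B * F z + C * z + D ≠ 0) {N : ℤ}
    (hN : Wind (fun z ↦ A * z * F z + B * F z + C * z + D) c₀ R N) (hN2 : N ≤ 2) {q₀ q₁ q₂ : ℂ}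
    (h₀ : q₀ ∈ S) (h₁ : q₁ ∈ S) (h₂ : q₂ ∈ S) (hp₀ : q₀ ∈ ball p δ) (hp₁ : q₁ ∈ ball p δ)
    (hp₂ : q₂ ∈ ball p δ) (h₀₁ : q₀ ≠ q₁) (h₁₂ : q₁ ≠ q₂) (h₀₂ : q₀ ≠ q₂)
    (hz₀ : A * q₀ * F q₀ + B * F q₀ + C * q₀ + D = 0)
    (hz₁ : A * q₁ * F q₁ + B * F q₁ + C * q₁ + D = 0)
    (hz₂ : A * q₂ * F q₂ + B * F q₂ + C * q₂ + D = 0) : False := by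
  have hloc : ∀ q ∈ S, q ∈ ball p δ → A * q * F q + B * F q + C * q + D = 0 →
      ∃ U ∈ 𝓝 q, ∀ x ∈ S ∩ U, A * x * F x + B * F x + C * x + D = 0 := by
    intro q hq hqp hqz
    have key : ∀ {a b : ℂ}, a ∈ S → b ∈ S → a ∈ ball p δ → b ∈ ball p δ → a ≠ b → b ≠ q → a ≠ q →
        A * a * F a + B * F a + C * a + D = 0 → A * b * F b + B * F b + C * b + D = 0 →
        ∃ U ∈ 𝓝 q, ∀ x ∈ S ∩ U, A * x * F x + B * F x + C * x + D = 0 :=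
      fun ha hb ha' hb' h1 h2 h3 h4 h5 ↦ M.eventually_zero_of_three_zeros L hreg hN hN2 ha hb hq
        ha' hb' hqp h1 h2 h3 h4 h5 hqz
    by_cases e₀ : q = q₀
    · exact key h₁ h₂ hp₁ hp₂ h₁₂ (e₀ ▸ h₀₂.symm) (e₀ ▸ h₀₁.symm) hz₁ hz₂
    by_cases e₁ : q = q₁
    · exact key h₀ h₂ hp₀ hp₂ h₀₂ (e₁ ▸ h₁₂.symm) (e₁ ▸ h₀₁) hz₀ hz₂
    · exact key h₀ h₁ hp₀ hp₁ h₀₁ (Ne.symm e₁) (Ne.symm e₀) hz₀ hz₁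
  have := isPreconnected_iff_preconnectedSpace.1 M.conn
  set Z : Set S := {z | (z : ℂ) ∈ closedBall c₀ R ∧
    A * (z : ℂ) * F z + B * F z + C * z + D = 0} with hZ
  have hball : ∀ z ∈ Z, (z : ℂ) ∈ ball p δ := fun z hz ↦ by
    by_contra hcon
    exact hreg z ⟨hz.1, hcon⟩ hz.2
  have hsub : ball p δ ⊆ closedBall c₀ R :=
    ball_subset_closedBall.trans (L.closedBall_sub.trans ball_subset_closedBall)
  have hGc : Continuous fun z : S ↦ A * (z : ℂ) * F z + B * F z + C * z + D :=
    continuousOn_iff_continuous_domRestrict.1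
      (continuousOn_bilin (M.cont.mono M.toSchottkyData.subset) A B C D)
  have hclosed : IsClosed Z :=
    (isClosed_closedBall.preimage continuous_subtype_val).inter (isClosed_singleton.preimage hGc)
  have hopen : IsOpen Z := by
    rw [isOpen_iff_mem_nhds]
    intro z hz
    obtain ⟨U, hU, hUz⟩ := hloc z z.2 (hball z hz) hz.2
    filter_upwards [continuous_subtype_val.continuousAt.preimage_mem_nhds hU,
      continuous_subtype_val.continuousAt.preimage_mem_nhds
        (isOpen_ball.mem_nhds (hball z hz))] with x hx hx'
    exact ⟨hsub hx', hUz x ⟨x.2, hx⟩⟩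
  have huniv := IsClopen.eq_univ ⟨hclosed, hopen⟩ ⟨⟨q₀, h₀⟩, hsub hp₀, hz₀⟩
  refine M.noncompact _ (isCompact_closedBall c₀ R) L.sub fun z hz ↦ ?_
  have : (⟨z, hz⟩ : S) ∈ Z := huniv ▸ mem_univ _
  exact this.1

theorem sphere_subset_diff {p c₀ : ℂ} {R δ : ℝ} (L : SchottkyData.LocalDisc Ω c r p c₀ R δ) :
    sphere c₀ R ⊆ closedBall c₀ R \ ball p δ := fun _ hz ↦
  ⟨sphere_subset_closedBall hz, fun hzp ↦
    (mem_ball.1 (L.closedBall_sub (ball_subset_closedBall hzp))).ne (mem_sphere.1 hz)⟩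

/-- The extension takes values near `F p` exactly once, counted along the boundary of a disc. -/
theorem wind_map_sub (M : SchottkyMap Ω S c r F c' r') {p c₀ : ℂ} {R δ : ℝ} (hp : p ∈ S)
    (L : SchottkyData.LocalDisc Ω c r p c₀ R δ) {m : ℝ}
    (hm : ∀ z ∈ closedBall c₀ R \ ball p δ, m ≤ ‖F z - F p‖) {y : ℂ} (hy : ‖F p - y‖ < m) :
    Wind (fun z ↦ F z - y) c₀ R 1 := by
  have n := M.neBot_near hp
  have hm0 : 0 < m := (norm_nonneg _).trans_lt hy
  have hsR := sphere_subset_diff L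
  have hFc : ContinuousOn F (sphere c₀ R) := M.cont.mono ((hsR.trans sdiff_subset).trans L.sub)
  have tc : Tendsto (fun j ↦ ‖c' j - F p‖) (near c r F c' r' p) (𝓝 0) := by
    simpa using ((tendsto_c' (c := c) (r := r) (F := F) (r' := r') p).sub_const (F p)).norm
  obtain ⟨j, hj, hjR⟩ := ((tc.eventually_lt_const (half_pos hm0)).and
    (eventually_closedBall_subset_ball L (mem_ball_self L.δ_pos))).exists
  have w := wind_sum {j} c r (fun _ ↦ 1) (g := fun z ↦ F z - c' j) L.R_pos (fun k _ ↦ M.pos k)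
    (by simpa using hjR)
    (by intro k hk l hl hkl; simp only [Finset.mem_singleton] at hk hl
        exact absurd (hk.trans hl.symm) hkl)
    ((M.cont.mono (sdiff_subset.trans L.sub)).sub continuousOn_const)
    (by
      rintro z ⟨hz, hzj⟩ h0
      simp only [Finset.mem_singleton, iUnion_iUnion_eq_left] at hzj
      have hz' : F z ∈ ball (c' j) (r' j) := by
        rw [sub_eq_zero.1 h0]; exact mem_ball_self (M.pos' j)
      by_cases hzS : z ∈ S
      · exact M.notMem_ball z hzS j hz'
      · obtain ⟨i, hi⟩ := M.toSchottkyData.exists_mem_ball (L.sub hz) hzS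
        have hij : i ≠ j := fun e ↦ hzj (e ▸ hi)
        exact (M.disj' hij).le_bot ⟨ball_subset_closedBall (M.maps_ball i hi),
          ball_subset_closedBall hz'⟩)
    (by intro k hk; rw [Finset.mem_singleton] at hk; subst hk; exact M.wind k)
  rw [Finset.sum_singleton] at w
  have w' : Wind (fun z ↦ F z - F p) c₀ R 1 := by
    refine Wind.of_norm_sub_lt (h := fun z ↦ F z - c' j) L.R_pos.le
      (hFc.sub continuousOn_const) (hFc.sub continuousOn_const) (fun z hz ↦ ?_) w
    have h1 := hm z (hsR hz)
    have h2 : ‖F z - F p‖ ≤ ‖F z - c' j‖ + ‖c' j - F p‖ := norm_sub_le_norm_sub_add_norm_sub _ _ _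
    rw [sub_sub_sub_cancel_left]
    linarith
  refine Wind.of_norm_sub_lt (h := fun z ↦ F z - F p) L.R_pos.le
    (hFc.sub continuousOn_const) (hFc.sub continuousOn_const) (fun z hz ↦ ?_) w'
  rw [sub_sub_sub_cancel_left]
  exact hy.trans_le (hm z (hsR hz))

theorem exists_bounds (M : SchottkyMap Ω S c r F c' r') {p c₀ : ℂ} {R δ : ℝ} (hp : p ∈ S)
    (L : SchottkyData.LocalDisc Ω c r p c₀ R δ) :
    ∃ ε > 0, ∃ μ > 0, ∃ T > 0, ball p ε ⊆ ball p δ ∧ ∀ x ∈ ball p ε,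
      (∀ z ∈ closedBall c₀ R \ ball p δ,
        (μ ≤ ‖z - x‖ ∧ ‖z - x‖ ≤ T) ∧ μ ≤ ‖F z - F x‖ ∧ ‖F z - F x‖ ≤ T) ∧
      Wind (fun z ↦ F z - F x) c₀ R 1 := by
  have hK : IsCompact (closedBall c₀ R \ ball p δ) := (isCompact_closedBall c₀ R).diff isOpen_ball
  have hKΩ : closedBall c₀ R \ ball p δ ⊆ Ω := sdiff_subset.trans L.sub
  have hFK := M.cont.mono hKΩ
  obtain ⟨m, hm, hmK⟩ := hK.exists_forall_le' (hFK.sub (continuousOn_const (c := F p))).norm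
    (a := 0) (fun z hz ↦ norm_pos_iff.2 (sub_ne_zero.2 fun he ↦ by
      have := M.eq_of_map_eq hp (hKΩ hz) he
      exact hz.2 (this ▸ mem_ball_self L.δ_pos)))
  obtain ⟨T₁, hT₁⟩ := hK.exists_bound_of_continuousOn
    (hFK.sub (continuousOn_const (c := F p)))
  obtain ⟨T₂, hT₂⟩ := hK.exists_bound_of_continuousOn
    ((continuousOn_id (s := closedBall c₀ R \ ball p δ)).sub (continuousOn_const (c := p)))
  obtain ⟨ε₁, hε₁, hε⟩ := Metric.continuousAt_iff.1 (M.continuousAt hp) (m / 2) (half_pos hm)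
  have hδ := L.δ_pos
  refine ⟨min ε₁ (δ / 2), by positivity, min m δ / 2, by positivity,
    max 1 (max (T₁ + m / 2) (T₂ + δ / 2)), by positivity,
    ball_subset_ball ((min_le_right _ _).trans (by linarith)), fun x hx ↦ ?_⟩
  have hx1 : ‖F x - F p‖ < m / 2 := by
    rw [← dist_eq_norm]; exact hε ((mem_ball.1 hx).trans_le (min_le_left _ _))
  have hx2 : ‖x - p‖ < δ / 2 := by
    rw [← dist_eq_norm]; exact (mem_ball.1 hx).trans_le (min_le_right _ _)
  have hmin1 := min_le_left m δ
  have hmin2 := min_le_right m δ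
  have hM := le_max_right 1 (max (T₁ + m / 2) (T₂ + δ / 2))
  have hM1 := (le_max_left (T₁ + m / 2) (T₂ + δ / 2)).trans hM
  have hM2 := (le_max_right (T₁ + m / 2) (T₂ + δ / 2)).trans hM
  refine ⟨fun z hz ↦ ?_, M.wind_map_sub hp L hmK (by rw [norm_sub_rev]; linarith)⟩
  have a1 := hmK z hz
  have a2 := hT₁ z hz
  have a3 := hT₂ z hz
  simp only [Pi.sub_apply, id] at a1 a2 a3
  have a4 : δ ≤ ‖z - p‖ := by
    rw [← dist_eq_norm]; exact not_lt.1 fun h ↦ hz.2 (mem_ball.2 h)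
  have b1 := norm_sub_le_norm_sub_add_norm_sub z x p
  have b2 := norm_sub_le_norm_sub_add_norm_sub z p x
  have b3 := norm_sub_le_norm_sub_add_norm_sub (F z) (F x) (F p)
  have b4 := norm_sub_le_norm_sub_add_norm_sub (F z) (F p) (F x)
  rw [norm_sub_rev p x] at b2
  rw [norm_sub_rev (F p) (F x)] at b4
  refine ⟨⟨?_, ?_⟩, ?_, ?_⟩ <;> linarith

/-- Difference quotients are bounded above and below, and satisfy a Lipschitz condition. -/
theorem exists_slope_bounds (M : SchottkyMap Ω S c r F c' r') {p : ℂ} (hp : p ∈ S) :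
    ∃ ε > 0, ∃ m > 0, ∃ B C : ℝ,
      (∀ q₀ ∈ S ∩ ball p ε, ∀ q₂ ∈ S ∩ ball p ε, q₀ ≠ q₂ →
        m ≤ ‖(F q₂ - F q₀) / (q₂ - q₀)‖ ∧ ‖(F q₂ - F q₀) / (q₂ - q₀)‖ ≤ B) ∧
      ∀ q₀ ∈ S ∩ ball p ε, ∀ q₁ ∈ S ∩ ball p ε, ∀ q₂ ∈ S ∩ ball p ε, q₀ ≠ q₁ → q₂ ≠ q₁ →
        ‖(F q₂ - F q₁) / (q₂ - q₁) - (F q₀ - F q₁) / (q₀ - q₁)‖ ≤ C * ‖q₀ - q₂‖ := by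
  obtain ⟨c₀, R, δ, L⟩ := M.toSchottkyData.exists_localDisc hp
  obtain ⟨ε, hε, μ, hμ, T, hT, hεδ, hb⟩ := M.exists_bounds hp L
  have hsR := sphere_subset_diff L
  have hKΩ : closedBall c₀ R \ ball p δ ⊆ Ω := sdiff_subset.trans L.sub
  have hεR : ball p ε ⊆ ball c₀ R := hεδ.trans (ball_subset_closedBall.trans L.closedBall_sub)
  -- a form close to one with known winding number
  have hdom : ∀ {A B C D : ℂ} {h : ℂ → ℂ} {N : ℤ}, ContinuousOn h (sphere c₀ R) → Wind h c₀ R N →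
      (∀ z ∈ closedBall c₀ R \ ball p δ, ‖A * z * F z + B * F z + C * z + D - h z‖ < ‖h z‖) →
      (∀ z ∈ closedBall c₀ R \ ball p δ, A * z * F z + B * F z + C * z + D ≠ 0) ∧
      Wind (fun z ↦ A * z * F z + B * F z + C * z + D) c₀ R N := by
    intro A B C D h N hc hw hlt
    refine ⟨fun z hz h0 ↦ ?_, Wind.of_norm_sub_lt L.R_pos.le
      (continuousOn_bilin (M.cont.mono (hsR.trans hKΩ)) _ _ _ _) hc (fun z hz ↦ hlt z (hsR hz)) hw⟩
    have := hlt z hz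
    rw [h0, zero_sub, norm_neg] at this
    exact this.false
  have hFc : ContinuousOn F (sphere c₀ R) := M.cont.mono (hsR.trans hKΩ)
  have hslope : ∀ q₀ ∈ S ∩ ball p ε, ∀ q₂ ∈ S ∩ ball p ε, q₀ ≠ q₂ →
        μ / T ≤ ‖(F q₂ - F q₀) / (q₂ - q₀)‖ ∧ ‖(F q₂ - F q₀) / (q₂ - q₀)‖ ≤ T / μ := by
    rintro q₀ ⟨h₀, hp₀⟩ q₂ ⟨h₂, hp₂⟩ hne
    set a := (F q₂ - F q₀) / (q₂ - q₀) with ha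
    have ha' : F q₂ - F q₀ = a * (q₂ - q₀) := by
      rw [ha, div_mul_cancel₀ _ (sub_ne_zero.2 hne.symm)]
    obtain ⟨hz, hw⟩ := hb q₀ hp₀
    have main : ∀ {h : ℂ → ℂ}, ContinuousOn h (sphere c₀ R) → Wind h c₀ R 1 →
        (∀ z ∈ closedBall c₀ R \ ball p δ,
          ‖0 * z * F z + 1 * F z + (-a) * z + (-F q₀ + a * q₀) - h z‖ < ‖h z‖) → False := by
      intro h hc hw hlt
      obtain ⟨h1, h2⟩ := hdom hc hw hlt
      have := M.two_add_card_le L h1 h2 h₀ h₂ (hεδ hp₀) (hεδ hp₂) hne (by ring)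
        (by linear_combination ha') ∅ (by simp)
      simp at this
    constructor
    · by_contra! hcon
      rw [lt_div_iff₀ hT] at hcon
      refine main (h := fun z ↦ F z - F q₀) (hFc.sub continuousOn_const) hw fun z hzK ↦ ?_
      obtain ⟨⟨h1, h2⟩, h3, h4⟩ := hz z hzK
      have : 0 * z * F z + 1 * F z + -a * z + (-F q₀ + a * q₀) - (F z - F q₀) =
        -(a * (z - q₀)) := by ring
      rw [this, norm_neg, norm_mul]
      exact ((mul_le_mul_of_nonneg_left h2 (norm_nonneg _)).trans_lt hcon).trans_le h3
    · by_contra! hcon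
      rw [div_lt_iff₀ hμ] at hcon
      have ha0 : a ≠ 0 := by
        rintro h0
        rw [h0, norm_zero, zero_mul] at hcon
        exact hcon.not_ge hT.le
      have hw' := (Wind.const (neg_ne_zero.2 ha0)).mul (Wind.id_sub_of_mem (hεR hp₀))
      rw [zero_add] at hw'
      refine main (h := fun z ↦ -a * (z - q₀))
        (continuousOn_const.mul (continuousOn_id.sub continuousOn_const))
        hw' fun z hzK ↦ ?_
      obtain ⟨⟨h1, h2⟩, h3, h4⟩ := hz z hzK
      have : 0 * z * F z + 1 * F z + -a * z + (-F q₀ + a * q₀) - (-a * (z - q₀)) =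
        F z - F q₀ := by ring
      rw [this, norm_mul, norm_neg]
      exact h4.trans_lt (hcon.trans_le (mul_le_mul_of_nonneg_left h1 (norm_nonneg _)))
  set B := T / μ with hB
  have hB0 : 0 < B := div_pos hT hμ
  refine ⟨ε, hε, μ / T, div_pos hμ hT, B, (B * T + B * B * T) / (μ * μ), hslope, ?_⟩
  intro q₀ hq₀ q₁ hq₁ q₂ hq₂ h₀₁ h₂₁
  by_cases h₀₂ : q₀ = q₂
  · rw [h₀₂]; simp
  by_contra! hcon
  have hs2 := (hslope q₁ hq₁ q₂ hq₂ h₂₁.symm).2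
  have hs0 := (hslope q₁ hq₁ q₀ hq₀ h₀₁.symm).2
  have hs02 := (hslope q₂ hq₂ q₀ hq₀ (Ne.symm h₀₂)).2
  have e2 : F q₂ - F q₁ = (F q₂ - F q₁) / (q₂ - q₁) * (q₂ - q₁) :=
    (div_mul_cancel₀ _ (sub_ne_zero.2 h₂₁)).symm
  have e0 : F q₀ - F q₁ = (F q₀ - F q₁) / (q₀ - q₁) * (q₀ - q₁) :=
    (div_mul_cancel₀ _ (sub_ne_zero.2 h₀₁)).symm
  set s := (F q₂ - F q₁) / (q₂ - q₁)
  set t := (F q₀ - F q₁) / (q₀ - q₁)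
  rw [norm_div, div_le_iff₀ (norm_pos_iff.2 (sub_ne_zero.2 h₀₂))] at hs02
  rw [div_mul_eq_mul_div, div_lt_iff₀ (mul_pos hμ hμ)] at hcon
  have hd0 : 0 < ‖q₀ - q₂‖ := norm_pos_iff.2 (sub_ne_zero.2 h₀₂)
  have hst : s - t ≠ 0 := by
    intro h0
    rw [h0, norm_zero, zero_mul] at hcon
    exact hcon.not_ge (by positivity)
  obtain ⟨hz, hw⟩ := hb q₀ hq₀.2
  obtain ⟨h1, h2⟩ := hdom (A := s - t) (B := -s * q₂ + t * q₀) (C := -s * F q₀ + t * F q₂)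
    (D := s * F q₀ * q₂ - t * F q₂ * q₀) (h := fun z ↦ (s - t) * ((F z - F q₀) * (z - q₀)))
    (N := 0 + (1 + 1)) (continuousOn_const.mul
      ((hFc.sub continuousOn_const).mul (continuousOn_id.sub continuousOn_const)))
    ((Wind.const hst).mul (hw.mul (Wind.id_sub_of_mem (hεR hq₀.2)))) (fun z hzK ↦ by
      obtain ⟨⟨h1, h2⟩, h3, h4⟩ := hz z hzK
      have : (s - t) * z * F z + (-s * q₂ + t * q₀) * F z + (-s * F q₀ + t * F q₂) * z +
          (s * F q₀ * q₂ - t * F q₂ * q₀) - (s - t) * ((F z - F q₀) * (z - q₀)) =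
          s * (F z - F q₀) * (q₀ - q₂) - t * (F q₀ - F q₂) * (z - q₀) := by ring
      rw [this, norm_mul (s - t), norm_mul (F z - F q₀)]
      calc _ ≤ ‖s * (F z - F q₀) * (q₀ - q₂)‖ + ‖t * (F q₀ - F q₂) * (z - q₀)‖ := norm_sub_le _ _
        _ ≤ B * T * ‖q₀ - q₂‖ + B * (B * ‖q₀ - q₂‖) * T := by
          rw [norm_mul, norm_mul, norm_mul, norm_mul]
          gcongr
        _ = (B * T + B * B * T) * ‖q₀ - q₂‖ := by ring
        _ < ‖s - t‖ * (μ * μ) := hcon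
        _ ≤ _ := by gcongr)
  exact M.no_three_zeros L h1 h2 (by norm_num) hq₀.1 hq₁.1 hq₂.1 (hεδ hq₀.2) (hεδ hq₁.2)
    (hεδ hq₂.2) h₀₁ h₂₁.symm h₀₂ (by ring)
    (by linear_combination s * (q₁ - q₂) * (-e0) + t * (q₀ - q₁) * (-e2)) (by ring)

theorem locally_biLipschitz (M : SchottkyMap Ω S c r F c' r') {p : ℂ} (hp : p ∈ S) :
    ∃ U ∈ 𝓝[S] p, ∃ L : ℝ, 1 ≤ L ∧ ∀ x ∈ U, ∀ y ∈ U,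
      dist x y / L ≤ dist (F x) (F y) ∧ dist (F x) (F y) ≤ L * dist x y := by
  obtain ⟨ε, hε, m, hm, B, C, hs, -⟩ := M.exists_slope_bounds hp
  set L := max 1 (max B m⁻¹) with hL
  have hL1 : 1 ≤ L := le_max_left _ _
  have hLB : B ≤ L := (le_max_left _ _).trans (le_max_right _ _)
  have hLm : m⁻¹ ≤ L := (le_max_right _ _).trans (le_max_right _ _)
  have hL0 : 0 < L := by linarith
  refine ⟨S ∩ ball p ε, inter_mem_nhdsWithin _ (ball_mem_nhds p hε), L, hL1,
    fun x hx y hy ↦ ?_⟩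
  by_cases hxy : x = y
  · simp [hxy]
  obtain ⟨h1, h2⟩ := hs y hy x hx (Ne.symm hxy)
  have hd : 0 < ‖x - y‖ := norm_pos_iff.2 (sub_ne_zero.2 hxy)
  rw [norm_div] at h1 h2
  rw [le_div_iff₀ hd] at h1
  rw [div_le_iff₀ hd] at h2
  rw [dist_eq_norm, dist_eq_norm]
  refine ⟨?_, h2.trans (by gcongr)⟩
  refine le_trans ?_ h1
  rw [div_le_iff₀ hL0]
  have : 1 ≤ m * L := by
    rw [← mul_inv_cancel₀ hm.ne']; gcongr
  nlinarith

/-- The map has a derivative along the Schottky set. -/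
theorem exists_deriv (M : SchottkyMap Ω S c r F c' r') {p : ℂ} (hp : p ∈ S) :
    ∃ l : ℂ, l ≠ 0 ∧ Tendsto (fun q ↦ (F q - F p) / (q - p)) (𝓝[S \ {p}] p) (𝓝 l) := by
  obtain ⟨ε, hε, m, hm, B, C, hs, hC⟩ := M.exists_slope_bounds hp
  have n := M.neBot_nhdsWithin hp
  have hpε : p ∈ S ∩ ball p ε := ⟨hp, mem_ball_self hε⟩
  have hmem : ∀ ρ > 0, ∀ᶠ q in 𝓝[S \ {p}] p, q ∈ S ∩ ball p ε ∧ q ≠ p ∧ ‖q - p‖ < ρ := by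
    intro ρ hρ
    filter_upwards [self_mem_nhdsWithin, mem_nhdsWithin_of_mem_nhds (ball_mem_nhds p hε),
      mem_nhdsWithin_of_mem_nhds (ball_mem_nhds p hρ)] with q h1 h2 h3
    exact ⟨⟨h1.1, h2⟩, h1.2, by rwa [← dist_eq_norm]⟩
  have hcauchy : Cauchy (map (fun q ↦ (F q - F p) / (q - p)) (𝓝[S \ {p}] p)) := by
    rw [Metric.cauchy_iff]
    refine ⟨inferInstance, fun e he ↦ ?_⟩
    set ρ := e / (2 * (|C| + 1)) with hρ
    have hρ0 : 0 < ρ := by positivity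
    refine ⟨_, image_mem_map (hmem ρ hρ0), ?_⟩
    rintro _ ⟨x, ⟨hx, hxp, hxρ⟩, rfl⟩ _ ⟨y, ⟨hy, hyp, hyρ⟩, rfl⟩
    rw [dist_eq_norm]
    refine (hC y hy p hpε x hx hyp hxp).trans_lt ?_
    have h1 : ‖y - x‖ ≤ ‖y - p‖ + ‖p - x‖ := norm_sub_le_norm_sub_add_norm_sub _ _ _
    rw [norm_sub_rev p x] at h1
    have h2 : C * ‖y - x‖ ≤ (|C| + 1) * ‖y - x‖ :=
      mul_le_mul_of_nonneg_right ((le_abs_self C).trans (by linarith)) (norm_nonneg _)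
    have h3 : (|C| + 1) * (2 * ρ) = e := by rw [hρ]; field_simp
    have h4 : (|C| + 1) * ‖y - x‖ < (|C| + 1) * (2 * ρ) := by
      apply mul_lt_mul_of_pos_left _ (by positivity)
      linarith
    linarith
  obtain ⟨l, hl⟩ := CompleteSpace.complete hcauchy
  refine ⟨l, ?_, hl⟩
  have hlt : m ≤ ‖l‖ := by
    refine ge_of_tendsto (Tendsto.norm hl) ?_
    filter_upwards [hmem 1 one_pos] with q hq
    exact (hs p hpε q hq.1 hq.2.1.symm).1
  exact norm_pos_iff.1 (hm.trans_le hlt)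

/-- A positively oriented map between Schottky sets of measure zero is conformal. -/
theorem exists_continuousOn_deriv (M : SchottkyMap Ω S c r F c' r') :
    ∃ g' : ℂ → ℂ, ContinuousOn g' S ∧ ∀ p ∈ S, g' p ≠ 0 ∧
      Tendsto (fun q ↦ (F q - F p) / (q - p)) (𝓝[S \ {p}] p) (𝓝 (g' p)) := by
  have h : ∀ p : ℂ, ∃ l : ℂ, p ∈ S → l ≠ 0 ∧
      Tendsto (fun q ↦ (F q - F p) / (q - p)) (𝓝[S \ {p}] p) (𝓝 l) := by
    intro p
    by_cases hp : p ∈ S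
    · obtain ⟨l, hl⟩ := M.exists_deriv hp
      exact ⟨l, fun _ ↦ hl⟩
    · exact ⟨0, fun h ↦ absurd h hp⟩
  choose g' hg' using h
  refine ⟨g', fun p hp ↦ ?_, hg'⟩
  obtain ⟨ε, hε, m, hm, B, C, hs, hC⟩ := M.exists_slope_bounds hp
  have hpε : p ∈ S ∩ ball p ε := ⟨hp, mem_ball_self hε⟩
  have hlim : ∀ x ∈ S ∩ ball p ε, ∀ y ∈ S ∩ ball p ε, x ≠ y →
      ‖(F x - F y) / (x - y) - g' y‖ ≤ C * ‖x - y‖ := by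
    intro x hx y hy hxy
    have n := M.neBot_nhdsWithin hy.1
    have t1 : Tendsto (fun q ↦ ‖(F x - F y) / (x - y) - (F q - F y) / (q - y)‖)
      (𝓝[S \ {y}] y) (𝓝 ‖(F x - F y) / (x - y) - g' y‖) :=
      (tendsto_const_nhds.sub (hg' y hy.1).2).norm
    have t2 : Tendsto (fun q : ℂ ↦ C * ‖q - x‖) (𝓝[S \ {y}] y) (𝓝 (C * ‖y - x‖)) := by
      have : Continuous fun q : ℂ ↦ C * ‖q - x‖ := by fun_prop
      exact (this.tendsto y).mono_left nhdsWithin_le_nhds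
    rw [norm_sub_rev x y]
    refine le_of_tendsto_of_tendsto t1 t2 ?_
    filter_upwards [self_mem_nhdsWithin,
      mem_nhdsWithin_of_mem_nhds (isOpen_ball.mem_nhds hy.2)] with q h1 h2
    exact hC q ⟨h1.1, h2⟩ y hy x hx h1.2 hxy
  rw [ContinuousWithinAt, tendsto_iff_norm_sub_tendsto_zero]
  have t : Tendsto (fun q : ℂ ↦ 2 * C * ‖q - p‖) (𝓝[S] p) (𝓝 0) := by
    have : Continuous fun q : ℂ ↦ 2 * C * ‖q - p‖ := by fun_prop
    simpa using (this.tendsto p).mono_left (nhdsWithin_le_nhds (s := S))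
  refine squeeze_zero' (Eventually.of_forall fun _ ↦ norm_nonneg _) ?_ t
  filter_upwards [self_mem_nhdsWithin, mem_nhdsWithin_of_mem_nhds (ball_mem_nhds p hε)] with q h1 h2
  by_cases hqp : q = p
  · simp [hqp]
  have e1 := hlim q ⟨h1, h2⟩ p hpε hqp
  have e2 := hlim p hpε q ⟨h1, h2⟩ (Ne.symm hqp)
  have e3 : (F p - F q) / (p - q) = (F q - F p) / (q - p) := by
    rw [← neg_sub, ← neg_sub q, neg_div_neg_eq]
  rw [e3, norm_sub_rev p q] at e2
  have := norm_sub_le_norm_sub_add_norm_sub (g' q) ((F q - F p) / (q - p)) (g' p)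
  rw [norm_sub_rev (g' q) ((F q - F p) / (q - p))] at this
  linarith

end SchottkyMap

/-- `g` has a continuous logarithm on `K`. -/
def HasLogOn (g : ℂ → ℂ) (K : Set ℂ) : Prop :=
  ∃ u : ℂ → ℂ, ContinuousOn u K ∧ ∀ z ∈ K, g z = Complex.exp (u z)

namespace HasLogOn

variable {g h : ℂ → ℂ} {K X : Set ℂ}

theorem mono (H : HasLogOn g K) (hX : X ⊆ K) : HasLogOn g X := by
  obtain ⟨u, hu, hg⟩ := H
  exact ⟨u, hu.mono hX, fun z hz ↦ hg z (hX hz)⟩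

theorem congr (H : HasLogOn g K) (hgh : ∀ z ∈ K, h z = g z) : HasLogOn h K := by
  obtain ⟨u, hu, hg⟩ := H
  exact ⟨u, hu, fun z hz ↦ (hgh z hz).trans (hg z hz)⟩

theorem mul (H : HasLogOn g K) (H' : HasLogOn h K) : HasLogOn (fun z ↦ g z * h z) K := by
  obtain ⟨u, hu, hg⟩ := H
  obtain ⟨v, hv, hh⟩ := H'
  exact ⟨fun z ↦ u z + v z, hu.add hv, fun z hz ↦ by
    simp only [hg z hz, hh z hz, Complex.exp_add]⟩

theorem const {a : ℂ} (ha : a ≠ 0) : HasLogOn (fun _ ↦ a) K :=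
  ⟨fun _ ↦ Complex.log a, continuousOn_const, fun _ _ ↦ (Complex.exp_log ha).symm⟩

theorem of_slitPlane (hg : ContinuousOn g K) (h0 : ∀ z ∈ K, g z ∈ Complex.slitPlane) :
    HasLogOn g K :=
  ⟨fun z ↦ Complex.log (g z), hg.clog h0,
    fun z hz ↦ (Complex.exp_log (Complex.slitPlane_ne_zero (h0 z hz))).symm⟩

theorem of_mul_slitPlane {a : ℂ} (ha : a ≠ 0) (hg : ContinuousOn g K)
    (h0 : ∀ z ∈ K, a * g z ∈ Complex.slitPlane) : HasLogOn g K := by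
  have h1 : HasLogOn (fun z ↦ a * g z) K :=
    of_slitPlane (g := fun z ↦ a * g z) (continuousOn_const.mul hg) h0
  refine ((const (inv_ne_zero ha)).mul h1).congr fun z _ ↦ ?_
  field_simp

theorem of_norm_sub_lt {a : ℂ} (hg : ContinuousOn g K) (h0 : ∀ z ∈ K, ‖g z - a‖ < ‖a‖) :
    HasLogOn g K := by
  rcases K.eq_empty_or_nonempty with rfl | ⟨w, hw⟩
  · exact ⟨0, continuousOn_empty _, fun z hz ↦ hz.elim⟩
  have ha : a ≠ 0 := norm_pos_iff.1 ((norm_nonneg _).trans_lt (h0 w hw))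
  refine of_mul_slitPlane (inv_ne_zero ha) hg fun z hz ↦ ?_
  refine Complex.ball_one_subset_slitPlane ?_
  rw [mem_ball, dist_eq_norm]
  have : a⁻¹ * g z - 1 = (g z - a) / a := by field_simp
  rw [this, norm_div, div_lt_one (norm_pos_iff.2 ha)]
  exact h0 z hz

theorem comp_mul {a : ℂ} (H : HasLogOn g ((a * ·) '' X)) : HasLogOn (fun z ↦ g (a * z)) X := by
  obtain ⟨u, hu, hg⟩ := H
  exact ⟨fun z ↦ u (a * z), hu.comp (by fun_prop) (mapsTo_image _ _),
    fun z hz ↦ hg _ (mem_image_of_mem _ hz)⟩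

end HasLogOn

/-- A compact plane set all of whose complementary points have winding number zero. -/
def IsLogCompact (K : Set ℂ) : Prop :=
  IsCompact K ∧ ∀ a ∉ K, HasLogOn (fun z ↦ z - a) K

theorem IsLogCompact.inter_halfSpace {K : Set ℂ} (hK : IsLogCompact K) (ω : ℂ) (t : ℝ) :
    IsLogCompact (K ∩ {z | (ω * z).re ≤ t}) := by
  have hcl : IsClosed {z : ℂ | (ω * z).re ≤ t} := isClosed_le (by fun_prop) (by fun_prop)
  refine ⟨hK.1.inter_right hcl, fun a ha ↦ ?_⟩
  by_cases haK : a ∈ K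
  · have hat : t < (ω * a).re := by
      by_contra! hcon
      exact ha ⟨haK, hcon⟩
    by_cases hω : ω = 0
    · refine HasLogOn.of_slitPlane (by fun_prop) fun z hz ↦ ?_
      have := hz.2
      simp [hω] at this hat
      linarith
    refine HasLogOn.of_mul_slitPlane (neg_ne_zero.2 hω) (by fun_prop) fun z hz ↦ ?_
    refine Or.inl ?_
    have h1 : -ω * (z - a) = ω * a - ω * z := by ring
    have h2 : (ω * z).re ≤ t := hz.2
    rw [h1, Complex.sub_re]
    linarith
  · exact (hK.2 a haK).mono inter_subset_left

/-- The elementary jump: along a vertical line, a pair of integer valued functions on the two sides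
whose difference jumps at a given point off `K`. -/
theorem exists_jump {K : Set ℂ} {a : ℂ} (ha : HasLogOn (fun z ↦ z - a) K) (haK : a ∉ K) :
    ∃ v₁ v₂ : ℂ → ℂ, ContinuousOn v₁ (K ∩ {z | z.re ≤ a.re}) ∧
      ContinuousOn v₂ (K ∩ {z | a.re ≤ z.re}) ∧
      (∀ z ∈ K, z.re ≤ a.re → Complex.exp (v₁ z) = 1) ∧
      (∀ z ∈ K, a.re ≤ z.re → Complex.exp (v₂ z) = 1) ∧
      ∀ z ∈ K, z.re = a.re → v₁ z - v₂ z = if z.im ≤ a.im then 0 else 2 * Real.pi * Complex.I := by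
  obtain ⟨u, hu, hexp⟩ := ha
  have hne : ∀ z ∈ K, z - a ≠ 0 := fun z hz h ↦ haK (sub_eq_zero.1 h ▸ hz)
  have key : ∀ w : ℂ, w ≠ 0 → 0 ≤ w.re → w ∈ Complex.slitPlane := by
    intro w hw h0
    rw [Complex.mem_slitPlane_iff]
    rcases h0.lt_or_eq with h | h
    · exact Or.inl h
    · exact Or.inr fun him ↦ hw (Complex.ext h.symm him)
  refine ⟨fun z ↦ u z - Complex.log (a - z) + Real.pi * Complex.I,
    fun z ↦ u z - Complex.log (z - a), ?_, ?_, ?_, ?_, ?_⟩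
  · refine ((hu.mono inter_subset_left).sub (ContinuousOn.clog (by fun_prop) fun z hz ↦ ?_)).add
      continuousOn_const
    refine key _ (fun h ↦ hne z hz.1 (by rw [← neg_sub, h, neg_zero])) ?_
    simpa using hz.2
  · refine (hu.mono inter_subset_left).sub (ContinuousOn.clog (by fun_prop) fun z hz ↦ ?_)
    exact key _ (hne z hz.1) (by simpa using hz.2)
  · intro z hz _
    have h0 : a - z ≠ 0 := fun h ↦ hne z hz (by rw [← neg_sub, h, neg_zero])
    rw [Complex.exp_add, Complex.exp_sub, Complex.exp_log h0, ← hexp z hz, Complex.exp_pi_mul_I]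
    beta_reduce
    rw [← neg_sub a z, neg_div, div_self h0]; norm_num
  · intro z hz _
    rw [Complex.exp_sub, Complex.exp_log (hne z hz), ← hexp z hz, div_self (hne z hz)]
  · intro z hz hre
    have him : z.im ≠ a.im := fun h ↦ haK ((Complex.ext hre h : z = a) ▸ hz)
    have hform : z - a = ((z.im - a.im : ℝ) : ℂ) * Complex.I := by
      apply Complex.ext <;> simp [hre]
    have hform' : a - z = ((a.im - z.im : ℝ) : ℂ) * Complex.I := by
      apply Complex.ext <;> simp [hre]
    have hlog : ∀ y : ℝ, 0 < y → Complex.log ((y : ℂ) * Complex.I) =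
        Real.log y + Real.pi / 2 * Complex.I := by
      intro y hy
      rw [Complex.log_ofReal_mul hy Complex.I_ne_zero, Complex.log_I]
    have hlog' : ∀ y : ℝ, 0 < y → Complex.log (((-y : ℝ) : ℂ) * Complex.I) =
        Real.log y - Real.pi / 2 * Complex.I := by
      intro y hy
      have : (((-y : ℝ) : ℂ) * Complex.I) = (y : ℂ) * -Complex.I := by push_cast; ring
      rw [this, Complex.log_ofReal_mul hy (neg_ne_zero.2 Complex.I_ne_zero), Complex.log_neg_I]
      ring
    beta_reduce
    rw [hform, hform']
    split_ifs with hle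
    · have hlt : 0 < a.im - z.im := sub_pos.2 (lt_of_le_of_ne hle him)
      rw [hlog _ hlt, ← neg_sub a.im z.im, hlog' _ hlt]
      ring
    · have hlt : 0 < z.im - a.im := sub_pos.2 (not_le.1 hle)
      rw [hlog _ hlt, ← neg_sub z.im a.im, hlog' _ hlt]
      ring

/-- Logarithms on the two sides of a vertical line can be merged. -/
theorem HasLogOn.merge {K : Set ℂ} (hK : IsLogCompact K) {g : ℂ → ℂ} {t : ℝ}
    (h₁ : HasLogOn g (K ∩ {z | z.re ≤ t})) (h₂ : HasLogOn g (K ∩ {z | t ≤ z.re})) :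
    HasLogOn g K := by
  obtain ⟨u₁, hu₁, hg₁⟩ := h₁
  obtain ⟨u₂, hu₂, hg₂⟩ := h₂
  set E : Set ℂ := K ∩ {z | z.re = t} with hE
  have hEc : IsCompact E := hK.1.inter_right (isClosed_eq (by fun_prop) (by fun_prop))
  have hE1 : E ⊆ K ∩ {z | z.re ≤ t} := fun z hz ↦ ⟨hz.1, le_of_eq hz.2⟩
  have hE2 : E ⊆ K ∩ {z | t ≤ z.re} := fun z hz ↦ ⟨hz.1, ge_of_eq hz.2⟩
  set d : ℂ → ℂ := fun z ↦ u₁ z - u₂ z with hd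
  have hdc : ContinuousOn d E := (hu₁.mono hE1).sub (hu₂.mono hE2)
  have hdexp : ∀ z ∈ E, Complex.exp (d z) = 1 := fun z hz ↦ by
    simp only [hd]
    rw [Complex.exp_sub, ← hg₁ z (hE1 hz), ← hg₂ z (hE2 hz), div_self]
    rw [hg₁ z (hE1 hz)]
    exact Complex.exp_ne_zero _
  obtain ⟨δ, hδ, hconst⟩ : ∃ δ > 0, ∀ z ∈ E, ∀ w ∈ E, dist z w ≤ δ → d z = d w := by
    obtain ⟨δ, hδ, H⟩ := Metric.uniformContinuousOn_iff.1
      (hEc.uniformContinuousOn_of_continuous hdc) 1 one_pos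
    refine ⟨δ / 2, by positivity, fun z hz w hw hzw ↦ ?_⟩
    have h1 := H z hz w hw (by linarith)
    obtain ⟨n, hn⟩ := Complex.exp_eq_exp_iff_exists_int.1 ((hdexp z hz).trans (hdexp w hw).symm)
    rw [dist_eq_norm, hn, add_sub_cancel_left, norm_mul, norm_mul, norm_mul] at h1
    simp only [Complex.norm_ofNat, Complex.norm_real, Complex.norm_I, mul_one, Complex.norm_intCast,
      Real.norm_eq_abs, abs_of_pos Real.pi_pos] at h1
    have hn0 : n = 0 := by
      by_contra hne
      have h2 : (1 : ℝ) ≤ |(n : ℝ)| := by exact_mod_cast Int.one_le_abs hne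
      nlinarith [Real.pi_gt_three]
    simp [hn, hn0]
  obtain ⟨R, hR⟩ := hEc.isBounded.subset_closedBall 0
  have him : ∀ z ∈ E, |z.im| ≤ R := fun z hz ↦
    (Complex.abs_im_le_norm z).trans (mem_closedBall_zero_iff.1 (hR hz))
  have step : ∀ n : ℕ, ∃ (v₁ v₂ : ℂ → ℂ) (k : ℂ), ContinuousOn v₁ (K ∩ {z | z.re ≤ t}) ∧
      ContinuousOn v₂ (K ∩ {z | t ≤ z.re}) ∧
      (∀ z ∈ K, z.re ≤ t → Complex.exp (v₁ z) = 1) ∧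
      (∀ z ∈ K, t ≤ z.re → Complex.exp (v₂ z) = 1) ∧ Complex.exp k = 1 ∧
      (∀ z ∈ E, z.im ≤ -R - 1 + n * δ → v₁ z - v₂ z = d z) ∧
      ∀ z ∈ E, -R - 1 + n * δ ≤ z.im → v₁ z - v₂ z = k := by
    intro n
    induction n with
    | zero =>
      refine ⟨0, 0, 0, continuousOn_const, continuousOn_const, by simp, by simp, by simp, ?_,
        by simp⟩
      intro z hz hle
      have := (abs_le.1 (him z hz)).1
      simp only [CharP.cast_eq_zero, zero_mul, add_zero] at hle
      linarith
    | succ n ih =>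
      obtain ⟨v₁, v₂, k, hv₁, hv₂, he₁, he₂, hk, hle, hge⟩ := ih
      set s : ℝ := -R - 1 + n * δ with hs
      have hs' : -R - 1 + ((n + 1 : ℕ) : ℝ) * δ = s + δ := by push_cast; ring
      rw [hs']
      by_cases hall : ∀ z ∈ E, s ≤ z.im → z.im ≤ s + δ → d z = k
      · refine ⟨v₁, v₂, k, hv₁, hv₂, he₁, he₂, hk, fun z hz h1 ↦ ?_, fun z hz h1 ↦
          hge z hz (by linarith)⟩
        rcases le_total z.im s with h2 | h2
        · exact hle z hz h2
        · rw [hge z hz h2, hall z hz h2 h1]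
      · push Not at hall
        obtain ⟨z₀, hz₀, hz₀1, hz₀2, hne⟩ := hall
        have hdist : ∀ z ∈ E, s ≤ z.im → z.im ≤ s + δ → d z = d z₀ := by
          intro z hz h1 h2
          refine hconst z hz z₀ hz₀ ?_
          rw [Complex.dist_of_re_eq (hz.2.trans hz₀.2.symm), Real.dist_eq, abs_le]
          constructor <;> linarith
        have ha : (⟨t, s⟩ : ℂ) ∉ K := by
          intro haK
          have haE : (⟨t, s⟩ : ℂ) ∈ E := ⟨haK, rfl⟩
          have h1 := hle _ haE le_rfl
          have h2 := hge _ haE le_rfl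
          have h3 := hdist _ haE le_rfl (by simpa using hδ.le)
          exact hne (by rw [← h3, ← h1, h2])
        obtain ⟨w₁, w₂, hw₁, hw₂, hf₁, hf₂, hjump⟩ := exists_jump (hK.2 _ ha) ha
        obtain ⟨m, hm⟩ := Complex.exp_eq_exp_iff_exists_int.1 ((hdexp z₀ hz₀).trans hk.symm)
        have hexp : ∀ x y : ℂ, Complex.exp x = 1 → Complex.exp y = 1 →
            Complex.exp (x + m * y) = 1 := by
          intro x y hx hy
          rw [Complex.exp_add, hx, Complex.exp_int_mul, hy]
          simp
        refine ⟨fun z ↦ v₁ z + m * w₁ z, fun z ↦ v₂ z + m * w₂ z, d z₀,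
          hv₁.add (continuousOn_const.mul hw₁), hv₂.add (continuousOn_const.mul hw₂),
          fun z hz h ↦ hexp _ _ (he₁ z hz h) (hf₁ z hz h),
          fun z hz h ↦ hexp _ _ (he₂ z hz h) (hf₂ z hz h), hdexp z₀ hz₀, ?_, ?_⟩
        · intro z hz h1
          have h2 := hjump z hz.1 hz.2
          have h3 : v₁ z + m * w₁ z - (v₂ z + m * w₂ z) = v₁ z - v₂ z + m * (w₁ z - w₂ z) := by ring
          rw [h3, h2]
          split_ifs with h4
          · rw [mul_zero, add_zero, hle z hz h4]
          · have h5 : s ≤ z.im := (not_le.1 h4).le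
            rw [hge z hz h5, hdist z hz h5 h1, hm]
        · intro z hz h1
          have h2 := hjump z hz.1 hz.2
          have h3 : v₁ z + m * w₁ z - (v₂ z + m * w₂ z) = v₁ z - v₂ z + m * (w₁ z - w₂ z) := by ring
          rw [h3, h2, if_neg (by simp only [not_le]; linarith), hge z hz (by linarith), hm]
  obtain ⟨n, hn⟩ := exists_nat_ge ((2 * R + 1) / δ)
  rw [div_le_iff₀ hδ] at hn
  obtain ⟨v₁, v₂, k, hv₁, hv₂, he₁, he₂, -, hle, -⟩ := step n
  have hagree : ∀ z ∈ E, u₁ z - v₁ z = u₂ z - v₂ z := by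
    intro z hz
    have h1 := hle z hz (by linarith [(abs_le.1 (him z hz)).2])
    simp only [hd] at h1
    linear_combination -h1
  set u : ℂ → ℂ := fun z ↦ if z.re ≤ t then u₁ z - v₁ z else u₂ z - v₂ z with hu
  have hu1 : ∀ z ∈ K ∩ {z | z.re ≤ t}, u z = u₁ z - v₁ z := fun z hz ↦ if_pos hz.2
  have hu2 : ∀ z ∈ K ∩ {z | t ≤ z.re}, u z = u₂ z - v₂ z := by
    intro z hz
    simp only [hu]
    split_ifs with h
    · exact hagree z ⟨hz.1, le_antisymm h hz.2⟩
    · rfl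
  refine ⟨u, ?_, ?_⟩
  · have h1 : ContinuousOn u (K ∩ {z | z.re ≤ t}) := (hu₁.sub hv₁).congr hu1
    have h2 : ContinuousOn u (K ∩ {z | t ≤ z.re}) := (hu₂.sub hv₂).congr hu2
    refine (h1.union_of_isClosed h2
      (hK.1.isClosed.inter (isClosed_le (by fun_prop) (by fun_prop)))
      (hK.1.isClosed.inter (isClosed_le (by fun_prop) (by fun_prop)))).mono fun z hz ↦ ?_
    rcases le_total z.re t with h | h
    · exact Or.inl ⟨hz, h⟩
    · exact Or.inr ⟨hz, h⟩
  · intro z hz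
    rcases le_total z.re t with h | h
    · rw [hu1 z ⟨hz, h⟩, Complex.exp_sub, he₁ z hz h, div_one, hg₁ z ⟨hz, h⟩]
    · rw [hu2 z ⟨hz, h⟩, Complex.exp_sub, he₂ z hz h, div_one, hg₂ z ⟨hz, h⟩]

theorem IsLogCompact.rotate {K : Set ℂ} (hK : IsLogCompact K) :
    IsLogCompact ((-Complex.I * ·) '' K) := by
  refine ⟨hK.1.image (by fun_prop), fun b hb ↦ ?_⟩
  have hb' : Complex.I * b ∉ K := fun h ↦ hb ⟨_, h, by
    simp only [neg_mul, ← mul_assoc, Complex.I_mul_I]; ring⟩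
  have h1 : HasLogOn (fun w ↦ Complex.I * w - Complex.I * b) ((-Complex.I * ·) '' K) := by
    refine HasLogOn.comp_mul (g := fun z ↦ z - Complex.I * b) ((hK.2 _ hb').mono ?_)
    rintro _ ⟨_, ⟨z, hz, rfl⟩, rfl⟩
    simpa [← mul_assoc] using hz
  refine ((HasLogOn.const (neg_ne_zero.2 Complex.I_ne_zero)).mul h1).congr fun z _ ↦ ?_
  linear_combination (z - b) * Complex.I_mul_I

theorem HasLogOn.merge_im {K : Set ℂ} (hK : IsLogCompact K) {g : ℂ → ℂ} {t : ℝ}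
    (h₁ : HasLogOn g (K ∩ {z | z.im ≤ t})) (h₂ : HasLogOn g (K ∩ {z | t ≤ z.im})) :
    HasLogOn g K := by
  have h1 : HasLogOn (fun w ↦ g (Complex.I * w)) ((-Complex.I * ·) '' K) := by
    refine HasLogOn.merge hK.rotate (t := t) (comp_mul (h₁.mono ?_)) (comp_mul (h₂.mono ?_))
    all_goals
      rintro _ ⟨_, ⟨⟨z, hz, rfl⟩, h⟩, rfl⟩
      exact ⟨by simpa [← mul_assoc] using hz, by simpa using h⟩
  refine h1.comp_mul.congr fun z _ ↦ ?_
  simp [← mul_assoc]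

/-- On a compact set without nontrivial winding, all nonvanishing functions have logarithms. -/
theorem IsLogCompact.hasLogOn {K : Set ℂ} (hK : IsLogCompact K) {g : ℂ → ℂ}
    (hg : ContinuousOn g K) (h0 : ∀ z ∈ K, g z ≠ 0) : HasLogOn g K := by
  have hre : ∀ {X : Set ℂ}, IsLogCompact X → ∀ t : ℝ, IsLogCompact (X ∩ {z | z.re ≤ t}) ∧
      IsLogCompact (X ∩ {z | t ≤ z.re}) := fun hX t ↦ by
    refine ⟨by simpa using hX.inter_halfSpace 1 t, by simpa using hX.inter_halfSpace (-1) (-t)⟩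
  have him : ∀ {X : Set ℂ}, IsLogCompact X → ∀ t : ℝ, IsLogCompact (X ∩ {z | z.im ≤ t}) ∧
      IsLogCompact (X ∩ {z | t ≤ z.im}) := fun hX t ↦ by
    refine ⟨by simpa using hX.inter_halfSpace (-Complex.I) t,
      by simpa using hX.inter_halfSpace Complex.I (-t)⟩
  obtain ⟨δ, hδ, hloc⟩ : ∃ δ > 0, ∀ X ⊆ K,
      (∀ z ∈ X, ∀ w ∈ X, |z.re - w.re| ≤ δ ∧ |z.im - w.im| ≤ δ) → HasLogOn g X := by
    rcases K.eq_empty_or_nonempty with rfl | hne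
    · refine ⟨1, one_pos, fun X hX _ ↦ ?_⟩
      rw [subset_empty_iff.1 hX]
      exact ⟨0, continuousOn_empty _, fun z hz ↦ hz.elim⟩
    obtain ⟨z₀, hz₀, hmin⟩ := hK.1.exists_isMinOn hne hg.norm
    obtain ⟨δ, hδ, H⟩ := Metric.uniformContinuousOn_iff.1
      (hK.1.uniformContinuousOn_of_continuous hg) ‖g z₀‖ (norm_pos_iff.2 (h0 z₀ hz₀))
    refine ⟨δ / 3, by positivity, fun X hX hosc ↦ ?_⟩
    rcases X.eq_empty_or_nonempty with rfl | ⟨w, hw⟩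
    · exact ⟨0, continuousOn_empty _, fun z hz ↦ hz.elim⟩
    refine HasLogOn.of_norm_sub_lt (a := g w) (hg.mono hX) fun z hz ↦ ?_
    rw [← dist_eq_norm]
    refine (H z (hX hz) w (hX hw) ?_).trans_le (hmin (hX hw))
    rw [dist_eq_norm]
    have := Complex.norm_le_abs_re_add_abs_im (z - w)
    have h2 := hosc z hz w hw
    rw [Complex.sub_re, Complex.sub_im] at this
    linarith [h2.1, h2.2]
  obtain ⟨R, hR⟩ := hK.1.isBounded.subset_closedBall 0
  have hbr : ∀ z ∈ K, |z.re| ≤ R := fun z hz ↦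
    (Complex.abs_re_le_norm z).trans (mem_closedBall_zero_iff.1 (hR hz))
  have hbi : ∀ z ∈ K, |z.im| ≤ R := fun z hz ↦
    (Complex.abs_im_le_norm z).trans (mem_closedBall_zero_iff.1 (hR hz))
  have hcol : ∀ n : ℕ, ∀ X ⊆ K, IsLogCompact X → ∀ a : ℝ,
      (∀ z ∈ X, a ≤ z.re ∧ z.re ≤ a + (n + 1) * δ) →
      (∀ z ∈ X, ∀ w ∈ X, |z.im - w.im| ≤ δ) → HasLogOn g X := by
    intro n
    induction n with
    | zero =>
      intro X hX _ a ha hosc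
      refine hloc X hX fun z hz w hw ↦ ⟨?_, hosc z hz w hw⟩
      have h1 := ha z hz
      have h2 := ha w hw
      simp only [CharP.cast_eq_zero, zero_add, one_mul] at h1 h2
      rw [abs_le]
      constructor <;> linarith
    | succ n ih =>
      intro X hX hXc a ha hosc
      refine HasLogOn.merge hXc (t := a + (n + 1) * δ) ?_ ?_
      · exact ih _ (inter_subset_left.trans hX) (hre hXc _).1 a (fun z hz ↦ ⟨(ha z hz.1).1, hz.2⟩)
          fun z hz w hw ↦ hosc z hz.1 w hw.1
      · refine hloc _ (inter_subset_left.trans hX) fun z hz w hw ↦ ⟨?_, hosc z hz.1 w hw.1⟩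
        have h1 := (ha z hz.1).2
        have h2 := (ha w hw.1).2
        have h3 : a + (n + 1) * δ ≤ z.re := hz.2
        have h4 : a + (n + 1) * δ ≤ w.re := hw.2
        push_cast at h1 h2
        rw [abs_le]
        constructor <;> linarith
  obtain ⟨N, hN⟩ := exists_nat_ge (2 * R / δ)
  rw [div_le_iff₀ hδ] at hN
  have hrow : ∀ n : ℕ, ∀ X ⊆ K, IsLogCompact X → ∀ a : ℝ,
      (∀ z ∈ X, a ≤ z.im ∧ z.im ≤ a + (n + 1) * δ) → HasLogOn g X := by
    have hstrip : ∀ X ⊆ K, IsLogCompact X → (∀ z ∈ X, ∀ w ∈ X, |z.im - w.im| ≤ δ) →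
        HasLogOn g X := by
      intro X hX hXc hosc
      refine hcol N X hX hXc (-R) (fun z hz ↦ ?_) hosc
      have := abs_le.1 (hbr z (hX hz))
      constructor
      · exact this.1
      · nlinarith [this.2]
    intro n
    induction n with
    | zero =>
      intro X hX hXc a ha
      refine hstrip X hX hXc fun z hz w hw ↦ ?_
      have h1 := ha z hz
      have h2 := ha w hw
      simp only [CharP.cast_eq_zero, zero_add, one_mul] at h1 h2
      rw [abs_le]
      constructor <;> linarith
    | succ n ih =>
      intro X hX hXc a ha
      refine HasLogOn.merge_im hXc (t := a + (n + 1) * δ) ?_ ?_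
      · exact ih _ (inter_subset_left.trans hX) (him hXc _).1 a (fun z hz ↦ ⟨(ha z hz.1).1, hz.2⟩)
      · refine hstrip _ (inter_subset_left.trans hX) (him hXc _).2 fun z hz w hw ↦ ?_
        have h1 := (ha z hz.1).2
        have h2 := (ha w hw.1).2
        have h3 : a + (n + 1) * δ ≤ z.im := hz.2
        have h4 : a + (n + 1) * δ ≤ w.im := hw.2
        push_cast at h1 h2
        rw [abs_le]
        constructor <;> linarith
  refine hrow N K Subset.rfl hK (-R) fun z hz ↦ ?_
  have := abs_le.1 (hbi z hz)
  constructor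
  · exact this.1
  · nlinarith [this.2]

theorem exists_mem_segment_frontier {A : Set ℂ} {x y : ℂ} (hx : x ∈ A) (hy : y ∉ A) :
    ∃ w ∈ segment ℝ x y, w ∈ frontier A := by
  by_contra! hcon
  have hpre : IsPreconnected (segment ℝ x y) := (convex_segment x y).isPreconnected
  have h1 := hpre.subset_left_of_subset_union (u := interior A) (v := (closure A)ᶜ) isOpen_interior
    isClosed_closure.isOpen_compl (disjoint_left.2 fun z hz hz' ↦
      hz' (subset_closure (interior_subset hz))) (fun z hz ↦ ?_) ⟨x, left_mem_segment ℝ x y, ?_⟩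
  · exact hy (interior_subset (h1 (right_mem_segment ℝ x y)))
  · by_contra hz'
    rw [mem_union, not_or, notMem_compl_iff] at hz'
    exact hcon z hz ⟨hz'.2, hz'.1⟩
  · by_contra hx'
    exact hcon x (left_mem_segment ℝ x y) ⟨subset_closure hx, hx'⟩

theorem exists_mem_segment_sphere {c x y : ℂ} {r : ℝ} (hr : 0 < r) (hx : x ∈ ball c r)
    (hy : y ∉ ball c r) : ∃ w ∈ segment ℝ x y, w ∈ sphere c r := by
  obtain ⟨w, hw, hf⟩ := exists_mem_segment_frontier hx hy
  exact ⟨w, hw, by rwa [frontier_ball c hr.ne'] at hf⟩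

theorem isPreconnected_sphere_complex (c : ℂ) (r : ℝ) : IsPreconnected (sphere c r) :=
  isPreconnected_sphere (by rw [Complex.rank_real_complex]; norm_num) c r

/-- Removing disjoint open discs from a connected set does not disconnect it. -/
theorem IsPreconnected.sdiff_balls {I : Type*} {U : Set ℂ} (hU : IsPreconnected U) {c : I → ℂ}
    {r : I → ℝ} (hr : ∀ i, 0 < r i) (hsub : ∀ i, closedBall (c i) (r i) ⊆ U)
    (hdisj : Pairwise fun i j ↦ Disjoint (closedBall (c i) (r i)) (closedBall (c j) (r j))) :
    IsPreconnected (U \ ⋃ i, ball (c i) (r i)) := by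
  classical
  have heq : ∀ {i j z}, z ∈ closedBall (c i) (r i) → z ∈ closedBall (c j) (r j) → i = j := by
    intro i j z hi hj
    by_contra hij
    exact disjoint_left.1 (hdisj hij) hi hj
  have hsph : ∀ i, sphere (c i) (r i) ⊆ U \ ⋃ i, ball (c i) (r i) := by
    intro i z hz
    refine ⟨hsub i (sphere_subset_closedBall hz), fun hmem ↦ ?_⟩
    obtain ⟨j, hj⟩ := mem_iUnion.1 hmem
    have := heq (sphere_subset_closedBall hz) (ball_subset_closedBall hj)
    subst this
    exact (mem_ball.1 hj).ne (mem_sphere.1 hz)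
  refine isPreconnected_of_forall_constant fun φ hφ x hx y hy ↦ ?_
  have hbase : ∀ i, c i + r i ∈ sphere (c i) (r i) := fun i ↦ by
    simp [abs_of_pos (hr i)]
  set ψ : ℂ → Bool := fun z ↦ if h : ∃ i, z ∈ ball (c i) (r i) then
    φ (c h.choose + r h.choose) else φ z with hψ
  have hin : ∀ i, ∀ z ∈ ball (c i) (r i), ψ z = φ (c i + r i) := by
    intro i z hz
    have h : ∃ i, z ∈ ball (c i) (r i) := ⟨i, hz⟩
    simp only [hψ, dif_pos h]
    rw [heq (ball_subset_closedBall h.choose_spec) (ball_subset_closedBall hz)]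
  have hout : ∀ z ∈ U \ ⋃ i, ball (c i) (r i), ψ z = φ z := by
    intro z hz
    have h : ¬ ∃ i, z ∈ ball (c i) (r i) := fun h ↦ hz.2 (mem_iUnion.2 h)
    simp only [hψ, dif_neg h]
  have hcont : ContinuousOn ψ U := by
    intro p hp
    by_cases hpS : p ∈ ⋃ i, ball (c i) (r i)
    · obtain ⟨i, hi⟩ := mem_iUnion.1 hpS
      refine (continuousAt_const (y := φ (c i + r i))).congr ?_ |>.continuousWithinAt
      filter_upwards [isOpen_ball.mem_nhds hi] with z hz using (hin i z hz).symm
    · have hev : ∀ᶠ z in 𝓝[U \ ⋃ i, ball (c i) (r i)] p, φ z = φ p :=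
        (hφ p ⟨hp, hpS⟩).eventually ((isOpen_discrete {φ p}).mem_nhds rfl)
      obtain ⟨ε, hε, hball⟩ := Metric.mem_nhdsWithin_iff.1 hev
      refine (continuousWithinAt_const (b := φ p)).congr_of_eventuallyEq ?_
        ((hout p ⟨hp, hpS⟩).trans rfl)
      filter_upwards [inter_mem_nhdsWithin U (ball_mem_nhds p hε)] with z hz
      by_cases hzS : z ∈ ⋃ i, ball (c i) (r i)
      · obtain ⟨i, hi⟩ := mem_iUnion.1 hzS
        obtain ⟨w, hw, hws⟩ := exists_mem_segment_sphere (hr i) hi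
          (fun h ↦ hpS (mem_iUnion.2 ⟨i, h⟩))
        have hwb : w ∈ ball p ε := (convex_ball p ε).segment_subset hz.2 (mem_ball_self hε) hw
        rw [hin i z hi, ← show φ w = φ p from hball ⟨hwb, hsph i hws⟩]
        exact (isPreconnected_sphere_complex _ _).constant (hφ.mono (hsph i)) (hbase i) hws
      · rw [hout z ⟨hz.1, hzS⟩]
        exact hball ⟨hz.2, hz.1, hzS⟩
  rw [← hout x hx, ← hout y hy]
  exact hU.constant hcont hx.1 hy.1

/-- Removing a closed disc from a connected open set does not disconnect it. -/
theorem IsPreconnected.sdiff_closedBall {U : Set ℂ} (hU : IsPreconnected U) (hUo : IsOpen U) {c : ℂ}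
    {r : ℝ} (hr : 0 < r) (hsub : closedBall c r ⊆ U) : IsPreconnected (U \ closedBall c r) := by
  classical
  obtain ⟨δ, hδ, hth⟩ := (isCompact_closedBall c r).exists_thickening_subset_open hUo hsub
  rw [thickening_closedBall hδ hr.le] at hth
  have hann : IsPreconnected (ball c (δ + r) \ closedBall c r) := by
    have h1 : IsPreconnected ((fun x : ℂ × ℝ ↦ c + (x.2 : ℂ) * x.1) ''
        (sphere (0 : ℂ) 1 ×ˢ Ioo r (δ + r))) :=
      ((isPreconnected_sphere_complex 0 1).prod isPreconnected_Ioo).image _ (by fun_prop)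
    convert h1 using 1
    ext z
    simp only [Set.mem_sdiff, mem_ball, mem_closedBall, not_le, mem_image, mem_prod, mem_Ioo,
      Prod.exists, dist_eq_norm, mem_sphere, sub_zero]
    constructor
    · rintro ⟨h1, h2⟩
      have h0 : (‖z - c‖ : ℂ) ≠ 0 := by exact_mod_cast (hr.trans h2).ne'
      refine ⟨(z - c) / ‖z - c‖, ‖z - c‖, ⟨?_, h2, h1⟩, ?_⟩
      · rw [norm_div, Complex.norm_real, norm_norm, div_self]
        exact_mod_cast h0
      · rw [mul_div_cancel₀ _ h0]; ring
    · rintro ⟨a, t, ⟨ha, ht⟩, rfl⟩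
      have : ‖c + t * a - c‖ = t := by
        rw [add_sub_cancel_left, norm_mul, ha, mul_one, Complex.norm_real, Real.norm_eq_abs,
          abs_of_pos (hr.trans ht.1)]
      rw [this]
      exact ⟨ht.2, ht.1⟩
  refine isPreconnected_of_forall_constant fun φ hφ x hx y hy ↦ ?_
  have hb : c + ((r + δ / 2 : ℝ) : ℂ) ∈ ball c (δ + r) \ closedBall c r := by
    have : ‖((r + δ / 2 : ℝ) : ℂ)‖ = r + δ / 2 := by
      rw [Complex.norm_real, Real.norm_eq_abs, abs_of_pos (by positivity)]
    simp only [Set.mem_sdiff, mem_ball, mem_closedBall, dist_eq_norm, add_sub_cancel_left, this]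
    constructor <;> linarith
  set b := c + ((r + δ / 2 : ℝ) : ℂ)
  set ψ : ℂ → Bool := fun z ↦ if z ∈ closedBall c r then φ b else φ z with hψ
  have hin : ∀ z ∈ ball c (δ + r), ψ z = φ b := by
    intro z hz
    by_cases hz' : z ∈ closedBall c r
    · exact if_pos hz'
    · simp only [hψ, if_neg hz']
      exact hann.constant (hφ.mono (sdiff_subset_sdiff_left hth)) ⟨hz, hz'⟩ hb
  have hout : ∀ z ∉ closedBall c r, ψ z = φ z := fun z hz ↦ if_neg hz
  have hcont : ContinuousOn ψ U := by
    intro p hp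
    by_cases hpc : p ∈ closedBall c r
    · have hp' : p ∈ ball c (δ + r) := mem_ball.2 ((mem_closedBall.1 hpc).trans_lt (by linarith))
      refine (continuousAt_const (y := φ b)).congr ?_ |>.continuousWithinAt
      filter_upwards [isOpen_ball.mem_nhds hp'] with z hz using (hin z hz).symm
    · have h1 : ContinuousWithinAt φ U p := (hφ p ⟨hp, hpc⟩).mono_of_mem_nhdsWithin
        (inter_mem_nhdsWithin U (isClosed_closedBall.isOpen_compl.mem_nhds hpc))
      refine h1.congr_of_eventuallyEq ?_ (hout p hpc)
      filter_upwards [mem_nhdsWithin_of_mem_nhds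
        (isClosed_closedBall.isOpen_compl.mem_nhds hpc)] with z hz using hout z hz
  rw [← hout x hx.2, ← hout y hy.2]
  exact hU.constant hcont hx.1 hy.1

namespace SchottkyData

variable {I : Type} {Ω S : Set ℂ} {c : I → ℂ} {r : I → ℝ}

theorem isPreconnected (h : SchottkyData Ω S c r) (hΩ : IsPreconnected Ω) : IsPreconnected S := by
  rw [h.eq]
  exact hΩ.sdiff_balls h.pos h.sub h.disj

theorem isPreconnected_sdiff_sphere (h : SchottkyData Ω S c r) (hΩ : IsPreconnected Ω) (i : I) :
    IsPreconnected (S \ sphere (c i) (r i)) := by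
  have h1 := (hΩ.sdiff_closedBall h.isOpen (h.pos i) (h.sub i)).sdiff_balls
    (I := {j // j ≠ i}) (c := fun j ↦ c j) (r := fun j ↦ r j) (fun j ↦ h.pos j)
    (fun j z hz ↦ ⟨h.sub j hz, fun hz' ↦ j.2 (h.eq_of_mem hz hz')⟩)
    (fun j k hjk ↦ h.disj fun hjk' ↦ hjk (Subtype.ext hjk'))
  convert h1 using 1
  ext z
  simp only [Set.mem_sdiff, h.mem_iff, mem_iUnion, not_exists, ← closedBall_sdiff_ball,
    Subtype.forall]
  constructor
  · rintro ⟨⟨hz, hb⟩, hs⟩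
    exact ⟨⟨hz, fun hc ↦ hs ⟨hc, hb i⟩⟩, fun j _ ↦ hb j⟩
  · rintro ⟨⟨hz, hc⟩, hb⟩
    refine ⟨⟨hz, fun j ↦ ?_⟩, fun hs ↦ hc hs.1⟩
    by_cases hj : j = i
    · subst hj
      exact fun h ↦ hc (ball_subset_closedBall h)
    · exact hb j hj

theorem exists_mem_near_frontier (h : SchottkyData Ω S c r) {q : ℂ} (hq : q ∈ frontier Ω) {ε : ℝ}
    (hε : 0 < ε) : ∃ z ∈ S, z ∈ ball q ε := by
  have hqΩ : q ∉ Ω := fun hmem ↦ hq.2 (by rwa [h.isOpen.interior_eq])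
  obtain ⟨z, hzΩ, hz⟩ := Metric.mem_closure_iff.1 hq.1 ε hε
  by_cases hzS : z ∈ S
  · exact ⟨z, hzS, mem_ball'.2 hz⟩
  obtain ⟨i, hi⟩ := h.exists_mem_ball hzΩ hzS
  obtain ⟨w, hw, hws⟩ := exists_mem_segment_sphere (h.pos i) hi
    (fun hqi ↦ hqΩ (h.sub i (ball_subset_closedBall hqi)))
  exact ⟨w, h.sphere_subset i hws, (convex_ball q ε).segment_subset (mem_ball'.2 hz)
    (mem_ball_self hε) hw⟩

end SchottkyData

theorem HasLogOn.sub_of_dist_lt {C : Set ℂ} {a b : ℂ} (H : HasLogOn (fun z ↦ z - a) C)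
    (hab : ∀ z ∈ C, dist a b < dist z a) : HasLogOn (fun z ↦ z - b) C := by
  have hne : ∀ z ∈ C, z - a ≠ 0 := fun z hz h ↦ by
    have := hab z hz
    rw [sub_eq_zero.1 h, dist_self] at this
    exact this.not_ge dist_nonneg
  have h1 : HasLogOn (fun z ↦ (z - b) / (z - a)) C := by
    refine HasLogOn.of_norm_sub_lt (a := 1) (ContinuousOn.div (by fun_prop) (by fun_prop) hne)
      fun z hz ↦ ?_
    have h2 : (z - b) / (z - a) - 1 = (a - b) / (z - a) := by
      rw [div_sub_one (hne z hz)]; ring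
    rw [h2, norm_div, norm_one, div_lt_one (norm_pos_iff.2 (hne z hz)), ← dist_eq_norm,
      ← dist_eq_norm]
    exact hab z hz
  exact (h1.mul H).congr fun z hz ↦ (div_mul_cancel₀ _ (hne z hz)).symm

/-- The property that `z - a` has a logarithm on `C` is constant on connected sets off `C`. -/
theorem hasLogOn_sub_iff {C X : Set ℂ} (hC : IsCompact C) (hX : IsPreconnected X)
    (hd : Disjoint X C) {a b : ℂ} (ha : a ∈ X) (hb : b ∈ X) :
    HasLogOn (fun z ↦ z - a) C ↔ HasLogOn (fun z ↦ z - b) C := by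
  classical
  have hcont : ContinuousOn (fun a ↦ decide (HasLogOn (fun z ↦ z - a) C)) X := by
    intro a ha
    obtain ⟨ε, hε, hsub⟩ := Metric.isOpen_iff.1 hC.isClosed.isOpen_compl a (disjoint_left.1 hd ha)
    have hne : ∀ z ∈ C, ε ≤ dist z a := fun z hz ↦ by
      by_contra! hcon
      exact hsub (mem_ball.2 hcon) hz
    refine (continuousAt_const (y := decide (HasLogOn (fun z ↦ z - a) C))).congr ?_
      |>.continuousWithinAt
    filter_upwards [ball_mem_nhds a (half_pos hε)] with b hb
    rw [mem_ball] at hb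
    refine decide_eq_decide.2 ⟨fun H ↦ H.sub_of_dist_lt fun z hz ↦ ?_,
      fun H ↦ H.sub_of_dist_lt fun z hz ↦ ?_⟩
    · linarith [hne z hz, dist_comm a b]
    · linarith [hne z hz, dist_triangle z b a]
  exact decide_eq_decide.1 (hX.constant hcont ha hb)

/-- A homeomorphism `f` between relative Schottky sets, with inverse `g`. -/
structure SchottkyHomeo {I I' : Type} (Ω S : Set ℂ) (c : I → ℂ) (r : I → ℝ) (Ω' S' : Set ℂ)
    (c' : I' → ℂ) (r' : I' → ℝ) (f g : ℂ → ℂ) : Prop where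
  data : SchottkyData Ω S c r
  data' : SchottkyData Ω' S' c' r'
  conn : IsPreconnected Ω
  conn' : IsPreconnected Ω'
  cont : ContinuousOn f S
  cont' : ContinuousOn g S'
  maps : MapsTo f S S'
  maps' : MapsTo g S' S
  left_inv : LeftInvOn g f S
  right_inv : LeftInvOn f g S'

namespace SchottkyHomeo

variable {I I' : Type} {Ω S : Set ℂ} {c : I → ℂ} {r : I → ℝ} {Ω' S' : Set ℂ}
    {c' : I' → ℂ} {r' : I' → ℝ} {f g : ℂ → ℂ}

theorem symm (H : SchottkyHomeo Ω S c r Ω' S' c' r' f g) :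
    SchottkyHomeo Ω' S' c' r' Ω S c r g f :=
  ⟨H.data', H.data, H.conn', H.conn, H.cont', H.cont, H.maps', H.maps, H.right_inv, H.left_inv⟩

theorem exists_sphere_subset_image (H : SchottkyHomeo Ω S c r Ω' S' c' r' f g) (i : I) :
    ∃ j, sphere (c' j) (r' j) ⊆ f '' sphere (c i) (r i) := by
  have D := H.data
  have D' := H.data'
  have hsph := D.sphere_subset i
  set C : Set ℂ := f '' sphere (c i) (r i) with hC
  have hCc : IsCompact C := (isCompact_sphere _ _).image_of_continuousOn (H.cont.mono hsph)
  have hCS : C ⊆ S' := by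
    rintro _ ⟨z, hz, rfl⟩
    exact H.maps (hsph hz)
  have hCn : C.Nonempty := (NormedSpace.sphere_nonempty.2 (D.pos i).le).image f
  have hconn : IsPreconnected (S' \ C) := by
    have h1 : S' \ C = f '' (S \ sphere (c i) (r i)) := by
      ext w
      constructor
      · rintro ⟨hw, hwC⟩
        exact ⟨g w, ⟨H.maps' hw, fun h ↦ hwC ⟨g w, h, H.right_inv hw⟩⟩, H.right_inv hw⟩
      · rintro ⟨z, ⟨hz, hzs⟩, rfl⟩
        refine ⟨H.maps hz, ?_⟩
        rintro ⟨y, hy, hyz⟩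
        have : y = z := by rw [← H.left_inv (hsph hy), hyz, H.left_inv hz]
        exact hzs (this ▸ hy)
    rw [h1]
    exact (D.isPreconnected_sdiff_sphere H.conn i).image f (H.cont.mono sdiff_subset)
  have hext : ∀ a ∉ Ω', ∃ s ∈ S' \ C,
      (HasLogOn (fun z ↦ z - a) C ↔ HasLogOn (fun z ↦ z - s) C) := by
    intro a ha
    obtain ⟨q, hq, hmin⟩ := hCc.exists_infDist_eq_dist hCn a
    obtain ⟨b, hb, hbf⟩ := exists_mem_segment_frontier (D'.subset (hCS hq)) ha
    have hbΩ : b ∉ Ω' := fun hmem ↦ hbf.2 (by rwa [D'.isOpen.interior_eq])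
    have hbC : b ∉ C := fun h ↦ hbΩ (D'.subset (hCS h))
    have hseg : Disjoint (segment ℝ a b) C := by
      refine disjoint_left.2 fun z hz hzC ↦ ?_
      have h1 : dist a q ≤ dist a z := by rw [← hmin]; exact infDist_le_dist_of_mem hzC
      have h2 := dist_add_dist_of_mem_segment hz
      have h3 := dist_add_dist_of_mem_segment hb
      have h4 : 0 < dist q b := dist_pos.2 fun h ↦ hbΩ (h ▸ D'.subset (hCS hq))
      have h5 : 0 ≤ dist z b := dist_nonneg
      rw [dist_comm q a, dist_comm b a] at h3
      linarith
    obtain ⟨ε, hε, hsub⟩ := Metric.isOpen_iff.1 hCc.isClosed.isOpen_compl b hbC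
    obtain ⟨s, hs, hsb⟩ := D'.exists_mem_near_frontier hbf hε
    refine ⟨s, ⟨hs, hsub hsb⟩, ?_⟩
    rw [hasLogOn_sub_iff hCc (convex_segment a b).isPreconnected hseg (left_mem_segment ℝ a b)
      (right_mem_segment ℝ a b)]
    exact hasLogOn_sub_iff hCc (convex_ball b ε).isPreconnected (disjoint_left.2 fun z hz ↦ hsub hz)
      (mem_ball_self hε) hsb
  have hlogS : ∀ s ∈ S' \ C, HasLogOn (fun z ↦ z - s) C := by
    intro s hs
    obtain ⟨R, hR⟩ := D'.isBounded.subset_closedBall 0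
    have hR0 : 0 ≤ R := by
      obtain ⟨q, hq⟩ := hCn
      exact (norm_nonneg _).trans (mem_closedBall_zero_iff.1 (hR (D'.subset (hCS hq))))
    have hnorm : ‖((R + 1 : ℝ) : ℂ)‖ = R + 1 := by
      rw [Complex.norm_real, Real.norm_eq_abs, abs_of_pos (by linarith)]
    have hfar : ((R + 1 : ℝ) : ℂ) ∉ Ω' := fun h ↦ by
      have := mem_closedBall_zero_iff.1 (hR h)
      rw [hnorm] at this
      linarith
    obtain ⟨s', hs', hiff⟩ := hext _ hfar
    rw [hasLogOn_sub_iff hCc hconn disjoint_sdiff_left hs hs', ← hiff]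
    refine HasLogOn.of_norm_sub_lt (a := -((R + 1 : ℝ) : ℂ)) (by fun_prop) fun z hz ↦ ?_
    have := mem_closedBall_zero_iff.1 (hR (D'.subset (hCS hz)))
    rw [norm_neg, hnorm, sub_neg_eq_add, sub_add_cancel]
    linarith
  obtain ⟨a, haC, ha⟩ : ∃ a ∉ C, ¬ HasLogOn (fun z ↦ z - a) C := by
    by_contra! hcon
    have hCS' : MapsTo g C (sphere (c i) (r i)) := by
      rintro _ ⟨z, hz, rfl⟩
      rwa [H.left_inv (hsph hz)]
    obtain ⟨u, hu, hexp⟩ := IsLogCompact.hasLogOn ⟨hCc, hcon⟩ (g := fun w ↦ g w - c i)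
      ((H.cont'.mono hCS).sub continuousOn_const) fun w hw h ↦ by
        have h1 := hCS' hw
        rw [sub_eq_zero.1 h, mem_sphere, dist_self] at h1
        exact (D.pos i).ne h1
    have hw : Wind (fun z ↦ z - c i) (c i) (r i) 0 := by
      refine ⟨fun t ↦ u (f (circleMap (c i) (r i) t)), ?_, ?_, ?_⟩
      · have hm : ∀ t, circleMap (c i) (r i) t ∈ sphere (c i) (r i) :=
          fun t ↦ circleMap_mem_sphere _ (D.pos i).le t
        have h1 : ContinuousOn (fun z ↦ u (f z)) (sphere (c i) (r i)) :=
          hu.comp (H.cont.mono hsph) (mapsTo_image _ _)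
        exact h1.comp_continuous (continuous_circleMap _ _) hm
      · intro t
        have hm := circleMap_mem_sphere (c i) (D.pos i).le t
        rw [← hexp _ (mem_image_of_mem f hm)]
        beta_reduce
        rw [H.left_inv (hsph hm)]
      · intro t
        have : circleMap (c i) (r i) (t + 2 * Real.pi) = circleMap (c i) (r i) t :=
          periodic_circleMap _ _ t
        simp [this]
    exact zero_ne_one (hw.unique (Wind.id_sub_center (D.pos i)))
  have haΩ : a ∈ Ω' := by
    by_contra haΩ
    obtain ⟨s, hs, hiff⟩ := hext a haΩ
    exact ha (hiff.2 (hlogS s hs))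
  have haS : a ∉ S' := fun haS ↦ ha (hlogS a ⟨haS, haC⟩)
  obtain ⟨j, hj⟩ := D'.exists_mem_ball haΩ haS
  refine ⟨j, fun b hb ↦ ?_⟩
  by_contra hbC
  have hdisj : Disjoint (insert b (ball (c' j) (r' j))) C := by
    refine disjoint_left.2 fun z hz hzC ↦ ?_
    rcases hz with rfl | hz
    · exact hbC hzC
    · exact (D'.mem_iff.1 (hCS hzC)).2 j hz
  have hpre : IsPreconnected (insert b (ball (c' j) (r' j))) :=
    (convex_ball _ _).isPreconnected.subset_closure (subset_insert _ _) (insert_subset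
      (by rw [closure_ball _ (D'.pos j).ne']; exact sphere_subset_closedBall hb) subset_closure)
  refine ha ((hasLogOn_sub_iff hCc hpre hdisj (mem_insert_of_mem _ hj) (mem_insert _ _)).2
    (hlogS b ⟨D'.sphere_subset j hb, hbC⟩))

/-- Peripheral circles are mapped onto peripheral circles. -/
theorem exists_image_eq (H : SchottkyHomeo Ω S c r Ω' S' c' r' f g) (i : I) :
    ∃ j, f '' sphere (c i) (r i) = sphere (c' j) (r' j) := by
  obtain ⟨j, hj⟩ := H.exists_sphere_subset_image i
  obtain ⟨k, hk⟩ := H.symm.exists_sphere_subset_image j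
  have hki : sphere (c k) (r k) ⊆ sphere (c i) (r i) := by
    refine hk.trans ?_
    rintro _ ⟨w, hw, rfl⟩
    obtain ⟨z, hz, rfl⟩ := hj hw
    rwa [H.left_inv (H.data.sphere_subset i hz)]
  obtain ⟨z, hz⟩ := (NormedSpace.sphere_nonempty (x := c k)).2 (H.data.pos k).le
  have := H.data.eq_of_mem (sphere_subset_closedBall hz) (sphere_subset_closedBall (hki hz))
  subst this
  refine ⟨j, Subset.antisymm ?_ hj⟩
  rintro _ ⟨z, hz, rfl⟩
  obtain ⟨w, hw, rfl⟩ := hk hz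
  rwa [H.right_inv (H.data'.sphere_subset j hw)]

/-- The bijection between the peripheral circles. -/
theorem exists_index_map (H : SchottkyHomeo Ω S c r Ω' S' c' r' f g) :
    ∃ σ : I → I', Function.Bijective σ ∧
      ∀ i, f '' sphere (c i) (r i) = sphere (c' (σ i)) (r' (σ i)) := by
  choose σ hσ using H.exists_image_eq
  refine ⟨σ, ⟨fun i k hik ↦ ?_, fun j ↦ ?_⟩, hσ⟩
  · obtain ⟨z, hz⟩ := (NormedSpace.sphere_nonempty (x := c i)).2 (H.data.pos i).le
    have h1 : f z ∈ f '' sphere (c k) (r k) := by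
      rw [hσ k, ← hik, ← hσ i]
      exact mem_image_of_mem f hz
    obtain ⟨w, hw, hwz⟩ := h1
    have : w = z := by
      rw [← H.left_inv (H.data.sphere_subset k hw), hwz, H.left_inv (H.data.sphere_subset i hz)]
    subst this
    exact H.data.eq_of_mem (sphere_subset_closedBall hz) (sphere_subset_closedBall hw)
  · obtain ⟨i, hi⟩ := H.symm.exists_image_eq j
    refine ⟨i, ?_⟩
    obtain ⟨w, hw⟩ := (NormedSpace.sphere_nonempty (x := c' j)).2 (H.data'.pos j).le
    have h1 : g w ∈ sphere (c i) (r i) := hi ▸ mem_image_of_mem g hw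
    have h2 : f (g w) ∈ sphere (c' (σ i)) (r' (σ i)) := hσ i ▸ mem_image_of_mem f h1
    rw [H.right_inv (H.data'.sphere_subset j hw)] at h2
    exact H.data'.eq_of_mem (sphere_subset_closedBall h2) (sphere_subset_closedBall hw)

end SchottkyHomeo

/-- The radial extension of a map between circles to the discs they bound. -/
def coneExt (f : ℂ → ℂ) (c c' : ℂ) (r : ℝ) (z : ℂ) : ℂ :=
  c' + ((‖z - c‖ / r : ℝ) : ℂ) * (f (c + r * ((z - c) / ‖z - c‖)) - c')

section Cone

variable {f : ℂ → ℂ} {c c' z : ℂ} {r r' : ℝ}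

theorem cone_arg_mem (hr : 0 < r) (hz : z ≠ c) : c + r * ((z - c) / ‖z - c‖) ∈ sphere c r := by
  have h0 : ‖z - c‖ ≠ 0 := norm_ne_zero_iff.2 (sub_ne_zero.2 hz)
  rw [mem_sphere, dist_eq_norm, add_sub_cancel_left, norm_mul, norm_div, Complex.norm_real,
    Complex.norm_real, norm_norm, div_self h0, mul_one, Real.norm_eq_abs, abs_of_pos hr]

theorem coneExt_eq_of_mem_sphere (hr : 0 < r) (hz : z ∈ sphere c r) : coneExt f c c' r z = f z := by
  have h1 : ‖z - c‖ = r := by rw [← dist_eq_norm]; exact hz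
  have h2 : (r : ℂ) ≠ 0 := by exact_mod_cast hr.ne'
  rw [coneExt, h1, div_self hr.ne', mul_div_cancel₀ _ h2]
  simp

theorem norm_coneExt_sub (hr : 0 < r) (hf : MapsTo f (sphere c r) (sphere c' r')) :
    ‖coneExt f c c' r z - c'‖ = ‖z - c‖ / r * r' := by
  rw [coneExt, add_sub_cancel_left, norm_mul, Complex.norm_real, Real.norm_eq_abs,
    abs_of_nonneg (by positivity)]
  by_cases hz : z = c
  · simp [hz]
  · congr 1
    rw [← dist_eq_norm]
    exact hf (cone_arg_mem hr hz)

theorem continuous_coneExt (hr : 0 < r) (hf : MapsTo f (sphere c r) (sphere c' r'))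
    (hfc : ContinuousOn f (sphere c r)) : Continuous (coneExt f c c' r) := by
  rw [continuous_iff_continuousAt]
  intro z
  by_cases hz : z = c
  · subst hz
    have h0 : coneExt f z c' r z = c' := by simp [coneExt]
    rw [ContinuousAt, h0, tendsto_iff_norm_sub_tendsto_zero]
    simp only [norm_coneExt_sub hr hf]
    have : Continuous fun w : ℂ ↦ ‖w - z‖ / r * r' := by fun_prop
    simpa using this.tendsto z
  · have h0 : (‖z - c‖ : ℂ) ≠ 0 := by exact_mod_cast norm_ne_zero_iff.2 (sub_ne_zero.2 hz)
    have h1 : ContinuousAt (fun w : ℂ ↦ c + r * ((w - c) / ‖w - c‖)) z :=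
      continuousAt_const.add (continuousAt_const.mul (ContinuousAt.div (by fun_prop)
        (by fun_prop) h0))
    have h2 : ContinuousAt (fun w : ℂ ↦ f (c + r * ((w - c) / ‖w - c‖))) z := by
      refine (hfc _ (cone_arg_mem hr hz)).tendsto.comp (tendsto_nhdsWithin_iff.2 ⟨h1, ?_⟩)
      filter_upwards [isOpen_ne.mem_nhds hz] with w hw using cone_arg_mem hr hw
    exact continuousAt_const.add ((by fun_prop : ContinuousAt (fun w : ℂ ↦
      ((‖w - c‖ / r : ℝ) : ℂ)) z).mul (h2.sub continuousAt_const))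

end Cone

namespace SchottkyHomeo

variable {I : Type} {Ω S : Set ℂ} {c : I → ℂ} {r : I → ℝ} {Ω' S' : Set ℂ}
    {c' : I → ℂ} {r' : I → ℝ} {f g : ℂ → ℂ}

/-- A homeomorphism between relative Schottky sets extends continuously to the discs. -/
theorem exists_extension (H : SchottkyHomeo Ω S c r Ω' S' c' r' f g)
    (hσ : ∀ i, f '' sphere (c i) (r i) = sphere (c' i) (r' i)) :
    ∃ F : ℂ → ℂ, ContinuousOn F Ω ∧ EqOn F f S ∧
      ∀ i, MapsTo F (ball (c i) (r i)) (ball (c' i) (r' i)) := by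
  classical
  have D := H.data
  have D' := H.data'
  have hm : ∀ i, MapsTo f (sphere (c i) (r i)) (sphere (c' i) (r' i)) := fun i ↦
    (hσ i) ▸ mapsTo_image f _
  set F : ℂ → ℂ := fun z ↦ if h : ∃ i, z ∈ ball (c i) (r i) then
    coneExt f (c h.choose) (c' h.choose) (r h.choose) z else f z with hF
  have hFS : EqOn F f S := fun z hz ↦ by
    have h : ¬ ∃ i, z ∈ ball (c i) (r i) := not_exists.2 (D.mem_iff.1 hz).2
    simp only [hF, dif_neg h]
  have hFb : ∀ i, EqOn F (coneExt f (c i) (c' i) (r i)) (closedBall (c i) (r i)) := by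
    intro i z hz
    by_cases hzb : z ∈ ball (c i) (r i)
    · have h : ∃ i, z ∈ ball (c i) (r i) := ⟨i, hzb⟩
      have hi : h.choose = i := D.eq_of_mem (ball_subset_closedBall h.choose_spec) hz
      simp only [hF, dif_pos h]
      rw [hi]
    · have hzs : z ∈ sphere (c i) (r i) := by
        rw [← closedBall_sdiff_ball]; exact ⟨hz, hzb⟩
      rw [hFS (D.sphere_subset i hzs), coneExt_eq_of_mem_sphere (D.pos i) hzs]
  have hmaps : ∀ i, MapsTo F (ball (c i) (r i)) (ball (c' i) (r' i)) := by
    intro i z hz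
    rw [mem_ball, dist_eq_norm, hFb i (ball_subset_closedBall hz),
      norm_coneExt_sub (D.pos i) (hm i)]
    have h1 : ‖z - c i‖ / r i < 1 := by
      rw [div_lt_one (D.pos i), ← dist_eq_norm]; exact hz
    nlinarith [D'.pos i]
  have hcball : ∀ i, ContinuousOn F (closedBall (c i) (r i)) := fun i ↦
    (continuous_coneExt (D.pos i) (hm i) (H.cont.mono (D.sphere_subset i))).continuousOn.congr
      (hFb i)
  refine ⟨F, fun p hp ↦ ?_, hFS, hmaps⟩
  by_cases hpS : p ∈ S
  · rw [ContinuousWithinAt, Metric.tendsto_nhds]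
    intro ε hε
    have hfin := D'.finite_large (show 0 < ε / 8 by positivity)
    have hJ : ∀ᶠ z in 𝓝 p, ∀ i ∈ {i | ε / 8 ≤ r' i}, z ∈ closedBall (c i) (r i) →
        dist (F z) (F p) < ε := by
      rw [Filter.eventually_all_finite hfin]
      intro i _
      by_cases hpi : p ∈ closedBall (c i) (r i)
      · exact eventually_nhdsWithin_iff.1 (Metric.tendsto_nhds.1 (hcball i p hpi) ε hε)
      · filter_upwards [isClosed_closedBall.isOpen_compl.mem_nhds hpi] with z hz hz'
        exact (hz hz').elim
    obtain ⟨δ, hδ, hS⟩ := Metric.mem_nhdsWithin_iff.1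
      (Metric.tendsto_nhds.1 (H.cont p hpS) (ε / 2) (half_pos hε))
    filter_upwards [mem_nhdsWithin_of_mem_nhds hJ, self_mem_nhdsWithin,
      mem_nhdsWithin_of_mem_nhds (ball_mem_nhds p hδ)] with z hzJ hzΩ hzδ
    by_cases hzS : z ∈ S
    · rw [hFS hzS, hFS hpS]
      exact (show dist (f z) (f p) < ε / 2 from hS ⟨hzδ, hzS⟩).trans (half_lt_self hε)
    obtain ⟨i, hi⟩ := D.exists_mem_ball hzΩ hzS
    by_cases hbig : ε / 8 ≤ r' i
    · exact hzJ i hbig (ball_subset_closedBall hi)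
    obtain ⟨w, hw, hws⟩ := exists_mem_segment_sphere (D.pos i) hi ((D.mem_iff.1 hpS).2 i)
    have hwδ : w ∈ ball p δ := (convex_ball p δ).segment_subset hzδ (mem_ball_self hδ) hw
    have h1 : dist (f w) (f p) < ε / 2 := hS ⟨hwδ, D.sphere_subset i hws⟩
    have h2 : dist (F z) (c' i) < r' i := hmaps i hi
    have h3 : dist (f w) (c' i) = r' i := hm i hws
    rw [hFS hpS]
    have h4 := dist_triangle4 (F z) (c' i) (f w) (f p)
    rw [dist_comm (c' i)] at h4
    linarith
  · obtain ⟨i, hi⟩ := D.exists_mem_ball hp hpS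
    exact ((hcball i).continuousAt (mem_of_superset (isOpen_ball.mem_nhds hi)
      ball_subset_closedBall)).continuousWithinAt

end SchottkyHomeo

theorem ofReal_sq_le_volume_ball (a : ℂ) {ρ : ℝ} (hρ : 0 ≤ ρ) :
    ENNReal.ofReal (ρ ^ 2) ≤ volume (ball a ρ) := by
  rw [Complex.volume_ball, ENNReal.ofReal_pow hρ]
  refine le_mul_of_one_le_right' ?_
  exact_mod_cast (by linarith [Real.pi_gt_three] : (1 : ℝ) ≤ Real.pi)

theorem volume_closedBall_le (a : ℂ) {ρ : ℝ} (hρ : 0 ≤ ρ) :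
    volume (closedBall a ρ) ≤ ENNReal.ofReal (ρ ^ 2 * 4) := by
  rw [Complex.volume_closedBall, ENNReal.ofReal_mul (by positivity), ENNReal.ofReal_pow hρ]
  gcongr
  rw [ENNReal.le_ofReal_iff_toReal_le (by simp) (by norm_num)]
  simpa using Real.pi_le_four

theorem tsum_sq_le_volume {ι : Type} [Countable ι] {a : ι → ℂ} {ρ : ι → ℝ} {V : Set ℂ}
    (hρ : ∀ i, 0 ≤ ρ i) (hd : Pairwise fun i j ↦ Disjoint (ball (a i) (ρ i)) (ball (a j) (ρ j)))
    (hV : ∀ i, ball (a i) (ρ i) ⊆ V) :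
    ∑' i, ENNReal.ofReal (ρ i ^ 2) ≤ volume V := calc
  ∑' i, ENNReal.ofReal (ρ i ^ 2) ≤ ∑' i, volume (ball (a i) (ρ i)) :=
    ENNReal.tsum_le_tsum fun i ↦ ofReal_sq_le_volume_ball _ (hρ i)
  _ = volume (⋃ i, ball (a i) (ρ i)) := (measure_iUnion hd fun _ ↦ measurableSet_ball).symm
  _ ≤ volume V := measure_mono (iUnion_subset hV)

/-- A covering of a compact set by discs adapted to a weakly quasisymmetric map. -/
theorem exists_cover_of_weakly_quasisymmetric {K U V : Set ℂ} {f : ℂ → ℂ} {H : ℝ}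
    (hK : IsCompact K) (hf : ContinuousOn f K) (hH : 1 ≤ H)
    (hqs : ∀ p ∈ K, ∀ q ∈ K, ∀ s ∈ K, dist p q ≤ 5 * dist p s →
      dist (f p) (f q) ≤ H * dist (f p) (f s))
    (hU : IsOpen U) (hKU : K ⊆ U) (hV : IsOpen V) (hKV : MapsTo f K V) :
    ∃ (T : Set ℂ) (ρ d : ℂ → ℝ), T.Countable ∧ T ⊆ K ∧ (∀ t ∈ T, 0 < ρ t ∧ 0 ≤ d t) ∧
      (∀ x ∈ K, ∃ t ∈ T, x ∈ closedBall t (5 * ρ t)) ∧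
      (∀ t ∈ T, ∀ x ∈ K, x ∈ closedBall t (5 * ρ t) → dist (f x) (f t) ≤ d t) ∧
      ∑' t : T, ENNReal.ofReal (ρ t ^ 2) ≤ volume U ∧
      ∑' t : T, ENNReal.ofReal (d t ^ 2) ≤ ENNReal.ofReal (4 * H ^ 2) * volume V := by
  have key : ∀ x ∈ K, ∃ ρ d : ℝ, 0 < ρ ∧ ρ ≤ 1 ∧ closedBall x ρ ⊆ U ∧ 0 ≤ d ∧
      ball (f x) (d / (2 * H)) ⊆ V ∧ (∀ y ∈ K, y ∈ closedBall x (5 * ρ) → dist (f y) (f x) ≤ d) ∧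
      ∃ y ∈ K, dist x y ≤ 5 * ρ ∧ dist (f x) (f y) = d := by
    intro x hx
    obtain ⟨ε, hε, hεU⟩ := nhds_basis_closedBall.mem_iff.1 (hU.mem_nhds (hKU hx))
    obtain ⟨γ, hγ, hγV⟩ := Metric.isOpen_iff.1 hV _ (hKV hx)
    obtain ⟨δ, hδ, hδf⟩ := Metric.continuousOn_iff.1 hf x hx γ hγ
    obtain ⟨ρ, hρ, hρ'⟩ := exists_between (lt_min (lt_min hε one_pos)
      (show 0 < δ / 5 by positivity))
    simp only [lt_min_iff] at hρ'
    have hc : IsCompact (K ∩ closedBall x (5 * ρ)) := hK.inter_right isClosed_closedBall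
    obtain ⟨y, hy, hmax⟩ := hc.exists_isMaxOn ⟨x, hx, mem_closedBall_self (by positivity)⟩
      (f := fun y ↦ dist (f y) (f x))
      (continuous_id.dist continuous_const |>.comp_continuousOn (hf.mono inter_subset_left))
    refine ⟨ρ, dist (f y) (f x), hρ, hρ'.1.2.le,
      (closedBall_subset_closedBall hρ'.1.1.le).trans hεU,
      dist_nonneg, (ball_subset_ball ?_).trans hγV, fun z hz hzx ↦ hmax ⟨hz, hzx⟩, y, hy.1, ?_,
      dist_comm _ _⟩
    · have h1 : dist (f y) (f x) < γ := hδf y hy.1 ((mem_closedBall.1 hy.2).trans_lt (by linarith))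
      exact (div_le_self dist_nonneg (by linarith)).trans h1.le
    · rw [dist_comm]; exact hy.2
  choose! ρ d hρ hρ1 hρU hd hdV hdle y hyK hyρ hyd using key
  obtain ⟨T, hTK, hTd, hTc⟩ := Vitali.exists_disjoint_subfamily_covering_enlargement_closedBall
    K id ρ 1 hρ1 5 (by norm_num)
  have hTcount : T.Countable := hTd.countable_of_nonempty_interior fun t ht ↦ by
    refine ⟨t, ball_subset_interior_closedBall (mem_ball_self (hρ t (hTK ht)))⟩
  have : Countable T := hTcount.to_subtype
  refine ⟨T, ρ, d, hTcount, hTK, fun t ht ↦ ⟨hρ t (hTK ht), hd t (hTK ht)⟩, fun x hx ↦ ?_,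
    fun t ht ↦ hdle t (hTK ht), ?_, ?_⟩
  · obtain ⟨b, hb, hsub⟩ := hTc x hx
    exact ⟨b, hb, hsub (mem_closedBall_self (hρ x hx).le)⟩
  · refine tsum_sq_le_volume (a := fun t : T ↦ (t : ℂ)) (fun t ↦ (hρ t (hTK t.2)).le) ?_
      fun t ↦ ball_subset_closedBall.trans (hρU t (hTK t.2))
    intro s t hst
    exact (hTd s.2 t.2 (Subtype.coe_injective.ne hst)).mono ball_subset_closedBall
      ball_subset_closedBall
  · have hdist : ∀ s ∈ T, ∀ t ∈ T, s ≠ t → d s ≤ H * dist (f s) (f t) := fun s hs t ht hst ↦ by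
      rw [← hyd s (hTK hs)]
      refine hqs s (hTK hs) _ (hyK s (hTK hs)) t (hTK ht) ((hyρ s (hTK hs)).trans ?_)
      have h1 : t ∉ closedBall s (ρ s) := fun h ↦
        (hTd hs ht hst).le_bot ⟨h, mem_closedBall_self (hρ t (hTK ht)).le⟩
      rw [mem_closedBall, not_le, dist_comm] at h1
      linarith
    have h2 := tsum_sq_le_volume (a := fun t : T ↦ f t) (ρ := fun t : T ↦ d t / (2 * H)) (V := V)
      (fun t ↦ div_nonneg (hd t (hTK t.2)) (by linarith)) ?_ fun t ↦ hdV t (hTK t.2)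
    · calc ∑' t : T, ENNReal.ofReal (d t ^ 2)
          = ∑' t : T, ENNReal.ofReal (4 * H ^ 2) * ENNReal.ofReal ((d t / (2 * H)) ^ 2) := by
            refine tsum_congr fun t ↦ ?_
            rw [← ENNReal.ofReal_mul (by positivity)]
            congr 1
            field_simp
            ring
        _ = ENNReal.ofReal (4 * H ^ 2) * ∑' t : T, ENNReal.ofReal ((d t / (2 * H)) ^ 2) :=
            ENNReal.tsum_mul_left
        _ ≤ _ := by gcongr
    · intro s t hst
      have hst' : (s : ℂ) ≠ t := Subtype.coe_injective.ne hst
      refine ball_disjoint_ball ?_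
      have h3 := hdist s s.2 t t.2 hst'
      have h4 := hdist t t.2 s s.2 hst'.symm
      rw [dist_comm (f t)] at h4
      rw [← add_div, div_le_iff₀ (by linarith)]
      linarith

/-- A length-area inequality on a rectangle. -/
theorem length_area {κ : Type} [Countable κ] {F : ℂ → ℂ} {x₀ x₁ y₀ y₁ l : ℝ} (hx : x₀ ≤ x₁)
    (hl0 : 0 ≤ l) (hF : ContinuousOn F (Icc x₀ x₁ ×ℂ Icc y₀ y₁)) {A : κ → Set ℂ} {a : κ → ℂ}
    {ρ e : κ → ℝ} (hA : ∀ k, A k ⊆ closedBall (a k) (ρ k))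
    (hcov : Icc x₀ x₁ ×ℂ Icc y₀ y₁ ⊆ ⋃ k, A k)
    (hosc : ∀ k, ∀ z ∈ A k, ∀ w ∈ A k, z ∈ Icc x₀ x₁ ×ℂ Icc y₀ y₁ → w ∈ Icc x₀ x₁ ×ℂ Icc y₀ y₁ →
      dist (F z) (F w) ≤ e k)
    (hl : ∀ y ∈ Icc y₀ y₁, l ≤ dist (F (x₁ + y * Complex.I)) (F (x₀ + y * Complex.I))) :
    ENNReal.ofReal ((y₁ - y₀) * l) ≤ ∑' k, ENNReal.ofReal (e k) * ENNReal.ofReal (2 * ρ k) := by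
  set E : κ → ℝ → ℝ≥0∞ := fun k ↦ (Icc ((a k).im - ρ k) ((a k).im + ρ k)).indicator
    fun _ ↦ ENNReal.ofReal (e k) with hE
  have hline : ∀ y ∈ Icc y₀ y₁, ENNReal.ofReal l ≤ ∑' k, E k y := by
    intro y hy
    set ϕ : ℝ → ℝ := fun x ↦ dist (F (x + y * Complex.I)) (F (x₀ + y * Complex.I)) with hϕ
    have hmem : ∀ x ∈ Icc x₀ x₁, (x + y * Complex.I : ℂ) ∈ Icc x₀ x₁ ×ℂ Icc y₀ y₁ := fun x hx ↦ by
      simpa [Complex.mem_reProdIm] using ⟨hx, hy⟩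
    have hϕc : ContinuousOn ϕ (Icc x₀ x₁) :=
      (continuous_id.dist continuous_const).comp_continuousOn (hF.comp (by fun_prop) hmem)
    have hsub : Icc 0 l ⊆ ⋃ k, ϕ '' {x | x ∈ Icc x₀ x₁ ∧ (x + y * Complex.I : ℂ) ∈ A k} := by
      intro v hv
      obtain ⟨x, hx', rfl⟩ := intermediate_value_Icc hx hϕc
        (show v ∈ Icc (ϕ x₀) (ϕ x₁) from ⟨by simpa [hϕ] using hv.1, hv.2.trans (hl y hy)⟩)
      obtain ⟨k, hk⟩ := mem_iUnion.1 (hcov (hmem x hx'))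
      exact mem_iUnion.2 ⟨k, x, ⟨hx', hk⟩, rfl⟩
    calc ENNReal.ofReal l = volume (Icc 0 l) := by rw [Real.volume_Icc, sub_zero]
      _ ≤ _ := measure_mono hsub
      _ ≤ _ := measure_iUnion_le _
      _ ≤ _ := ENNReal.tsum_le_tsum fun k ↦ ?_
    by_cases hk : y ∈ Icc ((a k).im - ρ k) ((a k).im + ρ k)
    · simp only [hE, indicator_of_mem hk]
      refine (Real.volume_le_diam _).trans (Metric.ediam_le ?_)
      rintro _ ⟨x, ⟨hx, hxA⟩, rfl⟩ _ ⟨x', ⟨hx', hxA'⟩, rfl⟩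
      rw [edist_dist]
      refine ENNReal.ofReal_le_ofReal ((dist_dist_dist_le_left _ _ _).trans ?_)
      exact hosc k _ hxA _ hxA' (hmem x hx) (hmem x' hx')
    · rw [show {x : ℝ | x ∈ Icc x₀ x₁ ∧ (x + y * Complex.I : ℂ) ∈ A k} = ∅ from ?_]
      · simp
      refine eq_empty_of_forall_notMem fun x hx ↦ hk ?_
      have h1 := (Complex.abs_im_le_norm _).trans (mem_closedBall_iff_norm.1 (hA k hx.2))
      simp only [Complex.sub_im, Complex.add_im, Complex.ofReal_im, Complex.mul_im,
        Complex.ofReal_re, Complex.I_im, Complex.I_re, mul_one, mul_zero, add_zero, zero_add] at h1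
      rw [abs_le] at h1
      constructor <;> linarith [h1.1, h1.2]
  calc ENNReal.ofReal ((y₁ - y₀) * l) = ∫⁻ _ in Icc y₀ y₁, ENNReal.ofReal l := by
        rw [setLIntegral_const, Real.volume_Icc, ENNReal.ofReal_mul' hl0, mul_comm]
    _ ≤ ∫⁻ y in Icc y₀ y₁, ∑' k, E k y := setLIntegral_mono' measurableSet_Icc hline
    _ ≤ ∫⁻ y, ∑' k, E k y := setLIntegral_le_lintegral _ _
    _ = ∑' k, ∫⁻ y, E k y := lintegral_tsum fun k ↦
        (measurable_const.indicator measurableSet_Icc).aemeasurable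
    _ = _ := tsum_congr fun k ↦ by
        rw [hE, lintegral_indicator measurableSet_Icc, setLIntegral_const, Real.volume_Icc]
        congr 2
        ring

/-- At some point of a set of positive measure, the complement of the set has density zero. -/
theorem exists_density_point {X : Set ℂ} (hX : MeasurableSet X) (h0 : volume X ≠ 0) :
    ∃ w ∈ X, ∀ ε > 0, ∀ᶠ ρ in 𝓝[>] (0 : ℝ),
      volume (closedBall w ρ \ X) ≤ ENNReal.ofReal (ε * ρ ^ 2) := by
  have h1 := Besicovitch.ae_tendsto_measure_inter_div_of_measurableSet volume hX.compl
  obtain ⟨w, hwX, hw⟩ : ∃ w ∈ X, Tendsto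
      (fun ρ ↦ volume (Xᶜ ∩ closedBall w ρ) / volume (closedBall w ρ)) (𝓝[>] 0)
        (𝓝 (Xᶜ.indicator 1 w)) := by
    by_contra! hcon
    exact h0 (measure_mono_null hcon (ae_iff.1 h1))
  rw [indicator_of_notMem (by simpa using hwX)] at hw
  refine ⟨w, hwX, fun ε hε ↦ ?_⟩
  filter_upwards [hw.eventually_lt_const (show (0 : ℝ≥0∞) < ENNReal.ofReal (ε / 4) by simpa),
    self_mem_nhdsWithin] with ρ hρ hρ0
  have hpos : 0 < ρ := hρ0
  have hv := volume_closedBall_le w hpos.le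
  rw [sdiff_eq, inter_comm]
  have h2 := ENNReal.div_le_iff_le_mul (Or.inl (measure_closedBall_pos volume w hpos).ne')
    (Or.inl (measure_closedBall_lt_top (μ := volume)).ne) |>.1 hρ.le
  calc _ ≤ ENNReal.ofReal (ε / 4) * volume (closedBall w ρ) := h2
    _ ≤ ENNReal.ofReal (ε / 4) * ENNReal.ofReal (ρ ^ 2 * 4) := by gcongr
    _ = _ := by rw [← ENNReal.ofReal_mul (by positivity)]; congr 1; ring

namespace SchottkyData

variable {I : Type} {Ω S : Set ℂ} {c : I → ℂ} {r : I → ℝ}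

theorem countable (h : SchottkyData Ω S c r) : Countable I := by
  refine countable_univ_iff.1 ((iUnion_eq_univ_iff.2 fun i ↦ ?_) ▸
    countable_iUnion fun n : ℕ ↦ (h.finite_large (Nat.one_div_pos_of_nat (n := n))).countable)
  obtain ⟨n, hn⟩ := exists_nat_one_div_lt (h.pos i)
  exact ⟨n, hn.le⟩

theorem isCompact_inter (h : SchottkyData Ω S c r) {p : ℂ} {R : ℝ} (hsub : closedBall p R ⊆ Ω) :
    IsCompact (S ∩ closedBall p R) := by
  have h1 : S ∩ closedBall p R = closedBall p R \ ⋃ i, ball (c i) (r i) := by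
    rw [h.eq]
    ext z
    exact ⟨fun hz ↦ ⟨hz.2, hz.1.2⟩, fun hz ↦ ⟨⟨hsub hz.1, hz.2⟩, hz.1⟩⟩
  rw [h1]
  exact (isCompact_closedBall p R).diff (isOpen_iUnion fun i ↦ isOpen_ball)

theorem measurableSet (h : SchottkyData Ω S c r) : MeasurableSet S := by
  rw [h.eq]
  exact h.isOpen.measurableSet.diff (isOpen_iUnion fun i ↦ isOpen_ball).measurableSet

theorem isSigmaCompact (h : SchottkyData Ω S c r) : IsSigmaCompact S := by
  have h1 : IsLocallyClosed S := by
    rw [h.eq, sdiff_eq]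
    exact h.isOpen.isLocallyClosed.inter
      (isOpen_iUnion fun i ↦ isOpen_ball).isClosed_compl.isLocallyClosed
  have := h1.locallyCompactSpace
  rw [isSigmaCompact_iff_sigmaCompactSpace]
  infer_instance

end SchottkyData

theorem exists_mem_sphere_dist_eq {c x : ℂ} {r l : ℝ} (hx : x ∈ sphere c r)
    (hl : 0 ≤ l) (hl' : l ≤ 2 * r) : ∃ y ∈ sphere c r, dist x y = l := by
  have hx' : dist x c = r := hx
  obtain ⟨y, hy, h⟩ := (isPreconnected_sphere_complex c r).intermediate_value
    (f := fun y ↦ dist x y)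
    hx (b := 2 * c - x) (by
      rw [mem_sphere, dist_comm, dist_eq_norm, ← hx', dist_eq_norm]
      congr 1
      ring)
    (by fun_prop)
    (show l ∈ Icc _ _ from ⟨by simpa using hl, by
      rw [dist_eq_norm, show x - (2 * c - x) = 2 * (x - c) by ring, norm_mul, ← dist_eq_norm, hx']
      simpa using hl'⟩)
  exact ⟨y, hy, h⟩

/-- Every point of a sphere is near the center of a smaller ball inside the sphere. -/
theorem exists_ball_subset_ball {c x : ℂ} {r τ : ℝ} (hx : x ∈ sphere c r) (hτ : 0 < τ)
    (hτr : τ ≤ r) : ∃ m, ball m τ ⊆ ball c r ∩ closedBall x (2 * τ) := by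
  have hr : 0 < r := hτ.trans_le hτr
  have hx' : ‖x - c‖ = r := by rwa [← dist_eq_norm]
  refine ⟨x + ((τ / r : ℝ) : ℂ) * (c - x), subset_inter (ball_subset_ball' ?_)
    (ball_subset_closedBall.trans (closedBall_subset_closedBall' ?_))⟩
  · rw [dist_eq_norm, show x + ((τ / r : ℝ) : ℂ) * (c - x) - c = ((1 - τ / r : ℝ) : ℂ) * (x - c) by
      push_cast; ring, norm_mul, hx', Complex.norm_real, Real.norm_of_nonneg
      (sub_nonneg.2 ((div_le_one hr).2 hτr))]
    field_simp
    linarith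
  · rw [dist_eq_norm, add_sub_cancel_left, norm_mul, norm_sub_rev, hx', Complex.norm_real,
      Real.norm_of_nonneg (by positivity)]
    field_simp
    linarith

theorem tsum_ofReal_combination_le {ι : Type} {x y z : ι → ℝ} {α β X Y : ℝ} (hα : 0 ≤ α)
    (hβ : 0 ≤ β) (hX0 : 0 ≤ X) (hY0 : 0 ≤ Y)
    (hX : ∑' i, ENNReal.ofReal (x i ^ 2) ≤ ENNReal.ofReal X)
    (hY : ∑' i, ENNReal.ofReal (y i ^ 2) ≤ ENNReal.ofReal Y)
    (hz : ∀ i, z i ≤ α * x i ^ 2 + β * y i ^ 2) :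
    ∑' i, ENNReal.ofReal (z i) ≤ ENNReal.ofReal (α * X + β * Y) := calc
  _ ≤ ∑' i, (ENNReal.ofReal α * ENNReal.ofReal (x i ^ 2) +
      ENNReal.ofReal β * ENNReal.ofReal (y i ^ 2)) := ENNReal.tsum_le_tsum fun i ↦ by
        rw [← ENNReal.ofReal_mul hα, ← ENNReal.ofReal_mul hβ,
          ← ENNReal.ofReal_add (by positivity) (by positivity)]
        exact ENNReal.ofReal_le_ofReal (hz i)
  _ ≤ ENNReal.ofReal α * ENNReal.ofReal X + ENNReal.ofReal β * ENNReal.ofReal Y := by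
        rw [ENNReal.tsum_add, ENNReal.tsum_mul_left, ENNReal.tsum_mul_left]
        gcongr
  _ = _ := by
        rw [← ENNReal.ofReal_mul hα, ← ENNReal.ofReal_mul hβ,
          ← ENNReal.ofReal_add (by positivity) (by positivity)]

/-- A scale `s` at a point `p` at which `f` is controlled and at whose image the complement of
`S'` has small density. -/
structure ScaleBound (S S' : Set ℂ) (f : ℂ → ℂ) (p : ℂ) (s t C H : ℝ) : Prop where
  s_pos : 0 < s
  t_pos : 0 < t
  one_le_C : 1 ≤ C
  one_le_H : 1 ≤ H
  dist_le : ∀ x ∈ S ∩ closedBall p (16 * s), dist (f x) (f p) ≤ t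
  le_dist : ∀ x ∈ S ∩ closedBall p (16 * s), ∀ y ∈ S ∩ closedBall p (16 * s),
    s / 4 ≤ dist x y → t ≤ C * dist (f x) (f y)
  weak : ∀ x ∈ S ∩ closedBall p (16 * s), ∀ y ∈ S ∩ closedBall p (16 * s),
    ∀ z ∈ S ∩ closedBall p (16 * s), dist x y ≤ 5 * dist x z →
      dist (f x) (f y) ≤ H * dist (f x) (f z)
  density : volume (closedBall (f p) (2 * t) \ S') ≤ ENNReal.ofReal (t ^ 2 / (65536 * C ^ 2))

namespace SchottkyHomeo

variable {I : Type} {Ω S : Set ℂ} {c : I → ℂ} {r : I → ℝ} {Ω' S' : Set ℂ}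
    {c' : I → ℂ} {r' : I → ℝ} {f g : ℂ → ℂ} {p : ℂ} {s t C K : ℝ}

theorem radius_lt_of_scaleBound (H : SchottkyHomeo Ω S c r Ω' S' c' r' f g)
    (hσ : ∀ i, f '' sphere (c i) (r i) = sphere (c' i) (r' i)) (hp : p ∈ S)
    (B : ScaleBound S S' f p s t C K) {i : I}
    (hi : (closedBall (c i) (r i) ∩ closedBall p (8 * s)).Nonempty) : r i < s / 8 := by
  by_contra! hri
  have hs := B.s_pos
  have ht := B.t_pos
  have hC := B.one_le_C
  obtain ⟨y, hy, hyp⟩ := hi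
  obtain ⟨x, hx, hxp⟩ : ∃ x ∈ sphere (c i) (r i), x ∈ closedBall p (8 * s) := by
    by_cases hyb : y ∈ ball (c i) (r i)
    · obtain ⟨w, hw, hws⟩ := exists_mem_segment_sphere (H.data.pos i) hyb
        ((H.data.mem_iff.1 hp).2 i)
      exact ⟨w, hws, (convex_closedBall p (8 * s)).segment_subset hyp
        (mem_closedBall_self (by linarith)) hw⟩
    · exact ⟨y, le_antisymm hy (not_lt.1 hyb), hyp⟩
  obtain ⟨x', hx', hxx'⟩ := exists_mem_sphere_dist_eq hx (show 0 ≤ s / 4 by positivity)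
    (by linarith)
  have hx'p : x' ∈ closedBall p (16 * s) := by
    rw [mem_closedBall] at hxp ⊢
    linarith [dist_triangle x' x p, dist_comm x x']
  have hxS : x ∈ S ∩ closedBall p (16 * s) :=
    ⟨H.data.sphere_subset i hx, closedBall_subset_closedBall (by linarith) hxp⟩
  have h1 := B.le_dist x hxS x' ⟨H.data.sphere_subset i hx', hx'p⟩ hxx'.ge
  have hfx : f x ∈ sphere (c' i) (r' i) := hσ i ▸ mem_image_of_mem f hx
  have hfx' : f x' ∈ sphere (c' i) (r' i) := hσ i ▸ mem_image_of_mem f hx'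
  have h2 : dist (f x) (f x') ≤ 2 * r' i := by
    have h3 := dist_triangle_right (f x) (f x') (c' i)
    rw [mem_sphere.1 hfx, mem_sphere.1 hfx'] at h3
    linarith
  have hτ : t / (2 * C) ≤ r' i := by
    rw [div_le_iff₀ (by positivity)]
    nlinarith [mul_le_mul_of_nonneg_left h2 (zero_le_one.trans hC)]
  obtain ⟨m, hm⟩ := exists_ball_subset_ball hfx (show 0 < t / (2 * C) by positivity) hτ
  have hm' : ball m (t / (2 * C)) ⊆ closedBall (f p) (2 * t) \ S' := fun z hz ↦ by
    refine ⟨?_, fun hzS ↦ (H.data'.mem_iff.1 hzS).2 i (hm hz).1⟩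
    have h3 := mem_closedBall.1 (hm hz).2
    have h4 := B.dist_le x hxS
    rw [mem_closedBall]
    have h5 : 2 * (t / (2 * C)) ≤ t := by
      rw [show 2 * (t / (2 * C)) = t / C by field_simp]
      exact div_le_self ht.le hC
    linarith [dist_triangle z (f x) (f p)]
  have h6 := (ofReal_sq_le_volume_ball m (by positivity)).trans
    ((measure_mono hm').trans B.density)
  rw [ENNReal.ofReal_le_ofReal_iff (by positivity), div_pow,
    div_le_div_iff_of_pos_left (by positivity) (by positivity) (by positivity)] at h6
  nlinarith

theorem closedBall_subset_of_scaleBound (H : SchottkyHomeo Ω S c r Ω' S' c' r' f g)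
    (hσ : ∀ i, f '' sphere (c i) (r i) = sphere (c' i) (r' i)) (hp : p ∈ S)
    (B : ScaleBound S S' f p s t C K) {i : I}
    (hi : (closedBall (c i) (r i) ∩ closedBall p (8 * s)).Nonempty) :
    closedBall (c i) (r i) ⊆ ball p (9 * s) ∧
      ball (c' i) (r' i) ⊆ closedBall (f p) (2 * t) \ S' := by
  have hs := B.s_pos
  have hri := H.radius_lt_of_scaleBound hσ hp B hi
  obtain ⟨y, hy, hyp⟩ := hi
  have h1 : closedBall (c i) (r i) ⊆ ball p (9 * s) :=
    SchottkyData.closedBall_subset_of_small hy hyp (by linarith)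
  refine ⟨h1, fun z hz ↦ ⟨?_, fun hzS ↦ (H.data'.mem_iff.1 hzS).2 i hz⟩⟩
  have h2 : sphere (c' i) (r' i) ⊆ closedBall (f p) (2 * t) := by
    rw [← hσ i]
    rintro _ ⟨x, hx, rfl⟩
    refine closedBall_subset_closedBall (by linarith [B.t_pos]) (B.dist_le x
      ⟨H.data.sphere_subset i hx, ?_⟩)
    exact closedBall_subset_closedBall (by linarith)
      (ball_subset_closedBall (h1 (sphere_subset_closedBall hx)))
  have h3 := convexHull_min h2 (convex_closedBall _ _)
  rw [convexHull_sphere_eq_closedBall _ (H.data'.pos i).le] at h3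
  exact h3 (ball_subset_closedBall hz)

theorem scaleBound_false (H : SchottkyHomeo Ω S c r Ω' S' c' r' f g)
    (hσ : ∀ i, f '' sphere (c i) (r i) = sphere (c' i) (r' i)) (h0 : volume S = 0) (hp : p ∈ S)
    (hsub : closedBall p (16 * s) ⊆ Ω) (B : ScaleBound S S' f p s t C K) : False := by
  obtain ⟨F, hFc, hFS, hFb⟩ := H.exists_extension hσ
  have D := H.data
  have D' := H.data'
  have hs := B.s_pos
  have ht := B.t_pos
  have hC := B.one_le_C
  have hK := B.one_le_H
  have : Countable I := D.countable
  set J : Set I := {i | (closedBall (c i) (r i) ∩ closedBall p (8 * s)).Nonempty} with hJ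
  have hFcl : ∀ i, MapsTo F (closedBall (c i) (r i)) (closedBall (c' i) (r' i)) := fun i z hz ↦ by
    by_cases hzb : z ∈ ball (c i) (r i)
    · exact ball_subset_closedBall (hFb i hzb)
    · have hzs : z ∈ sphere (c i) (r i) := le_antisymm hz (not_lt.1 hzb)
      rw [hFS (D.sphere_subset i hzs)]
      exact sphere_subset_closedBall (hσ i ▸ mem_image_of_mem f hzs)
  have hsumJ' : ∑' i : J, ENNReal.ofReal (r' i ^ 2) ≤ ENNReal.ofReal (t ^ 2 / (65536 * C ^ 2)) :=
    (tsum_sq_le_volume (a := fun i : J ↦ c' i) (fun i ↦ (D'.pos i).le)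
      (fun i j hij ↦ (D'.disj (Subtype.coe_injective.ne hij)).mono ball_subset_closedBall
        ball_subset_closedBall)
      fun i ↦ (H.closedBall_subset_of_scaleBound hσ hp B i.2).2).trans B.density
  have hsumJ : ∑' i : J, ENNReal.ofReal (r i ^ 2) ≤ ENNReal.ofReal (324 * s ^ 2) := by
    refine (tsum_sq_le_volume (a := fun i : J ↦ c i) (V := ball p (9 * s)) (fun i ↦ (D.pos i).le)
      (fun i j hij ↦ (D.disj (Subtype.coe_injective.ne hij)).mono ball_subset_closedBall
        ball_subset_closedBall) fun i ↦ ball_subset_closedBall.trans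
          (H.closedBall_subset_of_scaleBound hσ hp B i.2).1).trans ?_
    refine (measure_mono ball_subset_closedBall).trans
      ((volume_closedBall_le p (by positivity)).trans (ENNReal.ofReal_le_ofReal ?_))
    nlinarith
  have hr' : ∀ i ∈ J, r' i ≤ t / (256 * C) := fun i hi ↦ by
    have h1 := (ENNReal.le_tsum (f := fun i : J ↦ ENNReal.ofReal (r' i ^ 2)) ⟨i, hi⟩).trans hsumJ'
    rw [ENNReal.ofReal_le_ofReal_iff (by positivity)] at h1
    refine le_of_sq_le_sq (h1.trans_eq ?_) (by positivity)
    field_simp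
    norm_num
  have hapx : ∀ z ∈ closedBall p (8 * s), ∃ x ∈ S ∩ closedBall p (16 * s), dist x z ≤ s / 4 ∧
      dist (F z) (f x) ≤ t / (128 * C) := by
    intro z hz
    by_cases hzS : z ∈ S
    · refine ⟨z, ⟨hzS, closedBall_subset_closedBall (by linarith) hz⟩, by simp; positivity, ?_⟩
      rw [hFS hzS, dist_self]
      positivity
    · obtain ⟨i, hi⟩ := D.exists_mem_ball
        (hsub (closedBall_subset_closedBall (by linarith) hz)) hzS
      have hzi := ball_subset_closedBall hi
      have hiJ : i ∈ J := ⟨z, hzi, hz⟩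
      have h1 := H.radius_lt_of_scaleBound hσ hp B hiJ
      obtain ⟨x, hx⟩ := NormedSpace.sphere_nonempty (x := c i).2 (D.pos i).le
      have hxi := sphere_subset_closedBall hx
      refine ⟨x, ⟨D.sphere_subset i hx, closedBall_subset_closedBall (by linarith)
        (ball_subset_closedBall ((H.closedBall_subset_of_scaleBound hσ hp B hiJ).1 hxi))⟩, ?_, ?_⟩
      · have := dist_triangle_right x z (c i)
        rw [mem_closedBall] at hxi hzi
        linarith
      · rw [← hFS (D.sphere_subset i hx)]
        have h2 := hFcl i hzi
        have h3 := hFcl i hxi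
        rw [mem_closedBall] at h2 h3
        have h4 := hr' i hiJ
        have h5 : t / (128 * C) = 2 * (t / (256 * C)) := by field_simp; norm_num
        linarith [dist_triangle_right (F z) (F x) (c' i)]
  set R : Set ℂ := Icc (p.re - 4 * s) (p.re + 4 * s) ×ℂ Icc (p.im - s) (p.im + s) with hR
  have hRp : R ⊆ closedBall p (8 * s) := fun z hz ↦ by
    rw [hR, Complex.mem_reProdIm] at hz
    rw [mem_closedBall_iff_norm]
    refine (Complex.norm_le_abs_re_add_abs_im _).trans ?_
    have h1 : |(z - p).re| ≤ 4 * s := by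
      rw [Complex.sub_re, abs_le]; constructor <;> linarith [hz.1.1, hz.1.2]
    have h2 : |(z - p).im| ≤ s := by
      rw [Complex.sub_im, abs_le]; constructor <;> linarith [hz.2.1, hz.2.2]
    linarith
  have h8 : closedBall p (8 * s) ⊆ Ω := (closedBall_subset_closedBall (by linarith)).trans hsub
  have hl : ∀ y ∈ Icc (p.im - s) (p.im + s), t / (2 * C) ≤
      dist (F ((p.re + 4 * s : ℝ) + y * Complex.I)) (F ((p.re - 4 * s : ℝ) + y * Complex.I)) := by
    intro y hy
    obtain ⟨x, hx, hxz, hxF⟩ := hapx ((p.re + 4 * s : ℝ) + y * Complex.I) (hRp (by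
      simp only [hR, Complex.mem_reProdIm]
      refine ⟨?_, by simpa using hy⟩
      simp
      linarith))
    obtain ⟨x', hx', hxz', hxF'⟩ := hapx ((p.re - 4 * s : ℝ) + y * Complex.I) (hRp (by
      simp only [hR, Complex.mem_reProdIm]
      refine ⟨?_, by simpa using hy⟩
      simp
      linarith))
    set z : ℂ := (p.re + 4 * s : ℝ) + y * Complex.I with hz
    set z' : ℂ := (p.re - 4 * s : ℝ) + y * Complex.I with hz'
    have hzz' : dist z z' = 8 * s := by
      rw [dist_eq_norm, hz, hz', add_sub_add_right_eq_sub, ← Complex.ofReal_sub, Complex.norm_real,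
        Real.norm_of_nonneg] <;> linarith
    have h1 := dist_triangle4 z x x' z'
    rw [dist_comm z x, hzz'] at h1
    have h2 := B.le_dist x hx x' hx' (by linarith)
    rw [← div_le_iff₀' (by linarith)] at h2
    have h3 := dist_triangle4 (f x) (F z) (F z') (f x')
    rw [dist_comm (f x) (F z)] at h3
    have h4 : t / C = t / (2 * C) + 64 * (t / (128 * C)) := by field_simp; norm_num
    have h5 : 0 ≤ t / (128 * C) := by positivity
    linarith
  set a : ℝ := 25600 * K ^ 2 * t * C / s with ha
  set b : ℝ := t / (4096 * C * s) with hb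
  have ha0 : 0 < a := by positivity
  have hb0 : 0 < b := by positivity
  set K₁ : Set ℂ := S ∩ closedBall p (8 * s) with hK₁
  have hK₁s : K₁ ⊆ S ∩ closedBall p (16 * s) :=
    inter_subset_inter_right _ (closedBall_subset_closedBall (by linarith))
  obtain ⟨U, hKU, hU, hUv⟩ := K₁.exists_isOpen_lt_of_lt (μ := volume)
    (ENNReal.ofReal (s * t / (4 * C * a)))
    (by rw [measure_mono_null inter_subset_left h0]; simp; positivity)
  obtain ⟨T, ρ, d, hTc, hTK, hρd, hTcov, hTd, hTρ, hTd2⟩ :=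
    exists_cover_of_weakly_quasisymmetric (V := ball (f p) (2 * t)) (D.isCompact_inter h8)
      (H.cont.mono inter_subset_left) hK
      (fun x hx y hy z hz ↦ B.weak x (hK₁s hx) y (hK₁s hy) z (hK₁s hz)) hU hKU isOpen_ball
      (fun x hx ↦ (B.dist_le x (hK₁s hx)).trans_lt (by linarith))
  have : Countable T := hTc.to_subtype
  have hmain := length_area (κ := T ⊕ J) (F := F) (by linarith)
    (show 0 ≤ t / (2 * C) by positivity) (hFc.mono (hRp.trans h8))
    (A := Sum.elim (fun u ↦ K₁ ∩ closedBall u (5 * ρ u)) fun i ↦ closedBall (c i) (r i))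
    (a := Sum.elim (fun u ↦ u) fun i ↦ c i) (ρ := Sum.elim (fun u ↦ 5 * ρ u) fun i ↦ r i)
    (e := Sum.elim (fun u ↦ 2 * d u) fun i ↦ 2 * r' i)
    (by
      rintro (u | i)
      · exact inter_subset_right
      · exact subset_rfl)
    (fun z hz ↦ by
      by_cases hzS : z ∈ S
      · obtain ⟨u, hu, hzu⟩ := hTcov z ⟨hzS, hRp hz⟩
        exact mem_iUnion.2 ⟨Sum.inl ⟨u, hu⟩, ⟨hzS, hRp hz⟩, hzu⟩
      · obtain ⟨i, hi⟩ := D.exists_mem_ball (h8 (hRp hz)) hzS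
        have hzi := ball_subset_closedBall hi
        exact mem_iUnion.2 ⟨Sum.inr ⟨i, z, hzi, hRp hz⟩, hzi⟩)
    (by
      rintro (u | i) z hz w hw - -
      · rw [hFS hz.1.1, hFS hw.1.1]
        have h1 := hTd u u.2 z hz.1 hz.2
        have h2 := hTd u u.2 w hw.1 hw.2
        simp only [Sum.elim_inl]
        linarith [dist_triangle_right (f z) (f w) (f u)]
      · have h1 := hFcl i hz
        have h2 := hFcl i hw
        rw [mem_closedBall] at h1 h2
        simp only [Sum.elim_inr]
        linarith [dist_triangle_right (F z) (F w) (c' i)])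
    hl
  rw [ENNReal.summable.tsum_sum ENNReal.summable] at hmain
  have hV : ∑' u : T, ENNReal.ofReal (d u ^ 2) ≤ ENNReal.ofReal (64 * K ^ 2 * t ^ 2) := by
    refine hTd2.trans ?_
    rw [show 64 * K ^ 2 * t ^ 2 = 4 * K ^ 2 * ((2 * t) ^ 2 * 4) by ring,
      ENNReal.ofReal_mul (show 0 ≤ 4 * K ^ 2 by positivity)]
    gcongr
    exact (measure_mono ball_subset_closedBall).trans (volume_closedBall_le _ (by positivity))
  have h1 := tsum_ofReal_combination_le (z := fun u : T ↦ 2 * d u * (2 * (5 * ρ u)))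
    (show 0 ≤ 100 / a by positivity) ha0.le (by positivity) (by positivity) hV
    (hTρ.trans hUv.le) fun u ↦ by
      have h := mul_nonneg (inv_nonneg.2 ha0.le) (sq_nonneg (10 * d u - a * ρ u))
      have h' : a⁻¹ * (10 * d u - a * ρ u) ^ 2 =
          100 / a * d u ^ 2 + a * ρ u ^ 2 - 2 * d u * (2 * (5 * ρ u)) := by
        field_simp
        ring
      linarith
  have h2 := tsum_ofReal_combination_le (z := fun i : J ↦ 2 * r' i * (2 * r i))
    (show 0 ≤ 4 / b by positivity) hb0.le (by positivity) (by positivity) hsumJ' hsumJ fun i ↦ by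
      have h := mul_nonneg (inv_nonneg.2 hb0.le) (sq_nonneg (2 * r' i - b * r i))
      have h' : b⁻¹ * (2 * r' i - b * r i) ^ 2 =
          4 / b * r' i ^ 2 + b * r i ^ 2 - 2 * r' i * (2 * r i) := by
        field_simp
        ring
      linarith
  have h3 : ENNReal.ofReal ((p.im + s - (p.im - s)) * (t / (2 * C))) ≤ ENNReal.ofReal
      (100 / a * (64 * K ^ 2 * t ^ 2) + a * (s * t / (4 * C * a)) +
        (4 / b * (t ^ 2 / (65536 * C ^ 2)) + b * (324 * s ^ 2))) := by
    rw [ENNReal.ofReal_add (by positivity) (by positivity)]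
    refine hmain.trans ((add_le_add (le_of_eq ?_) (le_of_eq ?_)).trans (add_le_add h1 h2))
    · refine tsum_congr fun u ↦ ?_
      rw [Sum.elim_inl, Sum.elim_inl,
        ENNReal.ofReal_mul (mul_nonneg zero_le_two (hρd u u.2).2)]
    · refine tsum_congr fun i ↦ ?_
      rw [Sum.elim_inr, Sum.elim_inr,
        ENNReal.ofReal_mul (mul_nonneg zero_le_two (D'.pos i).le)]
  rw [ENNReal.ofReal_le_ofReal_iff (by positivity)] at h3
  have h4 : 100 / a * (64 * K ^ 2 * t ^ 2) = s * t / C / 4 := by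
    rw [ha]; field_simp; norm_num
  have h5 : a * (s * t / (4 * C * a)) = s * t / C / 4 := by field_simp
  have h6 : 4 / b * (t ^ 2 / (65536 * C ^ 2)) = s * t / C / 4 := by
    rw [hb]; field_simp; norm_num
  have h7 : b * (324 * s ^ 2) = s * t / C * (324 / 4096) := by
    rw [hb]; field_simp
  have h8 : (p.im + s - (p.im - s)) * (t / (2 * C)) = s * t / C := by field_simp; ring
  have h9 : 0 < s * t / C := by positivity
  rw [h4, h5, h6, h7, h8] at h3
  linarith

theorem exists_scaleBound (H : SchottkyHomeo Ω S c r Ω' S' c' r' f g)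
    (hqs : LocallyQuasisymmetricOn f S) (h0 : volume S = 0) (h0' : volume S' ≠ 0) :
    ∃ p ∈ S, ∃ s t C K : ℝ, closedBall p (16 * s) ⊆ Ω ∧ ScaleBound S S' f p s t C K := by
  have D := H.data
  obtain ⟨w, hw, hdens⟩ := exists_density_point H.data'.measurableSet h0'
  set p := g w with hp_def
  have hfp : f p = w := H.right_inv hw
  have hp : p ∈ S := H.maps' hw
  obtain ⟨R, hR, hRΩ⟩ := nhds_basis_closedBall.mem_iff.1 (D.isOpen.mem_nhds (D.subset hp))
  obtain ⟨η, hη⟩ := hqs _ inter_subset_left (D.isCompact_inter hRΩ)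
  set C : ℝ := max 1 (2 * η 128) with hC
  have hC1 : 1 ≤ C := le_max_left _ _
  obtain ⟨ρ, hρ, hρd⟩ := mem_nhdsGT_iff_exists_Ioo_subset.1
    (hdens (1 / (4 * 65536 * C ^ 2)) (by positivity))
  rw [mem_Ioi] at hρ
  obtain ⟨δ, hδ, hδf⟩ := Metric.continuousOn_iff.1 H.cont p hp (ρ / 4) (by positivity)
  set s : ℝ := min R (δ / 2) / 16 with hs
  have hs0 : 0 < s := by positivity
  have hsR : 16 * s ≤ R := by linarith [min_le_left R (δ / 2)]
  have hsδ : 16 * s < δ := by linarith [min_le_right R (δ / 2)]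
  have hsub : closedBall p (16 * s) ⊆ Ω := (closedBall_subset_closedBall hsR).trans hRΩ
  have hmono : S ∩ closedBall p (16 * s) ⊆ S ∩ closedBall p R :=
    inter_subset_inter_right _ (closedBall_subset_closedBall hsR)
  obtain ⟨x₀, hx₀, hmax⟩ := (D.isCompact_inter hsub).exists_isMaxOn
    ⟨p, hp, mem_closedBall_self (by positivity)⟩ (f := fun x ↦ dist (f x) (f p))
    ((continuous_id.dist continuous_const).comp_continuousOn (H.cont.mono inter_subset_left))
  set t := dist (f x₀) (f p) with ht
  have hle : ∀ x ∈ S ∩ closedBall p (16 * s), dist (f x) (f p) ≤ t := fun x hx ↦ hmax hx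
  have htρ : 2 * t < ρ := by
    have := hδf x₀ hx₀.1 ((mem_closedBall.1 hx₀.2).trans_lt hsδ)
    linarith
  have ht0 : 0 < t := by
    obtain ⟨i, hi⟩ := D.exists_closedBall_subset h0 hp (show 0 < 16 * s by positivity)
    obtain ⟨x, hx⟩ := NormedSpace.sphere_nonempty (x := c i).2 (D.pos i).le
    obtain ⟨y, hy, hxy⟩ := exists_mem_sphere_dist_eq hx (D.pos i).le (by linarith [D.pos i])
    have hin : ∀ z ∈ sphere (c i) (r i), z ∈ S ∩ closedBall p (16 * s) := fun z hz ↦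
      ⟨D.sphere_subset i hz, ball_subset_closedBall (hi (sphere_subset_closedBall hz))⟩
    refine dist_nonneg.lt_of_ne fun h ↦ ?_
    have h1 : ∀ z ∈ sphere (c i) (r i), z = p := fun z hz ↦
      H.left_inv.injOn (hin z hz).1 hp (dist_le_zero.1 ((hle z (hin z hz)).trans h.ge))
    rw [h1 x hx, h1 y hy, dist_self] at hxy
    exact (D.pos i).ne hxy
  refine ⟨p, hp, s, t, C, max 1 (η 5), hsub, hs0, ht0, hC1, le_max_left _ _, hle, ?_, ?_, ?_⟩
  · intro x hx y hy hxy
    have h1 : ∀ z ∈ S ∩ closedBall p (16 * s), dist (f x) (f z) ≤ η 128 * dist (f x) (f y) := by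
      intro z hz
      refine hη x (hmono hx) z (hmono hz) y (hmono hy) 128 ?_
      have := dist_triangle_right x z p
      have h2 := mem_closedBall.1 hx.2
      have h3 := mem_closedBall.1 hz.2
      push_cast
      linarith
    have h2 := h1 x₀ hx₀
    have h3 := h1 p ⟨hp, mem_closedBall_self (by positivity)⟩
    have h4 := dist_triangle_left (f x₀) (f p) (f x)
    have h5 : 2 * η 128 * dist (f x) (f y) ≤ C * dist (f x) (f y) := by
      gcongr
      exact le_max_right _ _
    linarith
  · intro x hx y hy z hz hxy
    refine (hη x (hmono hx) y (hmono hy) z (hmono hz) 5 (by simpa using hxy)).trans ?_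
    gcongr
    exact le_max_right _ _
  · have := hρd (show 2 * t ∈ Ioo 0 ρ from ⟨by linarith, htρ⟩)
    rw [hfp]
    refine le_trans this (ENNReal.ofReal_le_ofReal (le_of_eq ?_))
    field_simp
    ring

/-- A locally quasisymmetric homeomorphism maps null Schottky sets to null Schottky sets. -/
theorem volume_target_eq_zero (H : SchottkyHomeo Ω S c r Ω' S' c' r' f g)
    (hσ : ∀ i, f '' sphere (c i) (r i) = sphere (c' i) (r' i))
    (hqs : LocallyQuasisymmetricOn f S) (h0 : volume S = 0) : volume S' = 0 := by
  by_contra h0'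
  obtain ⟨p, hp, s, t, C, K, hsub, B⟩ := H.exists_scaleBound hqs h0 h0'
  exact H.scaleBound_false hσ h0 hp hsub B

end SchottkyHomeo

theorem volume_image_bilin_eq_zero_of_isCompact {K : Set ℂ} {f : ℂ → ℂ} (hK : IsCompact K)
    (hf : ContinuousOn f K) {η : ℝ≥0 ≃ₜ ℝ≥0} (hη : QuasisymmetricWith η f K) (h0 : volume K = 0)
    (h0' : volume (f '' K) = 0) (A B C : ℂ) :
    volume ((fun z ↦ A * z * f z + B * f z + C * z) '' K) = 0 := by
  set φ : ℂ → ℂ := fun z ↦ A * z * f z + B * f z + C * z with hφ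
  set h : ℝ := max 1 (η 5) with hh
  obtain ⟨b₁, hb₁⟩ := hK.exists_bound_of_continuousOn continuousOn_id
  obtain ⟨b₂, hb₂⟩ := hK.exists_bound_of_continuousOn hf
  set M : ℝ := ‖A‖ * (|b₁| + |b₂|) + ‖B‖ + ‖C‖ + 1 with hM
  have hM0 : 0 < M := by positivity
  have hφd : ∀ x ∈ K, ∀ t ∈ K, dist (φ x) (φ t) ≤ M * (dist x t + dist (f x) (f t)) := by
    intro x hx t ht
    simp only [dist_eq_norm]
    have e1 : φ x - φ t = A * x * (f x - f t) + A * f t * (x - t) + B * (f x - f t) +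
        C * (x - t) := by simp only [hφ]; ring
    have e2 : ‖x‖ ≤ |b₁| := (hb₁ x hx).trans (le_abs_self _)
    have e3 : ‖f t‖ ≤ |b₂| := (hb₂ t ht).trans (le_abs_self _)
    calc ‖φ x - φ t‖ ≤ ‖A‖ * ‖x‖ * ‖f x - f t‖ + ‖A‖ * ‖f t‖ * ‖x - t‖ + ‖B‖ * ‖f x - f t‖ +
          ‖C‖ * ‖x - t‖ := by
          rw [e1]
          refine (norm_add_le _ _).trans (add_le_add ((norm_add_le _ _).trans (add_le_add
            ((norm_add_le _ _).trans (add_le_add ?_ ?_)) ?_)) ?_) <;> simp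
      _ ≤ ‖A‖ * |b₁| * ‖f x - f t‖ + ‖A‖ * |b₂| * ‖x - t‖ + ‖B‖ * ‖f x - f t‖ +
          ‖C‖ * ‖x - t‖ := by gcongr
      _ ≤ M * (‖x - t‖ + ‖f x - f t‖) := by
          have h1 : 0 ≤ (‖A‖ * |b₁| + ‖B‖ + 1) * ‖x - t‖ := by positivity
          have h2 : 0 ≤ (‖A‖ * |b₂| + ‖C‖ + 1) * ‖f x - f t‖ := by positivity
          rw [hM]
          linarith
  set L : ℝ := 200 * M ^ 2 + 8 * M ^ 2 * (4 * h ^ 2) with hL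
  have hL0 : 0 < L := by positivity
  refine nonpos_iff_eq_zero.1 (ENNReal.le_of_forall_pos_le_add fun ε hε _ ↦ ?_)
  rw [zero_add]
  have hε' : (0 : ℝ) < ε / L := by positivity
  obtain ⟨U, hKU, hU, hUv⟩ := K.exists_isOpen_lt_of_lt (μ := volume) (ENNReal.ofReal (ε / L))
    (by rw [h0]; simpa using hε')
  obtain ⟨V, hKV, hV, hVv⟩ := (f '' K).exists_isOpen_lt_of_lt (μ := volume)
    (ENNReal.ofReal (ε / L)) (by rw [h0']; simpa using hε')
  obtain ⟨T, ρ, d, hTc, hTK, hρd, hTcov, hTd, hTρ, hTd2⟩ :=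
    exists_cover_of_weakly_quasisymmetric hK hf (le_max_left 1 (η 5 : ℝ))
      (fun x hx y hy z hz hxy ↦ (hη x hx y hy z hz 5 (by simpa using hxy)).trans
        (by gcongr; exact le_max_right _ _)) hU hKU hV (mapsTo_iff_image_subset.2 hKV)
  have : Countable T := hTc.to_subtype
  have hcov : φ '' K ⊆ ⋃ t : T, closedBall (φ t) (M * (5 * ρ t + d t)) := by
    rintro _ ⟨x, hx, rfl⟩
    obtain ⟨t, ht, hxt⟩ := hTcov x hx
    refine mem_iUnion.2 ⟨⟨t, ht⟩, (hφd x hx t (hTK ht)).trans ?_⟩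
    gcongr
    · exact hxt
    · exact hTd t ht x hx hxt
  have hd : ∑' t : T, ENNReal.ofReal (d t ^ 2) ≤ ENNReal.ofReal (4 * h ^ 2 * (ε / L)) := by
    rw [ENNReal.ofReal_mul (show 0 ≤ 4 * h ^ 2 by positivity)]
    exact hTd2.trans (by gcongr)
  calc volume (φ '' K) ≤ ∑' t : T, volume (closedBall (φ t) (M * (5 * ρ t + d t))) :=
        (measure_mono hcov).trans (measure_iUnion_le _)
    _ ≤ ∑' t : T, ENNReal.ofReal ((M * (5 * ρ t + d t)) ^ 2 * 4) :=
        ENNReal.tsum_le_tsum fun t ↦ volume_closedBall_le _ (mul_nonneg hM0.le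
          (add_nonneg (mul_nonneg (by norm_num) (hρd t t.2).1.le) (hρd t t.2).2))
    _ ≤ ENNReal.ofReal (200 * M ^ 2 * (ε / L) + 8 * M ^ 2 * (4 * h ^ 2 * (ε / L))) := by
        refine tsum_ofReal_combination_le (by positivity) (by positivity) hε'.le (by positivity)
          (hTρ.trans hUv.le) hd fun t ↦ ?_
        have := mul_nonneg (sq_nonneg M) (sq_nonneg (5 * ρ t - d t))
        linarith
    _ = ε := by
        rw [show 200 * M ^ 2 * (ε / L) + 8 * M ^ 2 * (4 * h ^ 2 * (ε / L)) = L * (ε / L) by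
          rw [hL]; ring, mul_div_cancel₀ _ hL0.ne', ENNReal.ofReal_coe_nnreal]

theorem SchottkyHomeo.volume_image_bilin_eq_zero {I : Type} {Ω S : Set ℂ} {c : I → ℂ} {r : I → ℝ}
    {Ω' S' : Set ℂ} {c' : I → ℂ} {r' : I → ℝ} {f g : ℂ → ℂ}
    (H : SchottkyHomeo Ω S c r Ω' S' c' r' f g)
    (hσ : ∀ i, f '' sphere (c i) (r i) = sphere (c' i) (r' i))
    (hqs : LocallyQuasisymmetricOn f S) (h0 : volume S = 0) (A B C : ℂ) :
    volume ((fun z ↦ A * z * f z + B * f z + C * z) '' S) = 0 := by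
  obtain ⟨K, hK, hKS⟩ := H.data.isSigmaCompact
  have hsub : ∀ n, K n ⊆ S := fun n ↦ hKS ▸ subset_iUnion K n
  nth_rw 1 [← hKS]
  rw [image_iUnion, measure_iUnion_null_iff]
  intro n
  obtain ⟨η, hη⟩ := hqs (K n) (hsub n) (hK n)
  refine volume_image_bilin_eq_zero_of_isCompact (hK n) (H.cont.mono (hsub n)) hη
    (measure_mono_null (hsub n) h0) (measure_mono_null ?_ (H.volume_target_eq_zero hσ hqs h0)) A B C
  exact ((H.maps.mono_left (hsub n)).image_subset)

namespace SchottkyHomeo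

variable {I : Type} {Ω S : Set ℂ} {c : I → ℂ} {r : I → ℝ} {Ω' S' : Set ℂ}
    {c' : I → ℂ} {r' : I → ℝ} {f g F : ℂ → ℂ}

theorem exists_wind (H : SchottkyHomeo Ω S c r Ω' S' c' r' f g)
    (hσ : ∀ i, f '' sphere (c i) (r i) = sphere (c' i) (r' i)) (i : I) :
    ∃ n : ℤ, (n = 1 ∨ n = -1) ∧ Wind (fun z ↦ f z - c' i) (c i) (r i) n := by
  have hsph := H.data.sphere_subset i
  have hmaps : MapsTo f (sphere (c i) (r i)) (sphere (c' i) (r' i)) := hσ i ▸ mapsTo_image f _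
  obtain ⟨n, hn⟩ := Wind.exists_eq (g := fun z ↦ f z - c' i) (H.data.pos i).le
    ((H.cont.mono hsph).sub continuousOn_const) fun z hz h ↦
      ne_of_mem_sphere (hmaps hz) (H.data'.pos i).ne' (sub_eq_zero.1 h)
  obtain ⟨ψ, hψ, -⟩ := exists_isCircleLift (H.data.pos i) (H.left_inv.injOn.mono hsph) hmaps hn
  exact ⟨n, hψ.eq_one_or_eq_neg_one, hn⟩

theorem notMem_closedBall_of_notMem (H : SchottkyHomeo Ω S c r Ω' S' c' r' f g)
    (hσ : ∀ i, f '' sphere (c i) (r i) = sphere (c' i) (r' i)) (hFS : EqOn F f S)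
    (hFb : ∀ i, MapsTo F (ball (c i) (r i)) (ball (c' i) (r' i))) {i : I} {z : ℂ} (hz : z ∈ Ω)
    (hzi : z ∉ closedBall (c i) (r i)) : F z ∉ closedBall (c' i) (r' i) := by
  intro hF
  by_cases hzS : z ∈ S
  · rw [hFS hzS] at hF
    have h1 : f z ∈ sphere (c' i) (r' i) := le_antisymm hF
      (not_lt.1 ((H.data'.mem_iff.1 (H.maps hzS)).2 i))
    rw [← hσ i] at h1
    obtain ⟨y, hy, hyz⟩ := h1
    rw [H.left_inv.injOn (H.data.sphere_subset i hy) hzS hyz] at hy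
    exact hzi (sphere_subset_closedBall hy)
  · obtain ⟨k, hk⟩ := H.data.exists_mem_ball hz hzS
    have h1 := H.data'.eq_of_mem hF (ball_subset_closedBall (hFb k hk))
    subst h1
    exact hzi (ball_subset_closedBall hk)

theorem apply_ne_of_ne (H : SchottkyHomeo Ω S c r Ω' S' c' r' f g) (hFS : EqOn F f S)
    (hFb : ∀ i, MapsTo F (ball (c i) (r i)) (ball (c' i) (r' i))) {p z : ℂ} (hp : p ∈ S)
    (hz : z ∈ Ω) (hzp : z ≠ p) : F z ≠ F p := by
  rw [hFS hp]
  by_cases hzS : z ∈ S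
  · rw [hFS hzS]
    exact H.left_inv.injOn.ne hzS hp hzp
  · obtain ⟨k, hk⟩ := H.data.exists_mem_ball hz hzS
    intro h
    exact (H.data'.mem_iff.1 (H.maps hp)).2 k (h ▸ hFb k hk)

/-- The winding number around a peripheral circle is computed by a larger circle. -/
theorem wind_of_outer (H : SchottkyHomeo Ω S c r Ω' S' c' r' f g)
    (hσ : ∀ i, f '' sphere (c i) (r i) = sphere (c' i) (r' i)) (hFc : ContinuousOn F Ω)
    (hFS : EqOn F f S) (hFb : ∀ i, MapsTo F (ball (c i) (r i)) (ball (c' i) (r' i)))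
    {c₀ w : ℂ} {R : ℝ} {N : ℤ} (hR : 0 < R) (hsub : closedBall c₀ R ⊆ Ω)
    (hN : Wind (fun z ↦ F z - w) c₀ R N) {j : I} (hj : closedBall (c j) (r j) ⊆ ball c₀ R)
    (hw : ∀ z ∈ sphere c₀ R, dist (c' j) w < dist (F z) w) :
    Wind (fun z ↦ f z - c' j) (c j) (r j) N := by
  have hsph := H.data.sphere_subset j
  obtain ⟨n, -, hn⟩ := H.exists_wind hσ j
  have hFj : Wind (fun z ↦ F z - c' j) (c j) (r j) n :=
    hn.congr (H.data.pos j).le fun z hz ↦ by rw [hFS (hsph hz)]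
  have hcont : ContinuousOn (fun z ↦ F z - c' j) Ω := hFc.sub continuousOn_const
  have h1 := wind_sum {j} c r (fun _ ↦ n) (g := fun z ↦ F z - c' j) hR
    (fun k _ ↦ H.data.pos k) (by simpa using hj)
    (fun k _ l _ hkl ↦ H.data.disj hkl) (hcont.mono (sdiff_subset.trans hsub)) (by
      intro z hz h
      have hzb : z ∉ ball (c j) (r j) := by simpa using hz.2
      have hFz : F z = c' j := sub_eq_zero.1 h
      by_cases hzj : z ∈ closedBall (c j) (r j)
      · have hzs : z ∈ sphere (c j) (r j) := le_antisymm hzj (not_lt.1 hzb)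
        have h2 : F z ∈ sphere (c' j) (r' j) := by
          rw [hFS (hsph hzs), ← hσ j]
          exact mem_image_of_mem f hzs
        exact ne_of_mem_sphere h2 (H.data'.pos j).ne' hFz
      · refine H.notMem_closedBall_of_notMem hσ hFS hFb (hsub hz.1) hzj ?_
        rw [hFz]
        exact mem_closedBall_self (H.data'.pos j).le) (fun k hk ↦ by
          rw [Finset.mem_singleton.1 hk]; exact hFj)
  rw [Finset.sum_singleton] at h1
  have hsphR : sphere c₀ R ⊆ Ω := sphere_subset_closedBall.trans hsub
  have h2 : Wind (fun z ↦ F z - c' j) c₀ R N := Wind.of_norm_sub_lt (h := fun z ↦ F z - w)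
    hR.le (hcont.mono hsphR)
    ((hFc.sub continuousOn_const).mono hsphR) (fun z hz ↦ by
      have := hw z hz
      show ‖F z - c' j - (F z - w)‖ < ‖F z - w‖
      rwa [sub_sub_sub_cancel_left, ← dist_eq_norm, ← dist_eq_norm, dist_comm w]) hN
  rw [h2.unique h1]
  exact hn

theorem exists_local_wind (H : SchottkyHomeo Ω S c r Ω' S' c' r' f g)
    (hσ : ∀ i, f '' sphere (c i) (r i) = sphere (c' i) (r' i)) {p : ℂ} (hp : p ∈ S) :
    ∃ (N : ℤ) (δ : ℝ), 0 < δ ∧ ∀ j, ¬ Disjoint (closedBall (c j) (r j)) (closedBall p δ) →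
      Wind (fun z ↦ f z - c' j) (c j) (r j) N := by
  obtain ⟨F, hFc, hFS, hFb⟩ := H.exists_extension hσ
  have D := H.data
  obtain ⟨c₀, R, δ₀, L⟩ := D.exists_localDisc hp
  have hsphΩ : sphere c₀ R ⊆ Ω := sphere_subset_closedBall.trans L.sub
  have hin : ∀ j, p ∈ closedBall (c j) (r j) → closedBall (c j) (r j) ⊆ ball c₀ R := fun j hj ↦
    L.inside j (not_disjoint_iff.2 ⟨p, hj, mem_closedBall_self L.δ_pos.le⟩)
  obtain ⟨w, hw, hwj⟩ : ∃ w : ℂ, (∀ z ∈ sphere c₀ R, dist (F p) w < dist (F z) w) ∧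
      ∀ j, p ∈ closedBall (c j) (r j) → c' j = w := by
    by_cases hpi : ∃ i, p ∈ closedBall (c i) (r i)
    · obtain ⟨i, hi⟩ := hpi
      refine ⟨c' i, fun z hz ↦ ?_, fun j hj ↦ by rw [D.eq_of_mem hj hi]⟩
      have h1 := H.notMem_closedBall_of_notMem hσ hFS hFb (hsphΩ hz) fun hzi ↦
        (mem_ball.1 (hin i hi hzi)).ne (mem_sphere.1 hz)
      have hps : p ∈ sphere (c i) (r i) := le_antisymm hi (not_lt.1 ((D.mem_iff.1 hp).2 i))
      have h2 : f p ∈ sphere (c' i) (r' i) := hσ i ▸ mem_image_of_mem f hps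
      rw [hFS hp, mem_sphere.1 h2]
      exact not_le.1 h1
    · refine ⟨F p, fun z hz ↦ ?_, fun j hj ↦ (hpi ⟨j, hj⟩).elim⟩
      rw [dist_self]
      refine dist_pos.2 (H.apply_ne_of_ne hFS hFb hp (hsphΩ hz) ?_)
      rintro rfl
      exact (mem_ball.1 (L.closedBall_sub (mem_closedBall_self L.δ_pos.le))).ne (mem_sphere.1 hz)
  obtain ⟨N, hN⟩ := Wind.exists_eq (g := fun z ↦ F z - w) L.R_pos.le
    ((hFc.mono hsphΩ).sub continuousOn_const) fun z hz h ↦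
      (dist_nonneg.trans_lt (hw z hz)).ne' (by rw [sub_eq_zero.1 h, dist_self])
  obtain ⟨z₀, hz₀, hmin⟩ := (isCompact_sphere c₀ R).exists_isMinOn
    (NormedSpace.sphere_nonempty.2 L.R_pos.le) (f := fun z ↦ dist (F z) w)
    ((continuous_id.dist continuous_const).comp_continuousOn (hFc.mono hsphΩ))
  obtain ⟨δ₁, hδ₁, hδF⟩ := Metric.continuousOn_iff.1 H.cont p hp (dist (F z₀) w - dist (F p) w)
    (sub_pos.2 (hw z₀ hz₀))
  obtain ⟨δ₂, hδ₂, hav⟩ := D.exists_ball_avoiding p (show 0 < δ₁ / 4 by positivity)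
  refine ⟨N, min δ₀ (min δ₂ (δ₁ / 4)), lt_min L.δ_pos (by positivity), fun j hj ↦ ?_⟩
  refine H.wind_of_outer hσ hFc hFS hFb L.R_pos L.sub hN
    (L.inside j fun h ↦ hj (h.mono_right (closedBall_subset_closedBall (min_le_left _ _))))
    fun z hz ↦ lt_of_lt_of_le ?_ (hmin hz)
  by_cases hpj : p ∈ closedBall (c j) (r j)
  · rw [hwj j hpj, dist_self]
    exact dist_nonneg.trans_lt (hw z₀ hz₀)
  have hrj : r j < δ₁ / 4 := by
    by_contra! hcon
    exact hj ((hav j hcon hpj).mono_right (closedBall_subset_closedBall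
      ((min_le_right _ _).trans (min_le_left _ _))))
  obtain ⟨y, hy, hyp⟩ := not_disjoint_iff.1 hj
  have hsub := SchottkyData.closedBall_subset_of_small (ε := δ₁) hy (closedBall_subset_closedBall
      ((min_le_right _ _).trans (min_le_right _ _)) hyp) (by linarith)
  have h1 : sphere (c' j) (r' j) ⊆ ball (F p) (dist (F z₀) w - dist (F p) w) := by
    rw [← hσ j]
    rintro _ ⟨x, hx, rfl⟩
    rw [hFS hp]
    exact hFS hp ▸ hδF x (D.sphere_subset j hx) (hsub (sphere_subset_closedBall hx))
  have h2 := convexHull_min h1 (convex_ball _ _)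
  rw [convexHull_sphere_eq_closedBall _ (H.data'.pos j).le] at h2
  have h3 := mem_ball.1 (h2 (mem_closedBall_self (H.data'.pos j).le))
  linarith [dist_triangle (c' j) (F p) w]

/-- The map has the same orientation on all peripheral circles. -/
theorem exists_orientation (H : SchottkyHomeo Ω S c r Ω' S' c' r' f g)
    (hσ : ∀ i, f '' sphere (c i) (r i) = sphere (c' i) (r' i)) (h0 : volume S = 0) :
    ∃ N : ℤ, (N = 1 ∨ N = -1) ∧ ∀ i, Wind (fun z ↦ f z - c' i) (c i) (r i) N := by
  have D := H.data
  choose! N δ hδ hN using fun p (hp : p ∈ S) ↦ H.exists_local_wind hσ hp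
  have hNc : ContinuousOn N S := by
    refine Metric.continuousOn_iff.2 fun p hp ε hε ↦ ⟨δ p, hδ p hp, fun q hq hqp ↦ ?_⟩
    obtain ⟨η, hη, hηsub⟩ := Metric.isOpen_iff.1 (isOpen_ball.inter isOpen_ball) q
      (show q ∈ ball p (δ p) ∩ ball q (δ q) from ⟨hqp, mem_ball_self (hδ q hq)⟩)
    obtain ⟨i, hi⟩ := D.exists_closedBall_subset h0 hq hη
    have hc := hηsub (hi (mem_closedBall_self (D.pos i).le))
    have h1 := hN p hp i (not_disjoint_iff.2
      ⟨c i, mem_closedBall_self (D.pos i).le, ball_subset_closedBall hc.1⟩)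
    have h2 := hN q hq i (not_disjoint_iff.2
      ⟨c i, mem_closedBall_self (D.pos i).le, ball_subset_closedBall hc.2⟩)
    rwa [h2.unique h1, dist_self]
  rcases isEmpty_or_nonempty I with hI | ⟨⟨i₀⟩⟩
  · exact ⟨1, Or.inl rfl, fun i ↦ isEmptyElim i⟩
  obtain ⟨n, hn, hni⟩ := H.exists_wind hσ i₀
  refine ⟨n, hn, fun i ↦ ?_⟩
  have hloc : ∀ j, ∃ p ∈ S, Wind (fun z ↦ f z - c' j) (c j) (r j) (N p) := fun j ↦ by
    obtain ⟨p, hp⟩ := NormedSpace.sphere_nonempty (x := c j).2 (D.pos j).le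
    have hpS := D.sphere_subset j hp
    exact ⟨p, hpS, hN p hpS j (not_disjoint_iff.2
      ⟨p, sphere_subset_closedBall hp, mem_closedBall_self (hδ p hpS).le⟩)⟩
  obtain ⟨p, hp, hpw⟩ := hloc i
  obtain ⟨q, hq, hqw⟩ := hloc i₀
  rwa [hni.unique hqw, ← (D.isPreconnected H.conn).constant hNc hp hq]

end SchottkyHomeo

theorem SchottkyData.not_subset_of_isCompact {I : Type} {Ω S : Set ℂ} {c : I → ℂ} {r : I → ℝ}
    (D : SchottkyData Ω S c r) (hne : Ω.Nonempty) {K : Set ℂ} (hK : IsCompact K) (hKΩ : K ⊆ Ω) :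
    ¬ S ⊆ K := by
  intro hSK
  have huniv : Ω ≠ univ := fun h ↦ NormedSpace.unbounded_univ ℂ ℂ (h ▸ D.isBounded)
  obtain ⟨q, hq⟩ := nonempty_frontier_iff.2 ⟨hne, huniv⟩
  have hqK : q ∉ K := fun h ↦ hq.2 (by rw [D.isOpen.interior_eq]; exact hKΩ h)
  obtain ⟨ε, hε, hεK⟩ := Metric.isOpen_iff.1 hK.isClosed.isOpen_compl q hqK
  obtain ⟨z, hzS, hz⟩ := D.exists_mem_near_frontier hq hε
  exact hεK hz (hSK hzS)

theorem SchottkyData.reindex {I I' : Type} {Ω S : Set ℂ} {c : I → ℂ} {r : I → ℝ}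
    (D : SchottkyData Ω S c r) {σ : I' → I} (hσ : σ.Bijective) :
    SchottkyData Ω S (c ∘ σ) (r ∘ σ) where
  isOpen := D.isOpen
  isBounded := D.isBounded
  pos i := D.pos (σ i)
  sub i := D.sub (σ i)
  disj _ _ hij := D.disj (hσ.1.ne hij)
  eq := by
    rw [D.eq, ← hσ.2.iUnion_comp]
    rfl

namespace SchottkyHomeo

variable {I : Type} {Ω S : Set ℂ} {c : I → ℂ} {r : I → ℝ} {Ω' S' : Set ℂ}
    {c' : I → ℂ} {r' : I → ℝ} {f g : ℂ → ℂ}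

theorem exists_schottkyMap (H : SchottkyHomeo Ω S c r Ω' S' c' r' f g) (hne : Ω.Nonempty)
    (hσ : ∀ i, f '' sphere (c i) (r i) = sphere (c' i) (r' i))
    (hqs : LocallyQuasisymmetricOn f S) (h0 : volume S = 0)
    (hw : ∀ i, Wind (fun z ↦ f z - c' i) (c i) (r i) 1) :
    ∃ F, SchottkyMap Ω S c r F c' r' ∧ EqOn F f S := by
  obtain ⟨F, hFc, hFS, hFb⟩ := H.exists_extension hσ
  have D := H.data
  refine ⟨F, ⟨D, hFc, H.data'.pos, H.data'.disj, hFb, fun i z hz ↦ ?_, fun z hz i ↦ ?_,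
    H.left_inv.injOn.congr hFS.symm, h0, fun A B C ↦ ?_, D.isPreconnected H.conn,
    fun K hK hKΩ ↦ D.not_subset_of_isCompact hne hK hKΩ,
    fun i ↦ (hw i).congr (D.pos i).le fun z hz ↦ by rw [hFS (D.sphere_subset i hz)]⟩, hFS⟩
  · rw [hFS (D.sphere_subset i hz), ← hσ i]
    exact mem_image_of_mem f hz
  · rw [hFS hz]
    exact (H.data'.mem_iff.1 (H.maps hz)).2 i
  · rw [image_congr fun z hz ↦ by rw [hFS hz]]
    exact H.volume_image_bilin_eq_zero hσ hqs h0 A B C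

/-- The conclusion for homeomorphisms whose peripheral winding numbers are positive. -/
theorem conformal_of_wind_one (H : SchottkyHomeo Ω S c r Ω' S' c' r' f g) (hne : Ω.Nonempty)
    (hσ : ∀ i, f '' sphere (c i) (r i) = sphere (c' i) (r' i))
    (hqs : LocallyQuasisymmetricOn f S) (h0 : volume S = 0)
    (hw : ∀ i, Wind (fun z ↦ f z - c' i) (c i) (r i) 1) :
    LocallyBiLipschitzOn f S ∧ ∃ f' : ℂ → ℂ, ContinuousOn f' S ∧ ∀ p ∈ S, f' p ≠ 0 ∧
      Tendsto (fun q ↦ (f q - f p) / (q - p)) (𝓝[S \ {p}] p) (𝓝 (f' p)) := by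
  obtain ⟨F, M, hFS⟩ := H.exists_schottkyMap hne hσ hqs h0 hw
  refine ⟨fun p hp ↦ ?_, ?_⟩
  · obtain ⟨U, hU, L, hL, hUL⟩ := M.locally_biLipschitz hp
    refine ⟨U ∩ S, inter_mem hU self_mem_nhdsWithin, L, hL, fun x hx y hy ↦ ?_⟩
    rw [← hFS hx.2, ← hFS hy.2]
    exact hUL x hx.1 y hy.1
  · obtain ⟨f', hf', hder⟩ := M.exists_continuousOn_deriv
    refine ⟨f', hf', fun p hp ↦ ⟨(hder p hp).1, (hder p hp).2.congr' ?_⟩⟩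
    filter_upwards [self_mem_nhdsWithin] with q hq
    rw [hFS hq.1, hFS hp]

theorem conj (H : SchottkyHomeo Ω S c r Ω' S' c' r' f g) :
    SchottkyHomeo Ω S c r (starRingEnd ℂ ⁻¹' Ω') (starRingEnd ℂ ⁻¹' S')
      (fun i ↦ starRingEnd ℂ (c' i)) r' (fun z ↦ starRingEnd ℂ (f z))
      (fun z ↦ g (starRingEnd ℂ z)) where
  data := H.data
  data' :=
    { isOpen := H.data'.isOpen.preimage Complex.continuous_conj
      isBounded := by
        have h : starRingEnd ℂ ⁻¹' Ω' = Complex.conjLIE '' Ω' := by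
          ext z
          refine ⟨fun hz ↦ ⟨_, hz, Complex.conj_conj z⟩, ?_⟩
          rintro ⟨w, hw, rfl⟩
          simpa using hw
        rw [h]
        exact Complex.conjLIE.lipschitz.isBounded_image H.data'.isBounded
      pos := H.data'.pos
      sub := fun i z hz ↦ H.data'.sub i (by rwa [mem_closedBall, Complex.dist_conj_comm])
      disj := fun i j hij ↦ disjoint_left.2 fun z hi hj ↦ by
        rw [mem_closedBall, ← Complex.dist_conj_comm] at hi hj
        exact disjoint_left.1 (H.data'.disj hij) hi hj
      eq := by
        ext z
        simp only [mem_preimage, H.data'.mem_iff, Set.mem_sdiff, mem_iUnion, not_exists, mem_ball,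
          Complex.dist_conj_comm] }
  conn := H.conn
  conn' := by
    have h : starRingEnd ℂ ⁻¹' Ω' = starRingEnd ℂ '' Ω' := by
      ext z
      refine ⟨fun hz ↦ ⟨_, hz, Complex.conj_conj z⟩, ?_⟩
      rintro ⟨w, hw, rfl⟩
      simpa using hw
    rw [h]
    exact H.conn'.image _ Complex.continuous_conj.continuousOn
  cont := Complex.continuous_conj.comp_continuousOn H.cont
  cont' := H.cont'.comp Complex.continuous_conj.continuousOn fun _ hz ↦ hz
  maps z hz := by simpa using H.maps hz
  maps' z hz := H.maps' hz
  left_inv z hz := by simpa using H.left_inv hz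
  right_inv z hz := by
    show starRingEnd ℂ (f (g (starRingEnd ℂ z))) = z
    rw [H.right_inv hz, Complex.conj_conj]

theorem conj_image_sphere {i : I} (hσ : f '' sphere (c i) (r i) = sphere (c' i) (r' i)) :
    (fun z ↦ starRingEnd ℂ (f z)) '' sphere (c i) (r i) =
      sphere (starRingEnd ℂ (c' i)) (r' i) := by
  rw [← image_image (starRingEnd ℂ) f, hσ]
  ext z
  constructor
  · rintro ⟨w, hw, rfl⟩
    rwa [mem_sphere, Complex.dist_conj_conj]
  · exact fun hz ↦ ⟨starRingEnd ℂ z, by rwa [mem_sphere, Complex.dist_conj_comm],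
      Complex.conj_conj z⟩

end SchottkyHomeo

theorem LocallyQuasisymmetricOn.conj {f : ℂ → ℂ} {S : Set ℂ} (h : LocallyQuasisymmetricOn f S) :
    LocallyQuasisymmetricOn (fun z ↦ starRingEnd ℂ (f z)) S := fun K hK hKc ↦ by
  obtain ⟨η, hη⟩ := h K hK hKc
  refine ⟨η, fun p hp q hq s hs t ht ↦ ?_⟩
  simp only [Complex.dist_conj_conj]
  exact hη p hp q hq s hs t ht

theorem IsRelativeSchottkySet.exists_schottkyData {Ω S : Set ℂ} (h : IsRelativeSchottkySet Ω S)
    (hb : Bornology.IsBounded Ω) : ∃ (I : Type) (c : I → ℂ) (r : I → ℝ), SchottkyData Ω S c r := by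
  obtain ⟨⟨hop, -⟩, I, c, r, ⟨hpos, hsub, hdisj⟩, hS⟩ := h
  exact ⟨I, c, r, hop, hb, hpos, hsub, hdisj, hS⟩

theorem IsHomeoOn.exists_inverse {f : ℂ → ℂ} {S T : Set ℂ} (h : IsHomeoOn f S T) :
    ContinuousOn f S ∧ MapsTo f S T ∧ ∃ g : ℂ → ℂ, ContinuousOn g T ∧ MapsTo g T S ∧
      LeftInvOn g f S ∧ LeftInvOn f g T := by
  classical
  obtain ⟨e, he⟩ := h
  have hg : ∀ w : T, (fun w ↦ if h : w ∈ T then (e.symm ⟨w, h⟩ : ℂ) else 0) (w : ℂ) = e.symm w :=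
    fun w ↦ by simp
  set g : ℂ → ℂ := fun w ↦ if h : w ∈ T then (e.symm ⟨w, h⟩ : ℂ) else 0
  have hmaps : MapsTo f S T := fun z hz ↦ he ⟨z, hz⟩ ▸ (e ⟨z, hz⟩).2
  refine ⟨continuousOn_iff_continuous_domRestrict.2 ?_, hmaps, g,
    continuousOn_iff_continuous_domRestrict.2 ?_, fun w hw ↦ ?_, fun z hz ↦ ?_, fun w hw ↦ ?_⟩
  · exact (continuous_subtype_val.comp e.continuous).congr he
  · exact (continuous_subtype_val.comp e.symm.continuous).congr fun w ↦ (hg w).symm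
  · rw [hg ⟨w, hw⟩]
    exact (e.symm ⟨w, hw⟩).2
  · rw [← he ⟨z, hz⟩, hg, e.symm_apply_apply]
  · rw [hg ⟨w, hw⟩, ← he, e.apply_symm_apply]

/-- A locally quasisymmetric homeomorphism between a measure-zero relative
Schottky set in a Jordan domain and another relative Schottky set in a Jordan domain is
locally bi-Lipschitz, and (possibly after conjugation) conformal with continuous
nonvanishing derivative. -/
theorem quasisymmetric_schottky_conformal
    (Ω Ωt S St : Set ℂ) (f : ℂ → ℂ)
    (hΩ : IsJordanDomain Ω) (hΩt : IsJordanDomain Ωt)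
    (hS : IsRelativeSchottkySet Ω S) (hS0 : volume S = 0)
    (hSt : IsRelativeSchottkySet Ωt St)
    (hf : IsHomeoOn f S St) (hqs : LocallyQuasisymmetricOn f S) :
    LocallyBiLipschitzOn f S ∧
    ∃ g : ℂ → ℂ, (g = f ∨ g = fun z => (starRingEnd ℂ) (f z)) ∧
      ∃ g' : ℂ → ℂ, ContinuousOn g' S ∧
        ∀ p ∈ S, g' p ≠ 0 ∧
          Tendsto (fun q => (g q - g p) / (q - p)) (𝓝[S \ {p}] p) (𝓝 (g' p)) := by
  obtain ⟨I, c, r, D⟩ := hS.exists_schottkyData hΩ.2.1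
  obtain ⟨I', c', r', D'⟩ := hSt.exists_schottkyData hΩt.2.1
  obtain ⟨hcont, hmaps, h, hcont', hmaps', hl, hr⟩ := hf.exists_inverse
  have hne : Ω.Nonempty := hΩ.1.2.nonempty
  have hconn : IsPreconnected Ω := hΩ.1.2.isPreconnected
  have hconn' : IsPreconnected Ωt := hΩt.1.2.isPreconnected
  obtain ⟨σ, hσ, hσs⟩ := SchottkyHomeo.exists_index_map
    ⟨D, D', hconn, hconn', hcont, hcont', hmaps, hmaps', hl, hr⟩
  have H : SchottkyHomeo Ω S c r Ωt St (c' ∘ σ) (r' ∘ σ) f h :=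
    ⟨D, D'.reindex hσ, hconn, hconn', hcont, hcont', hmaps, hmaps', hl, hr⟩
  obtain ⟨N, rfl | rfl, hN⟩ := H.exists_orientation hσs hS0
  · obtain ⟨hbl, hder⟩ := H.conformal_of_wind_one hne hσs hqs hS0 hN
    exact ⟨hbl, f, Or.inl rfl, hder⟩
  · obtain ⟨hbl, hder⟩ := H.conj.conformal_of_wind_one hne
      (fun i ↦ SchottkyHomeo.conj_image_sphere (hσs i)) hqs.conj hS0
      fun i ↦ by simpa using (hN i).conj
    refine ⟨fun p hp ↦ ?_, _, Or.inr rfl, hder⟩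
    simpa only [Complex.dist_conj_conj] using hbl p hp
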